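/- Let N ≥ 2 and let D ⊂ ℂ^N be a bounded domain with C² boundary such that the closure of D has a Stein neighbourhood basis. A continuous map Φ : bD → ℂ^N extends holomorphically through D if and only if for every holomorphic map G from some open neighbourhood of the closure of D (the neighbourhood may depend on G) to ℂ^N such that Φ + G ≠ 0 at every point of bD, the Brouwer degree of (Φ + G)|bD is nonnegative. -/

import Mathlib

open Set Metric Bornology MvPolynomial

noncomputable section

/-- An axiomatization of the Brouwer degree `deg f D y` of a continuous map
`f` on the closure of a bounded open set `D` with respect to a value `y ∉ f (frontier D)`,
via the classical normalization, additivity and homotopy-invariance axioms,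
which determine the degree uniquely. -/
structure BrouwerDegreeTheory (E : Type*) [NormedAddCommGroup E] [NormedSpace ℝ E]
    [FiniteDimensional ℝ E] where
  deg : (E → E) → Set E → E → ℤ
  normalization : ∀ (D : Set E) (y : E), IsOpen D → IsBounded D → y ∈ D → deg id D y = 1
  additivity : ∀ (f : E → E) (D D₁ D₂ : Set E) (y : E), IsOpen D → IsBounded D →
    ContinuousOn f (closure D) → IsOpen D₁ → IsOpen D₂ → D₁ ⊆ D → D₂ ⊆ D →
    Disjoint D₁ D₂ → y ∉ f '' (closure D \ (D₁ ∪ D₂)) →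
    deg f D y = deg f D₁ y + deg f D₂ y
  homotopy_invariance : ∀ (H : ℝ → E → E) (D : Set E) (y : ℝ → E), IsOpen D → IsBounded D →
    ContinuousOn (fun p : ℝ × E => H p.1 p.2) (Icc (0:ℝ) 1 ×ˢ closure D) →
    ContinuousOn y (Icc (0:ℝ) 1) →
    (∀ t ∈ Icc (0:ℝ) 1, ∀ x ∈ frontier D, H t x ≠ y t) →
    deg (H 0) D (y 0) = deg (H 1) D (y 1)

/-- A continuous map on the boundary of `D` extends holomorphically through `D`:
there is a map continuous on the closure of `D`, holomorphic on `D`, agreeing with `Φ`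
on the boundary of `D`. -/
def ExtendsHolomorphically {E F : Type*} [NormedAddCommGroup E] [NormedSpace ℂ E]
    [NormedAddCommGroup F] [NormedSpace ℂ F] (Φ : E → F) (D : Set E) : Prop :=
  ∃ g : E → F, ContinuousOn g (closure D) ∧ DifferentiableOn ℂ g D ∧
    ∀ z ∈ frontier D, g z = Φ z

/-- `D` has `C^k` boundary: near each boundary point there is a `C^k` defining function
with nonvanishing differential. -/
def HasCkBoundary {E : Type*} [NormedAddCommGroup E] [NormedSpace ℝ E]
    (k : ℕ∞) (D : Set E) : Prop :=
  ∀ p ∈ frontier D, ∃ (U : Set E) (ρ : E → ℝ), IsOpen U ∧ p ∈ U ∧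
    ContDiffOn ℝ k ρ U ∧ (∀ x ∈ U, fderiv ℝ ρ x ≠ 0) ∧
    D ∩ U = {x ∈ U | ρ x < 0} ∧ frontier D ∩ U = {x ∈ U | ρ x = 0}

/-- An open set `Ω ⊆ ℂ^N` is Stein iff it is holomorphically convex. -/
def IsStein {E : Type*} [NormedAddCommGroup E] [NormedSpace ℂ E] (Ω : Set E) : Prop :=
  IsOpen Ω ∧ ∀ K ⊆ Ω, IsCompact K →
    IsCompact {z ∈ Ω | ∀ f : E → ℂ, DifferentiableOn ℂ f Ω → ‖f z‖ ≤ ⨆ w : K, ‖f (w : E)‖}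

/-- A compact set has a Stein neighbourhood basis if every neighbourhood of it contains
a Stein open neighbourhood of it. -/
def HasSteinNeighbourhoodBasis {E : Type*} [NormedAddCommGroup E] [NormedSpace ℂ E]
    (K : Set E) : Prop :=
  ∀ U : Set E, IsOpen U → K ⊆ U → ∃ Ω : Set E, IsStein Ω ∧ K ⊆ Ω ∧ Ω ⊆ U


open Set Metric Bornology MvPolynomial
noncomputable section

set_option linter.unusedSectionVars false
set_option linter.unusedSimpArgs false
theorem not_mem_of_mem_frontier {X : Type*} [TopologicalSpace X] {D : Set X} (hD : IsOpen D) {x : X}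
    (hx : x ∈ frontier D) : x ∉ D := by
  rw [hD.frontier_eq] at hx; exact hx.2

namespace BrouwerDegreeTheory
section basic
variable {E : Type*} [NormedAddCommGroup E] [NormedSpace ℝ E] [FiniteDimensional ℝ E]
  (𝒟 : BrouwerDegreeTheory E)

theorem deg_empty (f : E → E) (y : E) : 𝒟.deg f ∅ y = 0 := by
  have h := 𝒟.additivity f ∅ ∅ ∅ y isOpen_empty Bornology.isBounded_empty (by simp) isOpen_empty
    isOpen_empty (by simp) (by simp) (by simp) (by simp)
  omega

theorem deg_excise (f : E → E) (D D' : Set E) (y : E) (hD : IsOpen D) (hb : IsBounded D)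
    (hf : ContinuousOn f (closure D)) (hD' : IsOpen D') (hs : D' ⊆ D)
    (h : ∀ x ∈ closure D, x ∉ D' → f x ≠ y) : 𝒟.deg f D y = 𝒟.deg f D' y := by
  have := 𝒟.additivity f D D' ∅ y hD hb hf hD' isOpen_empty hs (by simp) (by simp) (by
    rintro ⟨x, ⟨hx, hx'⟩, hxy⟩
    exact h x hx (by simpa using hx') hxy)
  rw [this, deg_empty, add_zero]

theorem deg_eq_zero (f : E → E) (D : Set E) (y : E) (hD : IsOpen D) (hb : IsBounded D)
    (hf : ContinuousOn f (closure D)) (h : ∀ x ∈ closure D, f x ≠ y) : 𝒟.deg f D y = 0 := by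
  rw [𝒟.deg_excise f D ∅ y hD hb hf isOpen_empty (by simp) (fun x hx _ => h x hx), deg_empty]

theorem deg_segment (f g : E → E) (D : Set E) (hD : IsOpen D) (hb : IsBounded D)
    (hf : ContinuousOn f (closure D)) (hg : ContinuousOn g (closure D))
    (h : ∀ x ∈ frontier D, ∀ t ∈ Icc (0:ℝ) 1, (1 - t) • f x + t • g x ≠ 0) :
    𝒟.deg f D 0 = 𝒟.deg g D 0 := by
  have := 𝒟.homotopy_invariance (fun t x => (1 - t) • f x + t • g x) D (fun _ => 0) hD hb
    (by
      have h1 : ContinuousOn (fun p : ℝ × E => f p.2) (Icc (0:ℝ) 1 ×ˢ closure D) :=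
        hf.comp continuousOn_snd (fun p hp => hp.2)
      have h2 : ContinuousOn (fun p : ℝ × E => g p.2) (Icc (0:ℝ) 1 ×ˢ closure D) :=
        hg.comp continuousOn_snd (fun p hp => hp.2)
      exact ((continuousOn_const.sub continuousOn_fst).smul h1).add (continuousOn_fst.smul h2))
    (by fun_prop) (fun t ht x hx => h x hx t ht)
  simpa using this

theorem deg_congr (f g : E → E) (D : Set E) (hD : IsOpen D) (hb : IsBounded D)
    (hf : ContinuousOn f (closure D)) (hg : ContinuousOn g (closure D))
    (h : ∀ x ∈ frontier D, f x = g x) (h0 : ∀ x ∈ frontier D, f x ≠ 0) :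
    𝒟.deg f D 0 = 𝒟.deg g D 0 := by
  apply 𝒟.deg_segment f g D hD hb hf hg
  intro x hx t _
  rw [← h x hx, ← add_smul]
  simpa using h0 x hx

/-- Rouche. -/
theorem deg_rouche (f g : E → E) (D : Set E) (hD : IsOpen D) (hb : IsBounded D)
    (hf : ContinuousOn f (closure D)) (hg : ContinuousOn g (closure D))
    (h : ∀ x ∈ frontier D, ‖f x - g x‖ < ‖f x‖) :
    𝒟.deg f D 0 = 𝒟.deg g D 0 := by
  apply 𝒟.deg_segment f g D hD hb hf hg
  intro x hx t ht h0
  have : f x = t • (f x - g x) := by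
    have : (1 - t) • f x + t • g x = f x - t • (f x - g x) := by module
    rw [this] at h0
    exact sub_eq_zero.1 h0
  have h1 := h x hx
  have h2 : ‖f x‖ ≤ ‖f x - g x‖ := by
    calc ‖f x‖ = ‖t • (f x - g x)‖ := by rw [← this]
      _ = t * ‖f x - g x‖ := by rw [norm_smul, Real.norm_of_nonneg ht.1]
      _ ≤ 1 * ‖f x - g x‖ := by gcongr; exact ht.2
      _ = _ := one_mul _
  linarith

theorem deg_sub_point (D : Set E) (hD : IsOpen D) (hb : IsBounded D) (p : E) (hp : p ∈ D) :
    𝒟.deg (fun z => z - p) D 0 = 1 := by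
  rw [← 𝒟.normalization D p hD hb hp]
  have := 𝒟.homotopy_invariance (fun t z => z - t • p) D (fun t => (1 - t) • p) hD hb
    (by fun_prop) (by fun_prop) (by
      intro t ht x hx h
      have : x = p := by
        have h2 : x = (1 - t) • p + t • p := by rw [← h]; simp
        rw [h2]; module
      rw [this] at hx
      exact not_mem_of_mem_frontier hD hx hp)
  simp only [zero_smul, sub_zero, one_smul, sub_self] at this
  exact this.symm

theorem deg_linear_move (L : E →L[ℝ] E) (hL : Function.Injective L) (D D' : Set E)
    (hD : IsOpen D) (hb : IsBounded D) (hD' : IsOpen D') (hb' : IsBounded D')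
    (p q : E) (hp : p ∈ D) (hq : q ∈ D') :
    𝒟.deg (fun z => L (z - p)) D 0 = 𝒟.deg (fun z => L (z - q)) D' 0 := by
  obtain ⟨r, hr⟩ := (hb.union hb').subset_ball 0
  have hz : ∀ p x : E, L (x - p) = 0 → x = p := by
    intro p x h
    have : x - p = 0 := hL (by rw [h, map_zero])
    exact sub_eq_zero.1 this
  have e1 : 𝒟.deg (fun z => L (z - p)) (ball 0 r) 0 = 𝒟.deg (fun z => L (z - p)) D 0 := by
    apply 𝒟.deg_excise _ _ _ _ isOpen_ball isBounded_ball (by fun_prop) hD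
      (subset_union_left.trans hr)
    intro x _ hx h
    exact hx (hz _ _ h ▸ hp)
  have e2 : 𝒟.deg (fun z => L (z - q)) (ball 0 r) 0 = 𝒟.deg (fun z => L (z - q)) D' 0 := by
    apply 𝒟.deg_excise _ _ _ _ isOpen_ball isBounded_ball (by fun_prop) hD'
      (subset_union_right.trans hr)
    intro x _ hx h
    exact hx (hz _ _ h ▸ hq)
  rw [← e1, ← e2]
  have hp' : p ∈ ball (0:E) r := hr (Or.inl hp)
  have hq' : q ∈ ball (0:E) r := hr (Or.inr hq)
  have := 𝒟.homotopy_invariance (fun t z => L (z - ((1 - t) • p + t • q))) (ball 0 r) (fun _ => 0)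
    isOpen_ball isBounded_ball (by fun_prop) (by fun_prop) (by
      intro t ht x hx h
      have hx' := hz _ _ h
      have : x ∈ ball (0:E) r := by
        rw [hx']
        exact (convex_ball 0 r) hp' hq' (by linarith [ht.2]) ht.1 (by ring)
      exact not_mem_of_mem_frontier isOpen_ball hx this)
  simpa using this

theorem deg_linear_path (γ : ℝ → E →L[ℝ] E) (hγ : ContinuousOn γ (Icc 0 1))
    (hi : ∀ t ∈ Icc (0:ℝ) 1, Function.Injective (γ t)) (D : Set E)
    (hD : IsOpen D) (hb : IsBounded D) (p : E) (hp : p ∈ D) :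
    𝒟.deg (fun z => γ 0 (z - p)) D 0 = 𝒟.deg (fun z => γ 1 (z - p)) D 0 := by
  refine 𝒟.homotopy_invariance (fun t z => γ t (z - p)) D (fun _ => 0) hD hb ?_ (by fun_prop) ?_
  · have h1 : ContinuousOn (fun p : ℝ × E => γ p.1) (Icc (0:ℝ) 1 ×ˢ closure D) :=
        hγ.comp continuousOn_fst (fun p hp => hp.1)
    exact h1.clm_apply (by fun_prop)
  · intro t ht x hx h
    have : x - p = 0 := hi t ht (by rw [h, map_zero])
    rw [sub_eq_zero.1 this] at hx
    exact not_mem_of_mem_frontier hD hx hp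

/-- Reflection. -/
def refl' (ℓ : E →L[ℝ] ℝ) (e : E) : E →L[ℝ] E :=
  ContinuousLinearMap.id ℝ E - (2:ℝ) • (ℓ.smulRight e)

theorem refl'_apply (ℓ : E →L[ℝ] ℝ) (e v : E) : refl' ℓ e v = v - (2 * ℓ v) • e := by
  simp [refl', mul_smul]

theorem refl'_inj (ℓ : E →L[ℝ] ℝ) (e : E) (h : ℓ e = 1) : Function.Injective (refl' ℓ e) := by
  have : Function.Involutive (refl' ℓ e) := by
    intro v
    simp only [refl'_apply, map_sub, map_smul, h, smul_eq_mul]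
    module
  exact this.injective

theorem deg_refl (ℓ : E →L[ℝ] ℝ) (e : E) (h : ℓ e = 1) (D : Set E)
    (hD : IsOpen D) (hb : IsBounded D) (p : E) (hp : p ∈ D) :
    𝒟.deg (fun z => refl' ℓ e (z - p)) D 0 = -1 := by
  set r : ℝ := ‖e‖ + 1
  have hr : ‖e‖ < r := by simp [r]
  set B := ball (0:E) r
  set f : E → E := fun v => v + (|ℓ v| - ℓ v - 1) • e with hf
  have hfc : Continuous f := by fun_prop
  have key : 𝒟.deg f B 0 = 0 := by
    have h1 := 𝒟.homotopy_invariance (fun t v => v + (|ℓ v| - ℓ v - 1 + 2 * t) • e) B (fun _ => 0)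
      isOpen_ball isBounded_ball (by fun_prop) (by fun_prop) (by
        intro t ht x hx h0
        have hl : ℓ (x + (|ℓ x| - ℓ x - 1 + 2 * t) • e) = 0 := by rw [h0, map_zero]
        simp only [map_add, map_smul, h, smul_eq_mul, mul_one] at hl
        have hxe : x = (ℓ x) • e := by
          have h3 : |ℓ x| - ℓ x - 1 + 2 * t = - ℓ x := by linarith
          rw [h3] at h0
          rw [neg_smul, ← sub_eq_add_neg] at h0
          exact sub_eq_zero.1 h0
        have habs : |ℓ x| ≤ 1 := by linarith [ht.1]
        have : x ∈ B := by
          rw [mem_ball_zero_iff, hxe, norm_smul]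
          calc ‖ℓ x‖ * ‖e‖ ≤ 1 * ‖e‖ := by gcongr; exact habs
            _ < r := by linarith
        exact not_mem_of_mem_frontier isOpen_ball hx this)
    have h2 := 𝒟.deg_eq_zero (fun v => v + (|ℓ v| - ℓ v - 1 + 2 * 1) • e) B 0 isOpen_ball
      isBounded_ball (by fun_prop) (by
        intro x _ h0
        have hl : ℓ (x + (|ℓ x| - ℓ x - 1 + 2 * 1) • e) = 0 := by rw [h0, map_zero]
        simp only [map_add, map_smul, h, smul_eq_mul, mul_one] at hl
        linarith [abs_nonneg (ℓ x)])
    simp only [mul_zero, add_zero] at h1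
    rw [← h2, ← h1]
  set B1 := B ∩ {v | 0 < ℓ v}
  set B2 := B ∩ {v | ℓ v < 0}
  have o1 : IsOpen B1 := isOpen_ball.inter (isOpen_lt continuous_const ℓ.continuous)
  have o2 : IsOpen B2 := isOpen_ball.inter (isOpen_lt ℓ.continuous continuous_const)
  have b1 : IsBounded B1 := isBounded_ball.subset inter_subset_left
  have b2 : IsBounded B2 := isBounded_ball.subset inter_subset_left
  have add := 𝒟.additivity f B B1 B2 0 isOpen_ball isBounded_ball hfc.continuousOn o1 o2
    inter_subset_left inter_subset_left (by
      rw [Set.disjoint_left]; rintro x ⟨_, hx⟩ ⟨_, hx'⟩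
      exact lt_asymm (show 0 < ℓ x from hx) hx') (by
      rintro ⟨x, ⟨hx, hx'⟩, h0⟩
      have hl : ℓ (f x) = 0 := by rw [h0, map_zero]
      simp only [hf, map_add, map_smul, h, smul_eq_mul, mul_one] at hl
      have habs : |ℓ x| = 1 := by linarith
      have hxe : x = (ℓ x) • e := by
        have h3 : |ℓ x| - ℓ x - 1 = - ℓ x := by linarith
        simp only [hf] at h0
        rw [h3, neg_smul, ← sub_eq_add_neg] at h0
        exact sub_eq_zero.1 h0
      have hxB : x ∈ B := by
        rw [mem_ball_zero_iff, hxe, norm_smul, Real.norm_eq_abs, habs]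
        linarith
      apply hx'
      rcases lt_trichotomy (ℓ x) 0 with h4 | h4 | h4
      · exact Or.inr ⟨hxB, h4⟩
      · rw [h4] at habs; simp at habs
      · exact Or.inl ⟨hxB, h4⟩)
  have c1 : closure B1 ⊆ {v | 0 ≤ ℓ v} := closure_minimal (fun x hx => le_of_lt (show 0 < ℓ x from hx.2))
    (isClosed_le continuous_const ℓ.continuous)
  have c2 : closure B2 ⊆ {v | ℓ v ≤ 0} := closure_minimal (fun x hx => le_of_lt (show ℓ x < 0 from hx.2))
    (isClosed_le ℓ.continuous continuous_const)
  have e1 : 𝒟.deg f B1 0 = 1 := by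
    have he : e ∈ B1 := ⟨by simpa [B] using hr, by simp [h]⟩
    rw [← 𝒟.deg_sub_point B1 o1 b1 e he]
    have heq : ∀ x ∈ closure B1, f x = x - e := by
      intro x hx
      have := c1 hx
      simp only [hf, abs_of_nonneg (show 0 ≤ ℓ x from this)]
      module
    apply 𝒟.deg_congr _ _ _ o1 b1 hfc.continuousOn (by fun_prop)
    · intro x hx; exact heq x (frontier_subset_closure hx)
    · intro x hx h0
      rw [heq x (frontier_subset_closure hx), sub_eq_zero] at h0
      exact not_mem_of_mem_frontier o1 hx (h0 ▸ he)
  have he : -e ∈ B2 := ⟨by simpa [B] using hr, by simp [h]⟩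
  have e2 : 𝒟.deg f B2 0 = 𝒟.deg (fun z => refl' ℓ e (z - (-e))) B2 0 := by
    have heq : ∀ x ∈ closure B2, f x = refl' ℓ e (x - (-e)) := by
      intro x hx
      have := c2 hx
      simp only [hf, abs_of_nonpos (show ℓ x ≤ 0 from this), refl'_apply, map_sub, map_neg, h]
      module
    apply 𝒟.deg_congr _ _ _ o2 b2 hfc.continuousOn (by fun_prop)
    · intro x hx; exact heq x (frontier_subset_closure hx)
    · intro x hx h0
      rw [heq x (frontier_subset_closure hx)] at h0
      have := refl'_inj ℓ e h (h0.trans (map_zero _).symm)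
      exact not_mem_of_mem_frontier o2 hx (sub_eq_zero.1 this ▸ he)
  rw [𝒟.deg_linear_move _ (refl'_inj ℓ e h) D B2 hD hb o2 b2 p (-e) hp he]
  omega

end basic
end BrouwerDegreeTheory
end

open Set Metric Bornology MvPolynomial
noncomputable section

namespace BrouwerDegreeTheory
section cplx
variable {E : Type*} [NormedAddCommGroup E] [NormedSpace ℂ E] [FiniteDimensional ℂ E]

theorem exists_path_id (A : E →L[ℂ] E) (hA : Function.Injective A) :
    ∃ γ : ℝ → E →L[ℂ] E, Continuous γ ∧ (∀ t ∈ Icc (0:ℝ) 1, Function.Injective (γ t)) ∧ γ 0 = A ∧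
      γ 1 = ContinuousLinearMap.id ℂ E := by
  set bad : Set ℂ := {μ | ¬ Function.Injective ((1 - μ) • A + μ • ContinuousLinearMap.id ℂ E)}
  have hfin : {μ | Module.End.HasEigenvalue (A : E →ₗ[ℂ] E) μ}.Finite := by
    exact Module.End.finite_hasEigenvalue _
  have hbad : bad.Countable := by
    refine ((hfin.image (fun l => l / (l - 1))).subset ?_).countable
    intro μ hμ
    have h1 : μ ≠ 1 := by
      rintro rfl
      apply hμ
      intro x y hxy
      simpa using hxy
    have hex : ∃ v : E, v ≠ 0 ∧ (1 - μ) • A v + μ • v = 0 := by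
      by_contra hcon
      push Not at hcon
      apply hμ
      rw [injective_iff_map_eq_zero]
      intro v hv
      by_contra hv0
      exact hcon v hv0 (by simpa using hv)
    obtain ⟨v, hv, h0⟩ := hex
    have h1' : μ - 1 ≠ 0 := sub_ne_zero.2 h1
    refine ⟨μ / (μ - 1), ?_, ?_⟩
    · apply Module.End.hasEigenvalue_of_hasEigenvector (x := v)
      rw [Module.End.hasEigenvector_iff, Module.End.mem_eigenspace_iff]
      refine ⟨?_, hv⟩
      have : (μ - 1) • A v = μ • v := by
        have : (μ - 1) • A v = μ • v - ((1 - μ) • A v + μ • v) := by module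
        rw [this, h0, sub_zero]
      rw [div_eq_inv_mul, mul_smul, ← this, smul_smul, inv_mul_cancel₀ h1', one_smul]
      rfl
    · field_simp
      ring
  have hpc : IsPathConnected badᶜ := hbad.isPathConnected_compl_of_one_lt_rank (by
    rw [Complex.rank_real_complex]; exact_mod_cast Nat.one_lt_two)
  obtain ⟨γ, hγ⟩ := hpc.joinedIn 0 (by simp [bad, hA]) 1 (by
    simp only [bad, mem_compl_iff, mem_ofPred_eq, not_not]
    intro x y hxy
    simpa using hxy)
  refine ⟨fun t => (1 - γ.extend t) • A + γ.extend t • ContinuousLinearMap.id ℂ E, ?_, ?_, ?_, ?_⟩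
  · have := γ.continuous_extend
    fun_prop
  · intro t ht
    have := hγ ⟨t, ht⟩
    simp only [Path.extend_apply _ ht]
    simpa [bad] using this
  · simp
  · simp

variable [NormedSpace ℝ E] [IsScalarTower ℝ ℂ E] [FiniteDimensional ℝ E]
variable  (𝒟 : BrouwerDegreeTheory E)

theorem deg_comp_complex (R : E →L[ℝ] E) (hR : Function.Injective R) (A : E →L[ℂ] E)
    (hA : Function.Injective A) (D : Set E)
    (hD : IsOpen D) (hb : IsBounded D) (p : E) (hp : p ∈ D) :
    𝒟.deg (fun z => R (A (z - p))) D 0 = 𝒟.deg (fun z => R (z - p)) D 0 := by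
  obtain ⟨γ, h1, h2, h3, h4⟩ := exists_path_id A hA
  have := 𝒟.deg_linear_path (fun t => R.comp ((γ t).restrictScalars ℝ)) (by
    have : Continuous (fun t => (γ t).restrictScalars ℝ) :=
      (ContinuousLinearMap.continuous_restrictScalars (𝕜 := ℂ) (𝕜' := ℝ)).comp h1
    fun_prop) (fun t ht => hR.comp (h2 t ht)) D hD hb p hp
  simpa [h3, h4] using this

theorem deg_complex (A : E →L[ℂ] E) (hA : Function.Injective A) (D : Set E)
    (hD : IsOpen D) (hb : IsBounded D) (p : E) (hp : p ∈ D) :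
    𝒟.deg (fun z => A (z - p)) D 0 = 1 := by
  have := 𝒟.deg_comp_complex (ContinuousLinearMap.id ℝ E) Function.injective_id A hA D hD hb p hp
  simpa [𝒟.deg_sub_point D hD hb p hp] using this

theorem deg_local (f : E → E) (A : E →L[ℂ] E) (hA : Function.Injective A) (p : E)
    (h : HasFDerivAt f A p) (hp : f p = 0) (D : Set E) (hD : IsOpen D) (hpD : p ∈ D)
    (hf : ContinuousOn f D) : ∃ ε > 0, ∀ r, 0 < r → r < ε → 𝒟.deg f (ball p r) 0 = 1 := by
  obtain ⟨c, hc, hc'⟩ : ∃ c > 0, ∀ v, c * ‖v‖ ≤ ‖A v‖ := by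
    obtain ⟨K, hK, hK'⟩ := (A : E →ₗ[ℂ] E).exists_antilipschitzWith (LinearMap.ker_eq_bot.2 hA)
    refine ⟨(K:ℝ)⁻¹, by positivity, fun v => ?_⟩
    have := hK'.le_mul_dist v 0
    simp only [dist_zero_right, map_zero] at this
    rw [inv_mul_le_iff₀ (by exact_mod_cast hK)]
    exact this
  have h2 := (hasFDerivAt_iff_isLittleO_nhds_zero.1 h).def (half_pos hc)
  rw [Metric.eventually_nhds_iff] at h2
  obtain ⟨ε₁, hε₁, h3⟩ := h2
  obtain ⟨ε₂, hε₂, h4⟩ := Metric.isOpen_iff.1 hD p hpD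
  refine ⟨min ε₁ ε₂, lt_min hε₁ hε₂, fun r hr hr' => ?_⟩
  have hcl : closure (ball p r) ⊆ D := by
    refine closure_ball_subset_closedBall.trans ((closedBall_subset_ball (lt_of_lt_of_le hr' (min_le_right _ _))).trans h4)
  rw [← 𝒟.deg_complex A hA (ball p r) isOpen_ball isBounded_ball p (mem_ball_self hr)]
  symm
  apply 𝒟.deg_rouche _ _ _ isOpen_ball isBounded_ball (by fun_prop) (hf.mono hcl)
  intro x hx
  have hx' : dist x p ≤ r := closure_ball_subset_closedBall (frontier_subset_closure hx)
  have hx0 : x ≠ p := by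
    rintro rfl
    exact not_mem_of_mem_frontier isOpen_ball hx (mem_ball_self hr)
  have h5 := h3 (y := x - p) (by
    rw [dist_zero_right, ← dist_eq_norm]; exact lt_of_le_of_lt hx' (lt_of_lt_of_le hr' (min_le_left _ _)))
  rw [add_sub_cancel, hp, sub_zero] at h5
  rw [norm_sub_rev]
  have : 0 < ‖x - p‖ := norm_pos_iff.2 (sub_ne_zero.2 hx0)
  have := hc' (x - p)
  nlinarith

theorem deg_finite (f : E → E) (Z : Finset E) : ∀ (D : Set E), IsOpen D → IsBounded D →
    ContinuousOn f (closure D) → (∀ x ∈ closure D, f x = 0 → x ∈ Z) → (∀ x ∈ Z, x ∈ D) →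
    (∀ x ∈ Z, f x = 0 ∧ ∃ A : E →L[ℂ] E, Function.Injective A ∧ HasFDerivAt f A x) →
    𝒟.deg f D 0 = Z.card := by
  classical
  induction Z using Finset.induction_on with
  | empty =>
    intro D hD hb hf h0 _ _
    simpa using 𝒟.deg_eq_zero f D 0 hD hb hf (fun x hx h => by simpa using h0 x hx h)
  | insert p Z hpZ ih =>
    intro D hD hb hf h0 hZ hA
    obtain ⟨hp0, A, hAi, hAd⟩ := hA p (by simp)
    have hpD := hZ p (by simp)
    obtain ⟨ε, hε, hloc⟩ := 𝒟.deg_local f A hAi p hAd hp0 D hD hpD (hf.mono subset_closure)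
    have hopen : IsOpen (D \ (Z : Set E)) := hD.sdiff Z.finite_toSet.isClosed
    obtain ⟨ε₂, hε₂, h4⟩ := Metric.isOpen_iff.1 hopen p ⟨hpD, by simpa using hpZ⟩
    obtain ⟨r, hr, hr'⟩ := exists_between (lt_min hε hε₂)
    have hrε : r < ε := lt_of_lt_of_le hr' (min_le_left _ _)
    have hrε₂ : r < ε₂ := lt_of_lt_of_le hr' (min_le_right _ _)
    have hsub : closedBall p r ⊆ D \ (Z : Set E) := (closedBall_subset_ball hrε₂).trans h4
    set D₂ := D \ closedBall p r
    have hD₂ : IsOpen D₂ := hD.sdiff isClosed_closedBall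
    have hcl2 : closure D₂ ⊆ closure D \ ball p r := by
      intro x hx
      refine ⟨closure_mono sdiff_subset hx, fun hxb => ?_⟩
      obtain ⟨y, hy, hy'⟩ := mem_closure_iff.1 hx _ isOpen_ball hxb
      exact hy'.2 (ball_subset_closedBall hy)
    have hadd := 𝒟.additivity f D (ball p r) D₂ 0 hD hb hf isOpen_ball hD₂
      (fun x hx => (hsub (ball_subset_closedBall hx)).1) sdiff_subset
      (by rw [Set.disjoint_left]; intro x hx hx'; exact hx'.2 (ball_subset_closedBall hx)) (by
        rintro ⟨x, ⟨hx, hx'⟩, hfx⟩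
        have := h0 x hx hfx
        rw [Finset.mem_insert] at this
        rcases this with rfl | h
        · exact hx' (Or.inl (mem_ball_self hr))
        · exact hx' (Or.inr ⟨hZ x (by simp [h]), fun hxc => (hsub hxc).2 h⟩))
    rw [hadd, hloc r hr hrε, ih D₂ hD₂ (hb.subset sdiff_subset) (hf.mono (closure_mono sdiff_subset))]
    · rw [Finset.card_insert_of_notMem hpZ]; push_cast; ring
    · intro x hx hfx
      have := h0 x (closure_mono sdiff_subset hx) hfx
      rw [Finset.mem_insert] at this
      rcases this with rfl | h
      · exact absurd (mem_ball_self hr) (hcl2 hx).2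
      · exact h
    · intro x hx
      exact ⟨hZ x (by simp [hx]), fun hxc => (hsub hxc).2 hx⟩
    · intro x hx
      exact hA x (by simp [hx])

theorem deg_nonneg (f : E → E) (D : Set E) (hD : IsOpen D) (hb : IsBounded D)
    (hf : ContinuousOn f (closure D)) (hd : DifferentiableOn ℂ f D)
    (h0 : ∀ x ∈ frontier D, f x ≠ 0) : 0 ≤ 𝒟.deg f D 0 := by
  let _ : MeasurableSpace E := borel E
  have : BorelSpace E := ⟨rfl⟩
  have : ProperSpace E := FiniteDimensional.proper ℝ E
  have hcpt : IsCompact (closure D) := hb.isCompact_closure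
  -- lower bound
  obtain ⟨ε, hε, hlow⟩ : ∃ ε > 0, ∀ x ∈ frontier D, ε ≤ ‖f x‖ := by
    have hcf : IsCompact (frontier D) := hcpt.of_isClosed_subset isClosed_frontier frontier_subset_closure
    rcases (frontier D).eq_empty_or_nonempty with h | h
    · exact ⟨1, one_pos, by simp [h]⟩
    · obtain ⟨x, hx, hmin⟩ := hcf.exists_isMinOn h (hf.mono frontier_subset_closure).norm
      exact ⟨‖f x‖, norm_pos_iff.2 (h0 x hx), fun y hy => hmin hy⟩
  -- Sard
  set f' : E → E →L[ℝ] E := fun x => (fderiv ℂ f x).restrictScalars ℝ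
  set S : Set E := {x ∈ D | (f' x).det = 0}
  have hSard : MeasureTheory.Measure.addHaar (f '' S) = 0 := by
    apply MeasureTheory.addHaar_image_eq_zero_of_det_fderivWithin_eq_zero (f' := f')
    · intro x hx
      exact ((hd.differentiableAt (hD.mem_nhds hx.1)).hasFDerivAt.restrictScalars ℝ).hasFDerivWithinAt
    · intro x hx; exact hx.2
  obtain ⟨y, hyε, hyS⟩ : ∃ y ∈ ball (0:E) ε, y ∉ f '' S := by
    by_contra hcon
    push Not at hcon
    have h1 : MeasureTheory.Measure.addHaar (ball (0:E) ε) = 0 :=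
      MeasureTheory.measure_mono_null hcon hSard
    exact (isOpen_ball.measure_pos _ ⟨0, mem_ball_self hε⟩).ne' h1
  rw [mem_ball_zero_iff] at hyε
  set g : E → E := fun x => f x - y
  have hg : ContinuousOn g (closure D) := hf.sub continuousOn_const
  have heq : 𝒟.deg f D 0 = 𝒟.deg g D 0 := by
    apply 𝒟.deg_rouche f g D hD hb hf hg
    intro x hx
    simpa [g] using lt_of_lt_of_le hyε (hlow x hx)
  rw [heq]
  set Z : Set E := {x ∈ closure D | g x = 0}
  have hZD : Z ⊆ D := by
    intro x hx
    by_contra hxD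
    have hxf : x ∈ frontier D := by rw [hD.frontier_eq]; exact ⟨hx.1, hxD⟩
    have := hlow x hxf
    rw [sub_eq_zero.1 (show f x - y = 0 from hx.2)] at this
    linarith
  have hZA : ∀ x ∈ Z, Function.Injective (fderiv ℂ f x) ∧ HasFDerivAt g (fderiv ℂ f x) x := by
    intro x hx
    have hxD := hZD hx
    refine ⟨?_, (hd.differentiableAt (hD.mem_nhds hxD)).hasFDerivAt.sub_const y⟩
    have hdet : (f' x).det ≠ 0 := by
      intro h
      exact hyS ⟨x, ⟨hxD, h⟩, sub_eq_zero.1 hx.2⟩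
    have hu : IsUnit ((f' x : E →ₗ[ℝ] E)) := by
      rw [LinearMap.isUnit_iff_isUnit_det]
      exact (isUnit_iff_ne_zero.2 hdet)
    have := (Module.End.isUnit_iff _).1 hu
    exact this.injective
  have hZc : IsClosed Z := hg.preimage_isClosed_of_isClosed isClosed_closure isClosed_singleton
  have hZcpt : IsCompact Z := hcpt.of_isClosed_subset hZc (fun x hx => hx.1)
  have hZfin : Z.Finite := by
    by_contra hinf
    obtain ⟨x, hx, hacc⟩ := Set.Infinite.exists_accPt_of_subset_isCompact hinf hZcpt subset_rfl
    have hK := (fderiv ℂ f x : E →ₗ[ℂ] E).exists_antilipschitzWith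
      (LinearMap.ker_eq_bot.2 (hZA x hx).1)
    have h2 := (hZA x hx).2.eventually_ne (c := 0) ⟨hK.choose, hK.choose_spec.2⟩
    rw [accPt_iff_frequently_nhdsNE] at hacc
    exact hacc (h2.mono fun z hz hzZ => hz hzZ.2)
  have := 𝒟.deg_finite g hZfin.toFinset D hD hb hg (fun x hx h => by simpa using ⟨hx, h⟩)
    (fun x hx => hZD (by simpa using hx)) (fun x hx => by
      have hx : x ∈ Z := by simpa using hx
      exact ⟨hx.2, _, hZA x hx⟩)
  rw [this]
  positivity
end cplx
end BrouwerDegreeTheory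
end

open Set Metric Bornology MvPolynomial
noncomputable section
namespace OneVar
open Complex Real

theorem trig_approx (u : ℂ → ℂ) (c : ℂ) (R : ℝ) (hR : 0 < R) (hu : ContinuousOn u (sphere c R))
    (ε : ℝ) (hε : 0 < ε) : ∃ p q : Polynomial ℂ, ∀ w ∈ sphere c R,
      ‖u w - (p.eval w + (starRingEnd ℂ) (q.eval w))‖ ≤ ε := by
  have : Fact (0 < 2 * π) := ⟨by positivity⟩
  set g : C(AddCircle (2 * π), ℂ) := ⟨fun x => u (c + R * (AddCircle.toCircle x : ℂ)), by
    refine hu.comp_continuous (by have := AddCircle.continuous_toCircle (T := 2 * π); fun_prop) ?_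
    intro x
    simp only [mem_sphere, dist_eq_norm, add_sub_cancel_left, norm_mul, Circle.norm_coe, mul_one, norm_real, Real.norm_of_nonneg hR.le]⟩
  have hg : g ∈ (Submodule.span ℂ (range <| @fourier (2 * π))).topologicalClosure := by
    rw [span_fourier_closure_eq_top]; trivial
  obtain ⟨h, hh, hgh⟩ := Metric.mem_closure_iff.1 hg ε hε
  have key : ∃ p q : Polynomial ℂ, ∀ x, h x = p.eval (c + R * (AddCircle.toCircle x : ℂ)) +
      (starRingEnd ℂ) (q.eval (c + R * (AddCircle.toCircle x : ℂ))) := by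
    refine Submodule.span_induction (p := fun h _ => ∃ p q : Polynomial ℂ, ∀ x, h x = p.eval (c + R * (AddCircle.toCircle x : ℂ)) +
      (starRingEnd ℂ) (q.eval (c + R * (AddCircle.toCircle x : ℂ)))) ?_ ?_ ?_ ?_ hh
    · rintro _ ⟨n, rfl⟩
      have hRc : (R:ℂ) ≠ 0 := by exact_mod_cast hR.ne'
      rcases Int.eq_nat_or_neg n with ⟨m, rfl | rfl⟩
      · refine ⟨(Polynomial.C (R:ℂ)⁻¹ * (Polynomial.X - Polynomial.C c)) ^ m, 0, fun x => ?_⟩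
        simp [hRc, AddCircle.toCircle_nsmul]
      · refine ⟨0, (Polynomial.C (R:ℂ)⁻¹ * (Polynomial.X - Polynomial.C c)) ^ m, fun x => ?_⟩
        simp only [fourier_apply, neg_smul, AddCircle.toCircle_neg, natCast_zsmul,
          AddCircle.toCircle_nsmul, Circle.coe_inv_eq_conj]
        simp [hRc]
    · exact ⟨0, 0, by simp⟩
    · rintro x y _ _ ⟨p, q, h1⟩ ⟨p', q', h2⟩
      exact ⟨p + p', q + q', fun t => by simp [h1, h2]; ring⟩
    · rintro a x _ ⟨p, q, h1⟩
      exact ⟨Polynomial.C a * p, Polynomial.C ((starRingEnd ℂ) a) * q, fun t => by simp [h1]; ring⟩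
  obtain ⟨p, q, hpq⟩ := key
  refine ⟨p, q, fun w hw => ?_⟩
  have hRc : (R:ℂ) ≠ 0 := by exact_mod_cast hR.ne'
  obtain ⟨x, hx⟩ : ∃ x : AddCircle (2 * π), (AddCircle.toCircle x : ℂ) = (w - c) / R := by
    have hw' : ‖(w - c) / R‖ = 1 := by
      rw [mem_sphere, dist_eq_norm] at hw
      rw [norm_div, hw, norm_real, Real.norm_of_nonneg hR.le, div_self hR.ne']
    obtain ⟨x, hx⟩ := (AddCircle.homeomorphCircle (T := 2 * π) (by positivity)).surjective ⟨_, mem_sphere_zero_iff_norm.2 hw'⟩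
    rw [AddCircle.homeomorphCircle_apply] at hx
    exact ⟨x, by rw [hx]⟩
  have h2 : c + R * (AddCircle.toCircle x : ℂ) = w := by
    rw [hx]; field_simp; ring
  have h1 : ‖g x - h x‖ ≤ ε := by
    rw [← dist_eq_norm]
    exact (ContinuousMap.dist_apply_le_dist x).trans hgh.le
  rw [hpq, h2] at h1
  simpa [g, h2] using h1

theorem re_max (u : ℂ → ℂ) (S : Set ℂ) (z : ℂ) (hb : ∃ K, ∀ w ∈ S, ‖u w‖ ≤ K)
    (H : ∀ T : ℝ, ∀ M : ℝ, (∀ w ∈ S, ‖u w + T‖ ≤ M) → ‖u z + T‖ ≤ M) (m : ℝ)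
    (hm : ∀ w ∈ S, (u w).re ≤ m) : (u z).re ≤ m := by
  obtain ⟨K, hK⟩ := hb
  by_contra hcon
  push Not at hcon
  have key : ∀ T : ℝ, 0 < T → 2 * T * ((u z).re - m) ≤ K ^ 2 := by
    intro T hT
    have h0 : ∀ w ∈ S, ‖u w + T‖ ^ 2 ≤ K ^ 2 + 2 * T * m + T ^ 2 := by
      intro w hw
      rw [← Complex.normSq_eq_norm_sq, Complex.normSq_apply]
      have h2 : (u w).re * (u w).re + (u w).im * (u w).im ≤ K ^ 2 := by
        rw [← Complex.normSq_apply, Complex.normSq_eq_norm_sq]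
        exact pow_le_pow_left₀ (norm_nonneg _) (hK w hw) 2
      simp only [add_re, ofReal_re, add_im, ofReal_im, add_zero]
      nlinarith [hm w hw]
    have h1 := H T (√(K ^ 2 + 2 * T * m + T ^ 2)) (fun w hw => Real.le_sqrt_of_sq_le (h0 w hw))
    rcases le_or_gt 0 (K ^ 2 + 2 * T * m + T ^ 2) with h3 | h3
    · have h4 := (Real.le_sqrt (norm_nonneg _) h3).1 h1
      rw [← Complex.normSq_eq_norm_sq, Complex.normSq_apply] at h4
      simp only [add_re, ofReal_re, add_im, ofReal_im, add_zero] at h4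
      nlinarith [sq_nonneg ((u z).re), sq_nonneg ((u z).im)]
    · exfalso
      have h5 := H T (-1) (fun w hw => by nlinarith [h0 w hw, sq_nonneg ‖u w + T‖])
      linarith [norm_nonneg (u z + T)]
  have h0 : 0 < (u z).re - m := by linarith
  have := key ((K ^ 2 + 1) / (u z - m).re) (by simp; positivity)
  simp only [sub_re, ofReal_re] at this
  rw [mul_assoc, div_mul_cancel₀ _ h0.ne'] at this
  nlinarith [sq_nonneg K]

theorem poisson_of_max (u : ℂ → ℂ) (c : ℂ) (R : ℝ) (hR : 0 < R) (hu : ContinuousOn u (sphere c R))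
    (H : ∀ (k : ℂ) (p : Polynomial ℂ) (M : ℝ), (∀ w ∈ sphere c R, ‖k * u w + p.eval w‖ ≤ M) →
      ∀ z ∈ ball c R, ‖k * u z + p.eval z‖ ≤ M) (z : ℂ) (hz : z ∈ ball c R) :
    Real.circleAverage (fun w => (poissonKernel c z w : ℂ) * u w) c R = u z := by
  have hcomp : IsCompact (sphere c R) := isCompact_sphere _ _
  have hPc : ContinuousOn (fun w => (poissonKernel c z w : ℂ)) (sphere c R) := by
    simp only [poissonKernel_def]
    apply Complex.continuous_ofReal.comp_continuousOn
    apply ContinuousOn.div (by fun_prop) (by fun_prop)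
    intro w hw
    rw [mem_sphere, dist_eq_norm] at hw
    rw [mem_ball, dist_eq_norm] at hz
    have : (w - c) - (z - c) ≠ 0 := by
      intro h
      rw [sub_eq_zero.1 h] at hw
      linarith
    positivity
  have hPpos : ∀ w ∈ sphere c R, 0 ≤ poissonKernel c z w := by
    intro w hw
    rw [mem_sphere, dist_eq_norm] at hw
    rw [mem_ball, dist_eq_norm] at hz
    rw [poissonKernel_def, hw]
    have : ‖z - c‖ ^ 2 ≤ R ^ 2 := pow_le_pow_left₀ (norm_nonneg _) hz.le 2
    apply div_nonneg (by linarith) (by positivity)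
  have hci : ∀ f : ℂ → ℂ, ContinuousOn f (sphere c R) →
      CircleIntegrable (fun w => (poissonKernel c z w : ℂ) * f w) c R := by
    intro f hf
    exact (hPc.mul hf).circleIntegrable hR.le
  have hpoly : ∀ p : Polynomial ℂ, Real.circleAverage (fun w => (poissonKernel c z w : ℂ) * p.eval w) c R = p.eval z := by
    intro p
    have := DiffContOnCl.circleAverage_poissonKernel_smul (f := fun w => p.eval w) (c := c) (R := R) (w := z)
      (p.differentiable.diffContOnCl) hz
    rw [← this]
    rfl
  have hbdd : ∀ f : ℂ → ℂ, ContinuousOn f (sphere c R) → ∀ ε, (∀ w ∈ sphere c R, ‖f w‖ ≤ ε) →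
      ‖Real.circleAverage (fun w => (poissonKernel c z w : ℂ) * f w) c R‖ ≤ ε := by
    intro f hf ε hfe
    have h1 : Real.circleAverage (fun w => (poissonKernel c z w)) c R = 1 := by
      have h2 := hpoly 1
      simp only [Polynomial.eval_one, mul_one] at h2
      have h3 := ContinuousLinearMap.circleAverage_comp_comm Complex.ofRealCLM
        (f := fun w => poissonKernel c z w) (c := c) (R := R) (by
          have : ContinuousOn (fun w => poissonKernel c z w) (sphere c R) := by
            have := Complex.continuous_re.comp_continuousOn hPc
            simpa [Function.comp_def] using this
          exact this.circleIntegrable hR.le)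
      have h4 : (Complex.ofRealCLM ∘ fun w => poissonKernel c z w) = (fun w => (poissonKernel c z w : ℂ)) := rfl
      rw [h4, h2] at h3
      rw [Complex.ofRealCLM_apply] at h3
      exact_mod_cast h3.symm
    rw [Real.circleAverage_def] at h1 ⊢
    rw [norm_smul, Real.norm_of_nonneg (by positivity)]
    have h5 : ‖∫ θ in (0:ℝ)..2 * π, (poissonKernel c z (circleMap c R θ) : ℂ) * f (circleMap c R θ)‖ ≤
        ∫ θ in (0:ℝ)..2 * π, poissonKernel c z (circleMap c R θ) * ε := by
      apply intervalIntegral.norm_integral_le_of_norm_le (by positivity)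
      · filter_upwards with θ _
        have hw : circleMap c R θ ∈ sphere c R := circleMap_mem_sphere _ hR.le _
        rw [norm_mul, Complex.norm_real, Real.norm_of_nonneg (hPpos _ hw)]
        exact mul_le_mul_of_nonneg_left (hfe _ hw) (hPpos _ hw)
      · apply Continuous.intervalIntegrable
        have h6 : Continuous (fun θ => (poissonKernel c z (circleMap c R θ) : ℂ)) :=
          hPc.comp_continuous (continuous_circleMap _ _) (fun θ => circleMap_mem_sphere _ hR.le _)
        have h7 := (Complex.continuous_re.comp h6)
        simp only [Function.comp_def, Complex.ofReal_re] at h7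
        exact h7.mul continuous_const
    rw [intervalIntegral.integral_mul_const] at h5
    calc _ ≤ (2 * π)⁻¹ * ((∫ θ in (0:ℝ)..2 * π, poissonKernel c z (circleMap c R θ)) * ε) := by gcongr
      _ = ε := by
        rw [← mul_assoc]
        simp only [smul_eq_mul] at h1
        rw [h1, one_mul]
  obtain ⟨K, hK⟩ := hcomp.exists_bound_of_continuousOn hu
  apply eq_of_forall_dist_le
  intro ε' hε'
  set ε := ε' / 3
  obtain ⟨p, q, hpq⟩ := trig_approx u c R hR hu ε (by positivity)
  -- inside estimates
  have hin : ∀ (k : ℂ) (r : Polynomial ℂ) (m : ℝ), (∀ w ∈ sphere c R, (k * u w + r.eval w).re ≤ m) →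
      (k * u z + r.eval z).re ≤ m := by
    intro k r m hm
    refine re_max (fun w => k * u w + r.eval w) (sphere c R) z ?_ ?_ m hm
    · have : ContinuousOn (fun w => k * u w + r.eval w) (sphere c R) :=
        (continuousOn_const.mul hu).add r.continuous.continuousOn
      exact hcomp.exists_bound_of_continuousOn this
    · intro T M hM
      have := H k (r + Polynomial.C (T:ℂ)) M (by
        intro w hw
        have := hM w hw
        simpa [add_assoc] using this) z hz
      simpa [add_assoc] using this
  have hre : ∀ v : ℂ, ‖v‖ ≤ ε → v.re ≤ ε ∧ -v.re ≤ ε ∧ v.im ≤ ε ∧ - v.im ≤ ε := by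
    intro v hv
    have h1 := (abs_le.1 ((Complex.abs_re_le_norm v).trans hv))
    have h2 := (abs_le.1 ((Complex.abs_im_le_norm v).trans hv))
    exact ⟨h1.2, by linarith [h1.1], h2.2, by linarith [h2.1]⟩
  have i1 := hin 1 (-(p + q)) ε (fun w hw => by
    have := (hre _ (hpq w hw)).1
    simp at this ⊢; linarith)
  have i2 := hin (-1) (p + q) ε (fun w hw => by
    have := (hre _ (hpq w hw)).2.1
    simp at this ⊢; linarith)
  have i3 := hin (-I) (Polynomial.C I * (p - q)) ε (fun w hw => by
    have := (hre _ (hpq w hw)).2.2.1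
    simp at this ⊢; linarith)
  have i4 := hin (I) (-(Polynomial.C I * (p - q))) ε (fun w hw => by
    have := (hre _ (hpq w hw)).2.2.2
    simp at this ⊢; linarith)
  have hz1 : ‖u z - (p.eval z + (starRingEnd ℂ) (q.eval z))‖ ≤ 2 * ε := by
    refine (Complex.norm_le_abs_re_add_abs_im _).trans ?_
    have a1 : |(u z - (p.eval z + (starRingEnd ℂ) (q.eval z))).re| ≤ ε := by
      rw [abs_le]; simp at i1 i2 ⊢; constructor <;> linarith
    have a2 : |(u z - (p.eval z + (starRingEnd ℂ) (q.eval z))).im| ≤ ε := by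
      rw [abs_le]; simp at i3 i4 ⊢; constructor <;> linarith
    linarith
  have hconj : Real.circleAverage (fun w => (poissonKernel c z w : ℂ) * (starRingEnd ℂ) (q.eval w)) c R =
      (starRingEnd ℂ) (q.eval z) := by
    have h3 := ContinuousLinearMap.circleAverage_comp_comm (Complex.conjCLE : ℂ →L[ℝ] ℂ)
        (f := fun w => (poissonKernel c z w : ℂ) * q.eval w) (c := c) (R := R)
        (hci _ q.continuous.continuousOn)
    rw [hpoly] at h3
    simp only [Function.comp_def] at h3
    simpa using h3
  have hsum : Real.circleAverage (fun w => (poissonKernel c z w : ℂ) *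
      (p.eval w + (starRingEnd ℂ) (q.eval w))) c R = p.eval z + (starRingEnd ℂ) (q.eval z) := by
    simp only [mul_add]
    rw [Real.circleAverage_fun_add (hci _ p.continuous.continuousOn)
      (hci (fun w => (starRingEnd ℂ) (q.eval w)) (Complex.continuous_conj.comp q.continuous).continuousOn), hpoly, hconj]
  have hdiff := hbdd (fun w => u w - (p.eval w + (starRingEnd ℂ) (q.eval w))) (by
    have h1 := p.continuous
    have h2 := (Complex.continuous_conj.comp q.continuous)
    exact hu.sub (h1.add h2).continuousOn) ε hpq
  simp only [mul_sub] at hdiff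
  rw [Real.circleAverage_fun_sub (hci _ hu) (hci (fun w => p.eval w + (starRingEnd ℂ) (q.eval w)) (p.continuous.add
    (Complex.continuous_conj.comp q.continuous)).continuousOn), hsum] at hdiff
  rw [dist_eq_norm]
  calc _ = ‖(Real.circleAverage (fun w => (poissonKernel c z w : ℂ) * u w) c R - (p.eval z + (starRingEnd ℂ) (q.eval z))) -
      (u z - (p.eval z + (starRingEnd ℂ) (q.eval z)))‖ := by congr 1; ring
    _ ≤ ε + 2 * ε := (norm_sub_le _ _).trans (add_le_add hdiff hz1)
    _ = ε' := by simp only [ε]; ring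

theorem holo_of_max (F : ℂ → ℂ) (c : ℂ) (R : ℝ) (hR : 0 < R) (hu : ContinuousOn F (sphere c R))
    (H : ∀ (p q : Polynomial ℂ) (M : ℝ), (∀ w ∈ sphere c R, ‖q.eval w * F w + p.eval w‖ ≤ M) →
      ∀ z ∈ ball c R, ‖q.eval z * F z + p.eval z‖ ≤ M) :
    DifferentiableOn ℂ F (ball c R) := by
  have hne : ∀ z ∈ ball c R, ∀ w ∈ sphere c R, w - z ≠ 0 := by
    intro z hz w hw h
    rw [sub_eq_zero.1 h] at hw
    exact (sphere_disjoint_ball.le_bot ⟨hw, hz⟩)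
  have key : ∀ z ∈ ball c R, F z = (2 * π * I : ℂ)⁻¹ • ∮ w in C(c, R), (w - z)⁻¹ • F w := by
    intro z hz
    have h1 := poisson_of_max F c R hR hu (fun k p M h z hz => by
      have := H p (Polynomial.C k) M (by simpa using h) z hz
      simpa using this) z hz
    have h2 := poisson_of_max (fun w => (w - c) * F w) c R hR (by fun_prop) (fun k p M h z hz => by
      have := H p (Polynomial.C k * (Polynomial.X - Polynomial.C c)) M
        (by simpa [mul_assoc] using h) z hz
      simpa [mul_assoc] using this) z hz
    -- conj kernel vanishes
    have hzR : ‖z - c‖ < R := by rwa [mem_ball, dist_eq_norm] at hz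
    have hpos : (0:ℝ) < R ^ 2 - ‖z - c‖ ^ 2 := by
      have := norm_nonneg (z - c); nlinarith
    have hconjc : ContinuousOn (fun w => ((starRingEnd ℂ) (w - z))⁻¹) (sphere c R) := by
      apply ContinuousOn.inv₀
      · exact (Complex.continuous_conj.comp (continuous_id.sub continuous_const)).continuousOn
      · intro w hw
        exact (map_ne_zero (starRingEnd ℂ)).2 (hne z hz w hw)
    have hP : ∀ w ∈ sphere c R, (poissonKernel c z w : ℂ) =
        ((R ^ 2 - ‖z - c‖ ^ 2 : ℝ) : ℂ) * (w - z)⁻¹ * ((starRingEnd ℂ) (w - z))⁻¹ := by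
      intro w hw
      rw [mem_sphere, dist_eq_norm] at hw
      rw [poissonKernel_def, hw, sub_sub_sub_cancel_right, ← Complex.normSq_eq_norm_sq (w - z)]
      push_cast
      rw [← Complex.mul_conj, div_eq_mul_inv, mul_inv, mul_assoc]
    have hPc : ContinuousOn (fun w => (poissonKernel c z w : ℂ)) (sphere c R) := by
      refine ContinuousOn.congr ?_ hP
      refine (continuousOn_const.mul (ContinuousOn.inv₀ (by fun_prop) (hne z hz))).mul hconjc
    have h3 : Real.circleAverage (fun w => ((starRingEnd ℂ) (w - z))⁻¹ * F w) c R = 0 := by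
      have h4 : Real.circleAverage (fun w => (poissonKernel c z w : ℂ) * ((w - c) * F w) -
          (z - c) * ((poissonKernel c z w : ℂ) * F w)) c R = 0 := by
        have i1 : CircleIntegrable (fun w => (poissonKernel c z w : ℂ) * ((w - c) * F w)) c R :=
          ContinuousOn.circleIntegrable hR.le (hPc.mul (by fun_prop))
        have i2 : CircleIntegrable (fun w => (z - c) * ((poissonKernel c z w : ℂ) * F w)) c R :=
          ContinuousOn.circleIntegrable hR.le (continuousOn_const.mul (hPc.mul hu))
        rw [Real.circleAverage_fun_sub i1 i2, h2]
        have := Real.circleAverage_fun_smul (a := z - c) (f := fun w => (poissonKernel c z w : ℂ) * F w) (c := c) (R := R)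
        simp only [smul_eq_mul] at this
        rw [this, h1, sub_self]
      have h5 : Real.circleAverage (fun w => ((R ^ 2 - ‖z - c‖ ^ 2 : ℝ) : ℂ) *
          (((starRingEnd ℂ) (w - z))⁻¹ * F w)) c R = 0 := by
        rw [← h4]
        apply Real.circleAverage_congr_sphere
        intro w hw
        rw [abs_of_pos hR] at hw
        simp only [hP w hw]
        have := hne z hz w hw
        field_simp
        ring
      have := Real.circleAverage_fun_smul (a := ((R ^ 2 - ‖z - c‖ ^ 2 : ℝ) : ℂ))
        (f := fun w => ((starRingEnd ℂ) (w - z))⁻¹ * F w) (c := c) (R := R)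
      simp only [smul_eq_mul] at this
      rw [this] at h5
      exact (mul_eq_zero.1 h5).resolve_left (by exact_mod_cast hpos.ne')
    have h6 : Real.circleAverage (fun w => (w - c) * ((w - z)⁻¹ * F w)) c R = F z := by
      rw [← h1, ← sub_zero (Real.circleAverage (fun w => (poissonKernel c z w : ℂ) * F w) c R),
        ← mul_zero ((starRingEnd ℂ) (z - c)), ← h3]
      have := Real.circleAverage_fun_smul (a := (starRingEnd ℂ) (z - c))
        (f := fun w => ((starRingEnd ℂ) (w - z))⁻¹ * F w) (c := c) (R := R)
      simp only [smul_eq_mul] at this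
      rw [← this, ← Real.circleAverage_fun_sub]
      · apply Real.circleAverage_congr_sphere
        intro w hw
        rw [abs_of_pos hR] at hw
        simp only [hP w hw]
        have n1 := hne z hz w hw
        have n2 : (starRingEnd ℂ) (w - z) ≠ 0 := (map_ne_zero (starRingEnd ℂ)).2 n1
        have e1 : ((R ^ 2 - ‖z - c‖ ^ 2 : ℝ) : ℂ) = (w - c) * (starRingEnd ℂ) (w - c) -
            (z - c) * (starRingEnd ℂ) (z - c) := by
          rw [mem_sphere, dist_eq_norm] at hw
          rw [Complex.mul_conj, Complex.mul_conj, Complex.normSq_eq_norm_sq, Complex.normSq_eq_norm_sq, hw]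
          push_cast; ring
        rw [e1]
        field_simp
        simp only [map_sub]
        ring
      · exact ContinuousOn.circleIntegrable hR.le (hPc.mul hu)
      · exact ContinuousOn.circleIntegrable hR.le (continuousOn_const.mul (hconjc.mul hu))
    rw [← h6, Real.circleAverage_eq_circleIntegral hR.ne']
    congr 1
    apply circleIntegral.integral_congr hR.le
    intro w hw
    have n1 := hne z hz w hw
    have n2 : w - c ≠ 0 := by
      intro h
      rw [mem_sphere, dist_eq_norm, h, norm_zero] at hw
      linarith
    simp only [smul_eq_mul]
    field_simp
  have hci : CircleIntegrable F c R := hu.circleIntegrable hR.le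
  lift R to NNReal using hR.le
  have := (hasFPowerSeriesOn_cauchy_integral hci (by exact_mod_cast hR)).differentiableOn
  rw [Metric.eball_coe] at this
  exact this.congr key
end OneVar
end

open Set Metric Bornology MvPolynomial
noncomputable section

namespace Slice
open Filter Topology

/-- `C(X)`-valued functions that are continuous and pointwise holomorphic are holomorphic. -/
theorem holo_CX {Y : Type*} [TopologicalSpace Y] [CompactSpace Y] (W : Set ℂ) (hW : IsOpen W)
    (Θ : ℂ → C(Y, ℂ)) (hc : ContinuousOn Θ W)
    (hd : ∀ x, DifferentiableOn ℂ (fun w => Θ w x) W) : DifferentiableOn ℂ Θ W := by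
  intro w0 hw0
  obtain ⟨r', hr', hsub'⟩ := Metric.nhds_basis_closedBall.mem_iff.1 (hW.mem_nhds hw0)
  obtain ⟨r, hr, hsub⟩ : ∃ r : NNReal, 0 < r ∧ closedBall w0 r ⊆ W :=
    ⟨r'.toNNReal, Real.toNNReal_pos.2 hr', by rwa [Real.coe_toNNReal _ hr'.le]⟩
  have hr0 : (0:ℝ) < r := hr
  have hci : CircleIntegrable Θ w0 r :=
    ContinuousOn.circleIntegrable hr0.le (hc.mono (sphere_subset_closedBall.trans hsub))
  have key : ∀ w ∈ ball w0 r, (2 * Real.pi * Complex.I : ℂ)⁻¹ • (∮ z in C(w0, r), (z - w)⁻¹ • Θ z) = Θ w := by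
    intro w hw
    ext x
    have hint : CircleIntegrable (fun z => (z - w)⁻¹ • Θ z) w0 r := by
      apply ContinuousOn.circleIntegrable hr0.le
      refine ContinuousOn.smul (ContinuousOn.inv₀ (continuousOn_id.sub continuousOn_const) ?_)
        (hc.mono (sphere_subset_closedBall.trans hsub))
      intro z hz h
      have h := sub_eq_zero.1 h
      simp only [id] at h
      subst h
      exact (ne_of_lt (mem_ball.1 hw)) (mem_sphere.1 hz)
    have h1 := Complex.two_pi_I_inv_smul_circleIntegral_sub_inv_smul_of_differentiable_on_off_countable
      (s := ∅) countable_empty hw (f := fun w => Θ w x) (c := w0) (R := r)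
      (((hd x).mono hsub).continuousOn)
      (fun z hz => ((hd x) z (hsub (ball_subset_closedBall hz.1))).differentiableAt
        (hW.mem_nhds (hsub (ball_subset_closedBall hz.1))))
    rw [← h1]
    have h2 : (∮ z in C(w0, r), (z - w)⁻¹ • Θ z) x = ∮ z in C(w0, r), (z - w)⁻¹ • Θ z x := by
      have := ContinuousLinearMap.intervalIntegral_comp_comm
        (ContinuousMap.evalCLM ℂ x : C(Y, ℂ) →L[ℂ] ℂ) (hint.out)
      simp only [circleIntegral]
      rw [← ContinuousMap.evalCLM_apply ℂ x, ← this]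
      rfl
    simp [h2]
  have hp := hasFPowerSeriesOn_cauchy_integral (R := r) hci hr
  have hdiff := hp.differentiableOn
  have : DifferentiableOn ℂ Θ (ball w0 r) := by
    refine DifferentiableOn.congr (f := fun w => (2 * Real.pi * Complex.I : ℂ)⁻¹ • (∮ z in C(w0, r), (z - w)⁻¹ • Θ z)) ?_ (fun w hw => (key w hw).symm)
    intro w hw
    exact hdiff w (by rw [Metric.eball_coe]; exact hw) |>.mono (by rw [Metric.eball_coe])
  exact ((this w0 (mem_ball_self hr0)).differentiableAt (ball_mem_nhds _ hr0)).differentiableWithinAt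

theorem dslope_symm (γ : ℂ → ℂ) (w x : ℂ) : dslope γ w x = dslope γ x w := by
  by_cases h : w = x
  · subst h; rfl
  · rw [dslope_of_ne _ (Ne.symm h), dslope_of_ne _ h, slope_comm]

/-- joint continuity of `dslope`. -/
theorem dslope_continuousOn (γ : ℂ → ℂ) (W : Set ℂ) (hW : IsOpen W) (hγ : DifferentiableOn ℂ γ W) :
    ContinuousOn (fun p : ℂ × ℂ => dslope γ p.1 p.2) (W ×ˢ W) := by
  rintro ⟨a, b⟩ ⟨ha, hb⟩
  apply ContinuousAt.continuousWithinAt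
  simp only at ha hb
  by_cases hab : a = b
  · subst hab
    have hs : HasStrictDerivAt γ (deriv γ a) a :=
      ((hγ.analyticAt (hW.mem_nhds ha)).hasStrictDerivAt)
    have hdc : ContinuousAt (deriv γ) a := (hγ.analyticAt (hW.mem_nhds ha)).deriv.continuousAt
    rw [ContinuousAt, dslope_same, Metric.tendsto_nhds]
    intro ε hε
    have h1 := (hasStrictFDerivAt_iff_isLittleO.1 hs.hasStrictFDerivAt).def (half_pos hε)
    have h2 : ∀ᶠ p : ℂ × ℂ in 𝓝 (a, a), dist (deriv γ p.1) (deriv γ a) < ε :=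
      (hdc.tendsto.comp (continuous_fst.continuousAt (x := ((a : ℂ), (a : ℂ))))).eventually
        (ball_mem_nhds _ hε)
    filter_upwards [h1, h2] with p hp1 hp2
    by_cases hp : p.1 = p.2
    · rw [← hp, dslope_same]; exact hp2
    · rw [dslope_symm, dslope_of_ne _ hp, slope_def_field, dist_eq_norm]
      have hne : p.1 - p.2 ≠ 0 := sub_ne_zero.2 hp
      have : (γ p.1 - γ p.2) / (p.1 - p.2) - deriv γ a
          = (γ p.1 - γ p.2 - (p.1 - p.2) • deriv γ a) / (p.1 - p.2) := by
        rw [smul_eq_mul]; field_simp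
      rw [ContinuousLinearMap.toSpanSingleton_apply] at hp1
      rw [this, norm_div, div_lt_iff₀ (norm_pos_iff.2 hne)]
      have := norm_pos_iff.2 hne
      nlinarith
  · have hev : ∀ᶠ p : ℂ × ℂ in 𝓝 (a, b), dslope γ p.1 p.2 = (γ p.2 - γ p.1) / (p.2 - p.1) := by
      have : ∀ᶠ p : ℂ × ℂ in 𝓝 (a, b), p.1 ≠ p.2 :=
        (isOpen_ne_fun continuous_fst continuous_snd).mem_nhds hab
      filter_upwards [this] with p hp
      rw [dslope_of_ne _ (Ne.symm hp), slope_def_field]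
    refine ContinuousAt.congr ?_ (hev.mono fun _ h => h.symm)
    have ca : ContinuousAt γ a := (hγ.differentiableAt (hW.mem_nhds ha)).continuousAt
    have cb : ContinuousAt γ b := (hγ.differentiableAt (hW.mem_nhds hb)).continuousAt
    refine ContinuousAt.div ?_ (by fun_prop) (sub_ne_zero.2 (Ne.symm hab))
    exact (ContinuousAt.comp (f := Prod.snd) (x := (a, b)) cb continuousAt_snd).sub
      (ContinuousAt.comp (f := Prod.fst) (x := (a, b)) ca continuousAt_fst)

theorem dslope_differentiableOn (γ : ℂ → ℂ) (W : Set ℂ) (hW : IsOpen W)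
    (hγ : DifferentiableOn ℂ γ W) (x : ℂ) (hx : x ∈ W) :
    DifferentiableOn ℂ (fun w => dslope γ w x) W := by
  have : (fun w => dslope γ w x) = dslope γ x := by
    ext w; exact dslope_symm _ _ _
  rw [this]
  exact (Complex.differentiableOn_dslope (hW.mem_nhds hx)).2 hγ

end Slice
end

open Set Metric Bornology MvPolynomial
noncomputable section

namespace Slice
open Filter Topology

variable {E : Type*} [NormedAddCommGroup E] [NormedSpace ℂ E]

/-- A parametrized complex curve `φ : G → E` with a global holomorphic coordinate `ξ`. -/
structure IsSlice (D : Set E) (G : Set ℂ) (φ : ℂ → E) (ξ : E → ℂ) : Prop where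
  G_open : IsOpen G
  G_conn : IsPreconnected G
  unbdd : ∀ R : ℝ, ∃ w ∈ G, R < ‖w‖
  φ_diff : DifferentiableOn ℂ φ G
  ξ_diff : Differentiable ℂ ξ
  ξφ : ∀ w ∈ G, ξ (φ w) = w
  K_compact : IsCompact (G ∩ φ ⁻¹' closure D)

/-- the boundary part of the slice -/
def SX (D : Set E) (G : Set ℂ) (φ : ℂ → E) : Set ℂ := G ∩ φ ⁻¹' frontier D

theorem IsSlice.X_compact {D : Set E} {G : Set ℂ} {φ : ℂ → E} {ξ : E → ℂ} (hs : IsSlice D G φ ξ) :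
    IsCompact (SX D G φ) := by
  have h1 : SX D G φ = (G ∩ φ ⁻¹' closure D) ∩ φ ⁻¹' frontier D := by
    ext w
    constructor
    · rintro ⟨h, h'⟩; exact ⟨⟨h, frontier_subset_closure h'⟩, h'⟩
    · rintro ⟨⟨h, _⟩, h'⟩; exact ⟨h, h'⟩
  rw [h1]
  have hc : ContinuousOn φ (G ∩ φ ⁻¹' closure D) := hs.φ_diff.continuousOn.mono inter_subset_left
  exact hs.K_compact.of_isClosed_subset
    (hc.preimage_isClosed_of_isClosed hs.K_compact.isClosed isClosed_frontier) inter_subset_left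

open Classical in
/-- restrict a function to a continuous map on `X` (junk if not continuous) -/
def cm (X : Set ℂ) (f : ℂ → ℂ) : C(X, ℂ) :=
  if h : ContinuousOn f X then ⟨X.domRestrict f, continuousOn_iff_continuous_domRestrict.1 h⟩ else 0

theorem cm_apply {X : Set ℂ} {f : ℂ → ℂ} (h : ContinuousOn f X) (x : X) : cm X f x = f x := by
  rw [cm, dif_pos h]; rfl

theorem cm_continuousOn {X : Set ℂ} [CompactSpace X] {W : Set ℂ} (F : ℂ → ℂ → ℂ)
    (hF : ContinuousOn (fun p : ℂ × ℂ => F p.1 p.2) (W ×ˢ X)) :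
    ContinuousOn (fun w => cm X (F w)) W := by
  rw [continuousOn_iff_continuous_domRestrict]
  apply ContinuousMap.continuous_of_continuous_uncurry
  have h : Function.uncurry (fun (w : W) (x : X) => (W.domRestrict (fun w => cm X (F w)) w) x)
      = fun p : W × X => F p.1 p.2 := by
    ext ⟨w, x⟩
    simp only [Function.uncurry, domRestrict_apply]
    rw [cm_apply]
    exact hF.comp (f := fun x : ℂ => ((w : ℂ), x)) (by fun_prop) (fun x hx => ⟨w.2, hx⟩)
  rw [h]
  exact hF.comp_continuous (f := fun p : W × X => ((p.1 : ℂ), (p.2 : ℂ))) (by fun_prop) (fun p => ⟨p.1.2, p.2.2⟩)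

theorem cm_differentiableOn {X : Set ℂ} [CompactSpace X] {W : Set ℂ} (hW : IsOpen W)
    (F : ℂ → ℂ → ℂ)
    (hF : ContinuousOn (fun p : ℂ × ℂ => F p.1 p.2) (W ×ˢ X))
    (hd : ∀ x ∈ X, DifferentiableOn ℂ (fun w => F w x) W) :
    DifferentiableOn ℂ (fun w => cm X (F w)) W := by
  apply holo_CX W hW _ (cm_continuousOn F hF)
  intro x
  refine (hd x x.2).congr ?_
  intro w hw
  exact cm_apply (hF.comp (f := fun x : ℂ => ((w : ℂ), x)) (by fun_prop) (fun x hx => ⟨hw, hx⟩)) x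

/-- resolvent -/
def rs (X : Set ℂ) (w : ℂ) : C(X, ℂ) := cm X (fun x => (x - w)⁻¹)

theorem rs_cont {X : Set ℂ} {w : ℂ} (hw : w ∉ X) : ContinuousOn (fun x : ℂ => (x - w)⁻¹) X :=
  ContinuousOn.inv₀ (by fun_prop) (fun x hx => sub_ne_zero.2 (fun h => hw (h ▸ hx)))

theorem rs_apply {X : Set ℂ} {w : ℂ} (hw : w ∉ X) (x : X) : rs X w x = ((x : ℂ) - w)⁻¹ :=
  cm_apply (rs_cont hw) x

theorem rs_differentiableOn {X : Set ℂ} [CompactSpace X] : DifferentiableOn ℂ (rs X) Xᶜ := by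
  have hX : IsClosed X := (isCompact_iff_compactSpace.2 inferInstance).isClosed
  apply cm_differentiableOn hX.isOpen_compl (fun w x => (x - w)⁻¹)
  · apply ContinuousOn.inv₀ (by fun_prop)
    rintro ⟨w, x⟩ ⟨hw, hx⟩
    exact sub_ne_zero.2 (fun h => hw (by simp only at h; exact h ▸ hx))
  · intro x hx
    apply DifferentiableOn.inv (by fun_prop)
    intro w hw
    exact sub_ne_zero.2 (fun h => hw (h ▸ hx))

/-- coordinate function on `X` -/
def xi (X : Set ℂ) : C(X, ℂ) := ⟨fun x => x, continuous_subtype_val⟩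

@[simp] theorem xi_apply {X : Set ℂ} (x : X) : xi X x = x := rfl

/-- large resolvents are limits of polynomials -/
theorem rs_large {X : Set ℂ} [CompactSpace X] {w : ℂ} (hw : ‖xi X‖ < ‖w‖)
    (ν : C(X, ℂ) →L[ℂ] ℂ) (b : C(X, ℂ)) (h : ∀ n : ℕ, ν (xi X ^ n * b) = 0) :
    ν (rs X w * b) = 0 := by
  have hw0 : w ≠ 0 := norm_pos_iff.1 ((norm_nonneg _).trans_lt hw)
  set t : C(X, ℂ) := w⁻¹ • xi X with ht
  have ht1 : ‖t‖ < 1 := by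
    rw [ht, norm_smul, norm_inv, inv_mul_lt_iff₀ (norm_pos_iff.2 hw0)]; simpa using hw
  have hwX : w ∉ X := fun hx => by
    have := ContinuousMap.norm_coe_le_norm (xi X) ⟨w, hx⟩
    simp at this; linarith
  have hsum := summable_geometric_of_norm_lt_one (x := t) ht1
  have hgeo := mul_neg_geom_series t ht1
  have h1 : rs X w = (-w⁻¹) • ∑' i : ℕ, t ^ i := by
    ext x
    have h2 := congrArg (fun c : C(X, ℂ) => c x) hgeo
    simp only [ContinuousMap.mul_apply, ContinuousMap.sub_apply, ContinuousMap.one_apply, ht,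
      ContinuousMap.smul_apply, xi_apply, smul_eq_mul] at h2
    rw [rs_apply hwX, ContinuousMap.smul_apply, smul_eq_mul]
    have h3 : (x : ℂ) - w ≠ 0 := sub_ne_zero.2 (fun h => hwX (h ▸ x.2))
    set S := (∑' i : ℕ, (w⁻¹ • xi X) ^ i) x
    have : (w - x) * S = w := by
      have : w * ((1 - w⁻¹ * x) * S) = w * 1 := by rw [h2]
      rw [← mul_assoc, mul_sub, mul_inv_cancel_left₀ hw0] at this; simpa using this
    symm
    apply eq_inv_of_mul_eq_one_left
    field_simp
    linear_combination this
  rw [h1, smul_mul_assoc, ← hsum.tsum_mul_right]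
  have hs2 : Summable (fun i : ℕ => t ^ i * b) := hsum.mul_right b
  rw [map_smul, ν.map_tsum hs2]
  have : ∀ i : ℕ, ν (t ^ i * b) = 0 := by
    intro i
    rw [ht, smul_pow, smul_mul_assoc, map_smul, h i, smul_zero]
  simp [this]

end Slice
end

open Set Metric Bornology MvPolynomial
noncomputable section

namespace Slice
open Filter Topology

variable {E : Type*} [NormedAddCommGroup E] [NormedSpace ℂ E]

theorem X_sub_W {D : Set E} {G : Set ℂ} {φ : ℂ → E} {U : Set E} (hDU : closure D ⊆ U) :
    SX D G φ ⊆ G ∩ φ ⁻¹' U := fun _ hw => ⟨hw.1, hDU (frontier_subset_closure hw.2)⟩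

theorem gφ_diff {D : Set E} {G : Set ℂ} {φ : ℂ → E} {ξ : E → ℂ} (hs : IsSlice D G φ ξ)
    {U : Set E} {g : E → ℂ} (hg : DifferentiableOn ℂ g U) :
    DifferentiableOn ℂ (g ∘ φ) (G ∩ φ ⁻¹' U) :=
  hg.comp (hs.φ_diff.mono inter_subset_left) (fun _ hw => hw.2)

theorem W_open {D : Set E} {G : Set ℂ} {φ : ℂ → E} {ξ : E → ℂ} (hs : IsSlice D G φ ξ)
    {U : Set E} (hU : IsOpen U) : IsOpen (G ∩ φ ⁻¹' U) :=
  hs.φ_diff.continuousOn.isOpen_inter_preimage hs.G_open hU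

theorem stein_key {D : Set E} {G : Set ℂ} {φ : ℂ → E} {ξ : E → ℂ} (hs : IsSlice D G φ ξ)
    (hDc : IsCompact (closure D)) (X : Set ℂ) (hX : X = SX D G φ) [CompactSpace X]
    (U : Set E) (hU : IsStein U) (hDU : closure D ⊆ U)
    (ν : C(X, ℂ) →L[ℂ] ℂ)
    (hν : ∀ g : E → ℂ, DifferentiableOn ℂ g U → ν (cm _ (g ∘ φ)) = 0) :
    (∀ c ∈ G, φ c ∉ U → ν (rs _ c) = 0) ∧
    (∀ a ∈ G, φ a ∈ closure D → φ a ∉ frontier D → ∀ g : E → ℂ, DifferentiableOn ℂ g U →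
      ν (rs _ a * cm _ (g ∘ φ)) = g (φ a) * ν (rs _ a)) := by
  set K := G ∩ φ ⁻¹' closure D with hK
  set W := G ∩ φ ⁻¹' U with hW
  have hWo : IsOpen W := W_open hs hU.1
  have hXK : X ⊆ K := hX ▸ X_sub_W subset_rfl
  have hKW : K ⊆ W := fun w hw => ⟨hw.1, hDU hw.2⟩
  have hXW : X ⊆ W := hXK.trans hKW
  have hKc : IsClosed K := hs.K_compact.isClosed
  have hXc : IsClosed X := hX ▸ hs.X_compact.isClosed
  have ccont : ∀ g : E → ℂ, DifferentiableOn ℂ g U → ContinuousOn (g ∘ φ) X :=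
    fun g hg => (gφ_diff hs hg).continuousOn.mono hXW
  let κ : (E → ℂ) → ℂ → ℂ := fun b w => ν (rs X w * cm X (b ∘ φ))
  let h : (E → ℂ) → (E → ℂ) → ℂ → ℂ := fun g b w => ν (cm X (dslope (g ∘ φ) w) * cm X (b ∘ φ))
  have κ_diff : ∀ b, DifferentiableOn ℂ (κ b) Xᶜ := fun b =>
    ν.differentiable.comp_differentiableOn (rs_differentiableOn.mul (differentiableOn_const _))
  have h_diff : ∀ g b, DifferentiableOn ℂ g U → DifferentiableOn ℂ (h g b) W := by
    intro g b hg
    refine ν.differentiable.comp_differentiableOn (DifferentiableOn.mul ?_ (differentiableOn_const _))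
    refine cm_differentiableOn hWo _ ?_ ?_
    · exact (dslope_continuousOn _ W hWo (gφ_diff hs hg)).mono (prod_mono subset_rfl hXW)
    · intro x hx
      exact dslope_differentiableOn _ W hWo (gφ_diff hs hg) x (hXW hx)
  have hκ : ∀ g b, DifferentiableOn ℂ g U → DifferentiableOn ℂ b U → ∀ w ∈ W, w ∉ X →
      h g b w = κ (g * b) w - g (φ w) * κ b w := by
    intro g b hg hb w hw hwX
    simp only [h, κ]
    rw [← smul_eq_mul (g (φ w)), ← map_smul, ← map_sub]
    congr 1
    ext x
    have hxw : (x : ℂ) ≠ w := fun h => hwX (h ▸ x.2)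
    have c1 : ContinuousOn (dslope (g ∘ φ) w) X := by
      have := (dslope_continuousOn _ W hWo (gφ_diff hs hg))
      exact this.comp (f := fun x : ℂ => (w, x)) (by fun_prop) (fun x hx => ⟨hw, hXW hx⟩)
    simp only [ContinuousMap.mul_apply, ContinuousMap.sub_apply, ContinuousMap.smul_apply,
      smul_eq_mul]
    rw [cm_apply c1, cm_apply (ccont b hb), cm_apply (ccont _ (hg.mul hb)), rs_apply hwX,
      dslope_of_ne _ hxw, slope_def_field]
    simp only [Function.comp, Pi.mul_apply]
    rw [div_eq_mul_inv]
    ring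
  let Y1 : Set ℂ := {w | w ∈ G ∧ w ∉ K ∧ ∀ᶠ w' in 𝓝 w, ∀ b, DifferentiableOn ℂ b U → κ b w' = 0}
  let Y2 : Set ℂ := {w | w ∈ W ∧ ∀ᶠ w' in 𝓝 w, ∀ g b, DifferentiableOn ℂ g U →
    DifferentiableOn ℂ b U → h g b w' = 0}
  have hY12 : ∀ w ∈ W, w ∈ Y1 → w ∈ Y2 := by
    rintro w hw ⟨_, h2, h3⟩
    refine ⟨hw, ?_⟩
    filter_upwards [h3, hWo.mem_nhds hw, hKc.isOpen_compl.mem_nhds h2] with w' h1 h2 h3 g b hg hb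
    rw [hκ g b hg hb w' h2 (fun h => h3 (hXK h)), h1 b hb, h1 _ (hg.mul hb)]; simp
  have hY1o : IsOpen Y1 := by
    rw [isOpen_iff_mem_nhds]
    rintro w ⟨h1, h2, h3⟩
    filter_upwards [hs.G_open.mem_nhds h1, hKc.isOpen_compl.mem_nhds h2, h3.eventually_nhds]
      with w' a1 a2 a3 using ⟨a1, a2, a3⟩
  have hY2o : IsOpen Y2 := by
    rw [isOpen_iff_mem_nhds]
    rintro w ⟨h1, h3⟩
    filter_upwards [hWo.mem_nhds h1, h3.eventually_nhds] with w' a1 a3 using ⟨a1, a3⟩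
  -- identity theorem
  have ident : ∀ (F : ℂ → ℂ) (y y1 : ℂ) (r : ℝ), DifferentiableOn ℂ F (ball y r) →
      y1 ∈ ball y r → (∀ᶠ w in 𝓝 y1, F w = 0) → ∀ w ∈ ball y r, F w = 0 := by
    intro F y y1 r hF hy1 hev w hw
    exact (hF.analyticOnNhd isOpen_ball).eqOn_zero_of_preconnected_of_eventuallyEq_zero
      (convex_ball y r).isPreconnected hy1 hev hw
  set Hh := {z ∈ U | ∀ f : E → ℂ, DifferentiableOn ℂ f U → ‖f z‖ ≤ ⨆ w : closure D, ‖f (w : E)‖} with hHh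
  have hHc : IsClosed Hh := (hU.2 _ hDU hDc).isClosed
  -- hull property
  have hull : ∀ w ∈ Y2, w ∉ K → φ w ∉ Hh → ∀ b, DifferentiableOn ℂ b U → κ b w = 0 := by
    intro w hw hwK hwH b hb
    by_contra hne
    apply hwH
    refine ⟨hw.1.2, fun g hg => ?_⟩
    by_contra hlt
    push Not at hlt
    set s := ⨆ w : closure D, ‖g (w : E)‖ with hsdef
    have hwX : w ∉ X := fun h => hwK (hXK h)
    have hs0 : 0 ≤ s := Real.iSup_nonneg fun _ => norm_nonneg _
    have hgs : ∀ x : X, ‖g (φ x)‖ ≤ s := by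
      intro x
      have hbd : BddAbove (range fun w : closure D => ‖g (w : E)‖) := by
        have : BddAbove ((fun z => ‖g z‖) '' closure D) :=
          hDc.bddAbove_image (hg.continuousOn.mono hDU).norm
        convert this using 1
        ext; simp
      exact le_ciSup hbd ⟨φ x, (hXK x.2).2⟩
    have hpow : ∀ n : ℕ, κ (g ^ n * b) w = g (φ w) ^ n * κ b w := by
      intro n
      induction n with
      | zero => simp
      | succ n ih =>
        have hgn : DifferentiableOn ℂ (g ^ n * b) U := (hg.pow n).mul hb
        have := hκ g (g ^ n * b) hg hgn w hw.1 hwX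
        rw [hw.2.self_of_nhds g _ hg hgn, ih] at this
        rw [pow_succ', mul_assoc]
        rw [pow_succ']
        linear_combination -this
    have hbound : ∀ n : ℕ, ‖g (φ w)‖ ^ n * ‖κ b w‖ ≤ ‖ν‖ * ‖rs X w‖ * ‖cm X (b ∘ φ)‖ * s ^ n := by
      intro n
      rw [← norm_pow, ← norm_mul, ← hpow]
      refine (ν.le_opNorm _).trans ?_
      rw [mul_assoc, mul_assoc]
      refine mul_le_mul_of_nonneg_left ?_ (norm_nonneg _)
      refine (norm_mul_le _ _).trans (mul_le_mul_of_nonneg_left ?_ (norm_nonneg _))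
      rw [ContinuousMap.norm_le _ (by positivity)]
      intro x
      rw [cm_apply (ccont _ ((hg.pow n).mul hb))]
      simp only [Function.comp, Pi.mul_apply, Pi.pow_apply, norm_mul, norm_pow]
      rw [mul_comm]
      refine mul_le_mul ?_ (pow_le_pow_left₀ (norm_nonneg _) (hgs x) n) (by positivity) (norm_nonneg _)
      have := ContinuousMap.norm_coe_le_norm (cm X (b ∘ φ)) x
      rwa [cm_apply (ccont _ hb)] at this
    have hgpos : 0 < ‖g (φ w)‖ := hs0.trans_lt hlt
    have hlim : Tendsto (fun n : ℕ => ‖ν‖ * ‖rs X w‖ * ‖cm X (b ∘ φ)‖ * (s / ‖g (φ w)‖) ^ n) atTop (𝓝 0) := by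
      have := (tendsto_pow_atTop_nhds_zero_of_lt_one (div_nonneg hs0 hgpos.le)
        ((div_lt_one hgpos).2 hlt)).const_mul (‖ν‖ * ‖rs X w‖ * ‖cm X (b ∘ φ)‖)
      simpa using this
    have hle : ‖κ b w‖ ≤ 0 := by
      refine ge_of_tendsto' hlim (fun n => ?_)
      rw [div_pow, ← mul_div_assoc, le_div_iff₀ (pow_pos hgpos n), mul_comm]
      exact hbound n
    exact hne (norm_le_zero_iff.1 hle)
  have hclosed : ∀ y ∈ G, y ∈ closure (Y1 ∪ Y2) → y ∈ Y1 ∪ Y2 := by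
    intro y hyG hyc
    by_cases hyW : y ∈ W
    · obtain ⟨r, hr, hsub⟩ := Metric.isOpen_iff.1 hWo y hyW
      obtain ⟨y1, hy1, hy1b⟩ := Metric.mem_closure_iff.1 hyc r hr
      have hy1b' : y1 ∈ ball y r := by rwa [mem_ball, dist_comm]
      have hy12 : y1 ∈ Y2 := by
        rcases hy1 with h1 | h1
        · exact hY12 _ (hsub hy1b') h1
        · exact h1
      right
      refine ⟨hyW, ?_⟩
      filter_upwards [ball_mem_nhds y hr] with w hw g b hg hb
      exact ident (h g b) y y1 r ((h_diff g b hg).mono hsub) hy1b'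
        (hy12.2.mono fun w' h' => h' g b hg hb) w hw
    · have hyK : y ∉ K := fun h => hyW (hKW h)
      have hyH : φ y ∉ Hh := fun h => hyW ⟨hyG, h.1⟩
      have ho : IsOpen (G ∩ φ ⁻¹' Hhᶜ ∩ Kᶜ) :=
        (hs.φ_diff.continuousOn.isOpen_inter_preimage hs.G_open hHc.isOpen_compl).inter
          hKc.isOpen_compl
      obtain ⟨r, hr, hsub⟩ := Metric.isOpen_iff.1 ho y ⟨⟨hyG, hyH⟩, hyK⟩
      obtain ⟨y1, hy1, hy1b⟩ := Metric.mem_closure_iff.1 hyc r hr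
      have hy1b' : y1 ∈ ball y r := by rwa [mem_ball, dist_comm]
      have hy11 : y1 ∈ Y1 := by
        rcases hy1 with h1 | h1
        · exact h1
        · refine ⟨(hsub hy1b').1.1, (hsub hy1b').2, ?_⟩
          filter_upwards [hY2o.mem_nhds h1, isOpen_ball.mem_nhds hy1b'] with w hw hwb b hb
          exact hull w hw (hsub hwb).2 (hsub hwb).1.2 b hb
      left
      refine ⟨hyG, hyK, ?_⟩
      filter_upwards [ball_mem_nhds y hr] with w hw b hb
      refine ident (κ b) y y1 r ((κ_diff b).mono ?_) hy1b' (hy11.2.2.mono fun w' h' => h' b hb) w hw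
      exact fun w hw hwX => (hsub hw).2 (hXK hwX)
  have hne : (G ∩ (Y1 ∪ Y2)).Nonempty := by
    obtain ⟨R, hR⟩ := hs.K_compact.isBounded.exists_norm_le
    obtain ⟨w, hwG, hwR⟩ := hs.unbdd (max R ‖xi X‖)
    refine ⟨w, hwG, Or.inl ⟨hwG, fun h => absurd (hR w h) (not_le.2 ((le_max_left _ _).trans_lt hwR)), ?_⟩⟩
    have : ∀ᶠ w' in 𝓝 w, ‖xi X‖ < ‖w'‖ :=
      continuous_norm.continuousAt.eventually_const_lt ((le_max_right _ _).trans_lt hwR)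
    filter_upwards [this] with w' hw' b hb
    refine rs_large hw' ν _ (fun n => ?_)
    have hd : DifferentiableOn ℂ (fun z => ξ z ^ n * b z) U :=
      (hs.ξ_diff.differentiableOn.pow n).mul hb
    rw [← hν _ hd]
    congr 1
    ext x
    rw [ContinuousMap.mul_apply, cm_apply (ccont b hb), cm_apply (ccont _ hd)]
    simp [Function.comp, hs.ξφ x (hXK x.2).1]
  have hall : G ⊆ Y1 ∪ Y2 := by
    refine hs.G_conn.subset_of_closure_inter_subset (hY1o.union hY2o) hne ?_
    rintro y ⟨h1, h2⟩
    exact hclosed y h2 h1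
  constructor
  · intro c hc hcU
    have h1 : c ∈ Y1 := (hall hc).resolve_right (fun h => hcU h.1.2)
    have := h1.2.2.self_of_nhds (fun _ => 1) (differentiableOn_const _)
    rw [← this]
    simp only [κ]
    congr 1
    ext x
    rw [ContinuousMap.mul_apply, cm_apply (ccont _ (differentiableOn_const _))]
    simp
  · intro a ha haK haF g hg
    have haX : a ∉ X := fun h => haF (hX ▸ h : a ∈ SX D G φ).2
    have h1 : a ∈ Y2 := (hall ha).resolve_left (fun h => h.2.1 ⟨ha, haK⟩)
    have hone : DifferentiableOn ℂ (fun _ : E => (1:ℂ)) U := differentiableOn_const _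
    have h2 := h1.2.self_of_nhds g (fun _ => 1) hg hone
    rw [hκ g _ hg hone a h1.1 haX, sub_eq_zero] at h2
    have e1 : (g * fun _ : E => (1:ℂ)) = g := by ext; simp
    have e2 : cm X ((fun _ : E => (1:ℂ)) ∘ φ) = 1 := by
      ext x; rw [cm_apply (ccont _ hone)]; simp
    simp only [κ, e1, e2, mul_one] at h2
    exact h2

end Slice
end

open Set Metric Bornology MvPolynomial
noncomputable section

namespace Slice
open Filter Topology

section J
variable {R : Type*} [CommRing R] [Algebra ℂ R]

/-- the bilinear power form -/
def J (α β : R →ₗ[ℂ] ℂ) (n : ℕ) (b : R) : ℂ :=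
  ∑ k ∈ Finset.range (n + 1), α (b ^ k) * β ((-b) ^ (n - k)) * (n.choose k : ℂ)

open TensorProduct in
theorem J_eq (α β : R →ₗ[ℂ] ℂ) (n : ℕ) (b : R) :
    J α β n b = (LinearMap.mul' ℂ ℂ ∘ₗ TensorProduct.map α β)
      ((b ⊗ₜ[ℂ] (1:R) - (1:R) ⊗ₜ[ℂ] b) ^ n) := by
  rw [sub_eq_add_neg, ← TensorProduct.tmul_neg, add_pow, map_sum, J]
  refine Finset.sum_congr rfl fun k _ => ?_
  rw [Algebra.TensorProduct.tmul_pow, Algebra.TensorProduct.tmul_pow,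
    Algebra.TensorProduct.tmul_mul_tmul, one_pow, one_pow, mul_one, one_mul]
  have : ((n.choose k : ℕ) : R ⊗[ℂ] R) = algebraMap ℂ _ (n.choose k : ℂ) := by simp
  rw [this, mul_comm _ (algebraMap ℂ _ _), ← Algebra.smul_def, map_smul]
  simp [mul_comm]

theorem J_shift (α β : R →ₗ[ℂ] ℂ) (n : ℕ) (b : R) (μ : ℂ) :
    J α β n (b - algebraMap ℂ R μ) = J α β n b := by
  rw [J_eq, J_eq]
  congr 2
  rw [TensorProduct.sub_tmul, TensorProduct.tmul_sub]
  have : (algebraMap ℂ R μ) ⊗ₜ[ℂ] (1:R) = (1:R) ⊗ₜ[ℂ] (algebraMap ℂ R μ) := by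
    rw [Algebra.algebraMap_eq_smul_one, TensorProduct.smul_tmul]
  rw [this]; abel

theorem J_bound (α β : R →ₗ[ℂ] ℂ) (n : ℕ) (b : R) (A B η : ℝ) (hA : 0 ≤ A) (hη : 0 ≤ η)
    (h1 : ∀ k, ‖α (b ^ k)‖ ≤ A * η ^ k) (h2 : ∀ k, ‖β (b ^ k)‖ ≤ B * η ^ k) :
    ‖J α β n b‖ ≤ A * B * (2 * η) ^ n := by
  have h3 : (2 * η) ^ n = ∑ k ∈ Finset.range (n + 1), η ^ k * η ^ (n - k) * (n.choose k : ℝ) := by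
    rw [two_mul, add_pow]
  rw [h3, J, Finset.mul_sum]
  refine (norm_sum_le _ _).trans (Finset.sum_le_sum fun k _ => ?_)
  rw [norm_mul, norm_mul]
  have h4 : ‖β ((-b) ^ (n - k))‖ ≤ B * η ^ (n - k) := by
    rw [neg_pow]
    have : (-1 : R) ^ (n - k) * b ^ (n - k) = ((-1 : ℂ) ^ (n - k)) • b ^ (n - k) := by
      rw [Algebra.smul_def]; simp
    rw [this, map_smul, norm_smul, norm_pow]; simpa using h2 (n - k)
  have h5 : ‖(n.choose k : ℂ)‖ = n.choose k := by simp
  rw [h5]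
  have : A * B * (η ^ k * η ^ (n - k) * (n.choose k : ℝ)) = (A * η ^ k) * (B * η ^ (n - k)) * n.choose k := by
    ring
  rw [this]
  gcongr
  exact h1 k

theorem J_mult (α β : R →ₗ[ℂ] ℂ) (n : ℕ) (b : R) (t : ℂ) (h : ∀ k, α (b ^ k) = t ^ k) :
    J α β n b = β ((algebraMap ℂ R t - b) ^ n) := by
  rw [sub_eq_add_neg, add_pow, map_sum, J]
  refine Finset.sum_congr rfl fun k _ => ?_
  rw [h, ← map_pow, mul_assoc, mul_assoc, ← Algebra.smul_def, map_smul]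
  have : (n.choose k : R) = algebraMap ℂ R (n.choose k : ℂ) := by simp
  rw [this, mul_comm _ (algebraMap ℂ _ _), ← Algebra.smul_def, map_smul]
  simp only [smul_eq_mul]; ring

end J

/-- a functional representing a point over `w` -/
structure Rep {X : Set ℂ} [CompactSpace X] (A : Subalgebra ℂ C(X, ℂ)) (χ : C(X, ℂ) →L[ℂ] ℂ) (w : ℂ) :
    Prop where
  norm_le : ‖χ‖ ≤ 1
  one : χ 1 = 1
  mul : ∀ a ∈ A, ∀ b ∈ A, χ (a * b) = χ a * χ b
  xi_mem : xi X ∈ A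
  xi_eq : χ (xi X) = w

section rep
variable {X : Set ℂ} [CompactSpace X] {A : Subalgebra ℂ C(X, ℂ)} {χ ψ : C(X, ℂ) →L[ℂ] ℂ} {w v : ℂ}

theorem Rep.pow (hχ : Rep A χ w) {b : C(X, ℂ)} (hb : b ∈ A) (n : ℕ) : χ (b ^ n) = χ b ^ n := by
  induction n with
  | zero => simpa using hχ.one
  | succ n ih => rw [pow_succ, hχ.mul _ (A.pow_mem hb n) _ hb, ih, pow_succ]

theorem Rep.algebraMap (hχ : Rep A χ w) (c : ℂ) : χ (algebraMap ℂ _ c) = c := by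
  rw [Algebra.algebraMap_eq_smul_one, map_smul, hχ.one]; simp

/-- `b ↦ χ ((ξ - w)/(ξ - w') b)` -/
def al (χ : C(X, ℂ) →L[ℂ] ℂ) (w w' : ℂ) : C(X, ℂ) →ₗ[ℂ] ℂ :=
  χ.toLinearMap ∘ₗ LinearMap.mulLeft ℂ ((xi X - algebraMap ℂ _ w) * rs X w')

theorem al_apply (χ : C(X, ℂ) →L[ℂ] ℂ) (w w' : ℂ) (b : C(X, ℂ)) :
    al χ w w' b = χ ((xi X - algebraMap ℂ _ w) * rs X w' * b) := rfl

theorem xi_mul_rs {w : ℂ} (hw : w ∉ X) : (xi X - algebraMap ℂ _ w) * rs X w = 1 := by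
  ext x
  have : (x : ℂ) - w ≠ 0 := sub_ne_zero.2 (fun h => hw (h ▸ x.2))
  simp [rs_apply hw, this]

theorem al_self (hw : w ∉ X) (b : C(X, ℂ)) : al χ w w b = χ b := by
  rw [al_apply, xi_mul_rs hw, one_mul]

theorem al_norm (hχ : ‖χ‖ ≤ 1) {w w' : ℂ} {R δ : ℝ} (hδ : 0 < δ) (hR0 : 0 ≤ R)
    (hR : ∀ x ∈ X, ‖x - w‖ ≤ R) (hd : ∀ x ∈ X, δ ≤ ‖x - w'‖) (b : C(X, ℂ)) :
    ‖al χ w w' b‖ ≤ R / δ * ‖b‖ := by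
  have hw' : w' ∉ X := fun h => by have := hd w' h; simp at this; linarith
  rw [al_apply]
  refine (χ.le_opNorm _).trans ?_
  refine (mul_le_of_le_one_left (norm_nonneg _) hχ).trans ?_
  refine (norm_mul_le _ _).trans (mul_le_mul_of_nonneg_right ?_ (norm_nonneg _))
  rw [ContinuousMap.norm_le _ (by positivity)]
  intro x
  simp only [ContinuousMap.mul_apply, ContinuousMap.sub_apply, xi_apply, norm_mul, rs_apply hw',
    norm_inv]
  rw [div_eq_mul_inv]
  have := hd x x.2
  refine mul_le_mul (hR x x.2) (inv_anti₀ hδ this) (by positivity) hR0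

theorem al_rs (hχ : Rep A χ w) {w' c : ℂ} (hw' : w' ∉ X) (hc : c ∉ X) (hcw : c ≠ w')
    (hcA : rs X c ∈ A) {b : C(X, ℂ)} (hb : b ∈ A) :
    al χ w w' (b * rs X c) = al χ w w' b * (w' - c)⁻¹ := by
  have h0 : χ ((xi X - algebraMap ℂ _ w) * (rs X c * b)) = 0 := by
    rw [hχ.mul _ (A.sub_mem hχ.xi_mem (A.algebraMap_mem _)) _ (A.mul_mem hcA hb), map_sub,
      hχ.algebraMap, hχ.xi_eq]; simp
  have h1 : (xi X - algebraMap ℂ _ w) * rs X w' * (b * rs X c) = (w' - c)⁻¹ •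
      ((xi X - algebraMap ℂ _ w) * rs X w' * b - (xi X - algebraMap ℂ _ w) * (rs X c * b)) := by
    ext x
    have n1 : (x : ℂ) - w' ≠ 0 := sub_ne_zero.2 (fun h => hw' (h ▸ x.2))
    have n2 : (x : ℂ) - c ≠ 0 := sub_ne_zero.2 (fun h => hc (h ▸ x.2))
    have n3 : w' - c ≠ 0 := sub_ne_zero.2 hcw.symm
    simp only [ContinuousMap.mul_apply, ContinuousMap.sub_apply, xi_apply, rs_apply hw',
      rs_apply hc, ContinuousMap.smul_apply, smul_eq_mul]
    field_simp
    ring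
  rw [al_apply, al_apply, h1, map_smul, map_sub, h0, sub_zero, smul_eq_mul, mul_comm]

theorem al_rs_pow (hχ : Rep A χ w) {w' c : ℂ} (hw' : w' ∉ X) (hc : c ∉ X) (hcw : c ≠ w')
    (hcA : rs X c ∈ A) {b : C(X, ℂ)} (hb : b ∈ A) (n : ℕ) :
    al χ w w' (b * rs X c ^ n) = al χ w w' b * ((w' - c)⁻¹) ^ n := by
  induction n with
  | zero => simp
  | succ n ih =>
    rw [pow_succ, ← mul_assoc, al_rs hχ hw' hc hcw hcA (A.mul_mem hb (A.pow_mem hcA n)), ih,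
      pow_succ]; ring

theorem al_pow_bound (hχ : Rep A χ w) {w' c : ℂ} (hc : c ∉ X) (hcw : c ≠ w')
    (hcA : rs X c ∈ A) {b : C(X, ℂ)} (hb : b ∈ A) {R δ η : ℝ} (hδ : 0 < δ) (hR0 : 0 ≤ R)
    (hR : ∀ x ∈ X, ‖x - w‖ ≤ R) (hd : ∀ x ∈ X, δ ≤ ‖x - w'‖) (hη : 0 ≤ η)
    (hbar : ∀ x : X, ‖b x‖ * ‖w' - c‖ ≤ η * ‖(x : ℂ) - c‖) (n : ℕ) :
    ‖al χ w w' (b ^ n)‖ ≤ R / δ * η ^ n := by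
  have hw' : w' ∉ X := fun h => by have := hd w' h; simp at this; linarith
  have n3 : w' - c ≠ 0 := sub_ne_zero.2 hcw.symm
  have h1 : al χ w w' (b ^ n) = al χ w w' ((w' - c) ^ n • (b ^ n * rs X c ^ n)) := by
    rw [map_smul, al_rs_pow hχ hw' hc hcw hcA (A.pow_mem hb n), smul_eq_mul,
      mul_left_comm, ← mul_pow, mul_inv_cancel₀ n3, one_pow, mul_one]
  rw [h1]
  refine (al_norm hχ.norm_le hδ hR0 hR hd _).trans (mul_le_mul_of_nonneg_left ?_ (by positivity))
  rw [ContinuousMap.norm_le _ (by positivity)]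
  intro x
  simp only [ContinuousMap.smul_apply, ContinuousMap.mul_apply, ContinuousMap.pow_apply,
    rs_apply hc, smul_eq_mul]
  rw [← mul_pow, ← mul_pow, norm_pow]
  refine pow_le_pow_left₀ (norm_nonneg _) ?_ n
  have n2 : 0 < ‖(x : ℂ) - c‖ := norm_pos_iff.2 (sub_ne_zero.2 (fun h => hc (h ▸ x.2)))
  rw [norm_mul, norm_mul, norm_inv, ← mul_assoc, ← div_eq_mul_inv, div_le_iff₀ n2, mul_comm]
  exact hbar x

theorem al_diff (χ : C(X, ℂ) →L[ℂ] ℂ) (w : ℂ) (b : C(X, ℂ)) :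
    DifferentiableOn ℂ (fun w' => al χ w w' b) Xᶜ := by
  simp only [al_apply]
  exact χ.differentiable.comp_differentiableOn
    (((differentiableOn_const _).mul rs_differentiableOn).mul (differentiableOn_const _))

/-- main estimate -/
theorem main_est {Ω : Set ℂ} (hΩ : IsOpen Ω) (hdisj : Disjoint Ω X) (hK : IsCompact (Ω ∪ X))
    (hχ : Rep A χ w) (hψ : Rep A ψ v) (hw : w ∈ Ω) {b : C(X, ℂ)} (hb : b ∈ A)
    {R δ η : ℝ} (hδ : 0 < δ) (hη : 0 ≤ η) (hR0 : 0 ≤ R)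
    (hRw : ∀ x ∈ X, ‖x - w‖ ≤ R) (hRv : ∀ x ∈ X, ‖x - v‖ ≤ R)
    (hwδ : δ < infDist w X)
    (hbar : ∀ w' ∈ Ω, infDist w' X = δ → ∃ c, c ∉ X ∧ c ≠ w' ∧ rs X c ∈ A ∧ ∃ μ : ℂ,
      ∀ x : X, ‖b x - μ‖ * ‖w' - c‖ ≤ η * ‖(x : ℂ) - c‖) (n : ℕ) :
    ‖al ψ v w ((b - algebraMap ℂ _ (χ b)) ^ n)‖ ≤ (R / δ) * (R / δ) * (2 * η) ^ n := by
  have hwX : w ∉ X := fun h => disjoint_left.1 hdisj hw h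
  have hJw : J (al χ w w) (al ψ v w) n b = al ψ v w ((algebraMap ℂ _ (χ b) - b) ^ n) :=
    J_mult _ _ _ _ _ (fun k => by rw [al_self hwX, hχ.pow hb])
  have hsgn : ‖al ψ v w ((b - algebraMap ℂ _ (χ b)) ^ n)‖ = ‖J (al χ w w) (al ψ v w) n b‖ := by
    rw [hJw, ← neg_sub b, neg_pow]
    have : (-1 : C(X, ℂ)) ^ n * (b - algebraMap ℂ _ (χ b)) ^ n
        = ((-1 : ℂ) ^ n) • (b - algebraMap ℂ _ (χ b)) ^ n := by
      rw [Algebra.smul_def]; simp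
    rw [this, map_smul, norm_smul, norm_pow]; simp
  rw [hsgn]
  set V := {w' | w' ∈ Ω ∧ δ < infDist w' X} with hV
  have hVb : IsBounded V := hK.isBounded.subset (fun z hz => Or.inl hz.1)
  have hVo : IsOpen V := hΩ.inter (isOpen_lt continuous_const (continuous_infDist_pt X))
  have hcl : ∀ z ∈ closure V, z ∈ Ω ∧ δ ≤ infDist z X := by
    intro z hz
    have h2 : δ ≤ infDist z X := by
      have : closure V ⊆ {z | δ ≤ infDist z X} :=
        closure_minimal (fun z hz => hz.2.le) (isClosed_le continuous_const (continuous_infDist_pt X))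
      exact this hz
    have h1 : z ∈ Ω ∪ X := closure_minimal (fun z hz => Or.inl hz.1) hK.isClosed hz
    refine ⟨h1.resolve_right (fun h => ?_), h2⟩
    rw [infDist_zero_of_mem h] at h2; linarith
  have hfr : ∀ z ∈ frontier V, z ∈ Ω ∧ infDist z X = δ := by
    intro z hz
    have h1 := hcl z (frontier_subset_closure hz)
    rw [hVo.frontier_eq] at hz
    refine ⟨h1.1, le_antisymm (not_lt.1 fun h => hz.2 ⟨h1.1, h⟩) h1.2⟩
  have hJd : DifferentiableOn ℂ (fun w' => J (al χ w w') (al ψ v w') n b) Xᶜ := by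
    simp only [J]
    refine DifferentiableOn.fun_sum fun k _ => ?_
    exact ((al_diff χ w _).mul (al_diff ψ v _)).mul (differentiableOn_const _)
  refine Complex.norm_le_of_forall_mem_frontier_norm_le hVb
    (f := fun w' => J (al χ w w') (al ψ v w') n b)
    (DifferentiableOn.diffContOnCl (hJd.mono fun z hz hzX => disjoint_left.1 hdisj (hcl z hz).1 hzX))
    (fun z hz => ?_) (subset_closure ⟨hw, hwδ⟩)
  obtain ⟨hzΩ, hzd⟩ := hfr z hz
  obtain ⟨c, hcX, hcz, hcA, μ, hμ⟩ := hbar z hzΩ hzd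
  have hd : ∀ x ∈ X, δ ≤ ‖x - z‖ := by
    intro x hx
    rw [← hzd, ← dist_eq_norm, dist_comm]; exact infDist_le_dist_of_mem hx
  rw [← J_shift _ _ _ _ μ]
  have hbA : b - algebraMap ℂ _ μ ∈ A := A.sub_mem hb (A.algebraMap_mem _)
  have hμ' : ∀ x : X, ‖(b - algebraMap ℂ C(X, ℂ) μ) x‖ * ‖z - c‖ ≤ η * ‖(x : ℂ) - c‖ := hμ
  exact J_bound _ _ _ _ _ _ _ (by positivity) hη
    (al_pow_bound hχ hcX hcz hcA hbA hδ hR0 hRw hd hη hμ')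
    (al_pow_bound hψ hcX hcz hcA hbA hδ hR0 hRv hd hη hμ')

end rep

end Slice
end

open Set Metric Bornology MvPolynomial
noncomputable section

namespace Slice
open Filter Topology

theorem le_of_pow_le {a r C : ℝ} (ha : 0 ≤ a) (hr : 0 < r) (h : ∀ n : ℕ, a ^ n ≤ C * r ^ n) : a ≤ r := by
  by_contra hlt
  push Not at hlt
  have h1 : 1 < a / r := (one_lt_div hr).2 hlt
  obtain ⟨n, hn⟩ := pow_unbounded_of_one_lt C h1
  have := h n
  rw [div_pow, lt_div_iff₀ (pow_pos hr n)] at hn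
  linarith

section rep
variable {X : Set ℂ} [CompactSpace X] {A : Subalgebra ℂ C(X, ℂ)} {χ ψ : C(X, ℂ) →L[ℂ] ℂ} {w v : ℂ}

/-- barrier condition -/
def BarB (Ω : Set ℂ) (A : Subalgebra ℂ C(X, ℂ)) (b : C(X, ℂ)) : Prop :=
  ∀ η : ℝ, 0 < η → ∃ δ0 : ℝ, 0 < δ0 ∧ ∀ w' ∈ Ω, infDist w' X ≤ δ0 →
    ∃ c, c ∉ X ∧ c ≠ w' ∧ rs X c ∈ A ∧ ∃ μ : ℂ,
      ∀ x : X, ‖b x - μ‖ * ‖w' - c‖ ≤ η * ‖(x : ℂ) - c‖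

theorem Rep.nonempty (hχ : Rep A χ w) : X.Nonempty := by
  by_contra h
  rw [not_nonempty_iff_eq_empty] at h
  have h1 : (1 : C(X, ℂ)) = 0 := by
    ext x; exact absurd (h.subset x.2) (notMem_empty _)
  have := hχ.one
  rw [h1, map_zero] at this
  exact zero_ne_one this

theorem infDist_pos' (hX : X.Nonempty) {w : ℂ} (hw : w ∉ X) : 0 < infDist w X := by
  have hc : IsClosed X := (isCompact_iff_compactSpace.2 inferInstance).isClosed
  exact (hc.notMem_iff_infDist_pos hX).1 hw

theorem rep_uniq {Ω : Set ℂ} (hΩ : IsOpen Ω) (hdisj : Disjoint Ω X) (hK : IsCompact (Ω ∪ X))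
    (hχ : Rep A χ w) (hψ : Rep A ψ w) (hw : w ∈ Ω) {b : C(X, ℂ)} (hb : b ∈ A)
    (hbar : BarB Ω A b) : χ b = ψ b := by
  have hwX : w ∉ X := fun h => disjoint_left.1 hdisj hw h
  have hpos := infDist_pos' hχ.nonempty hwX
  have key : ∀ η : ℝ, 0 < η → ‖ψ b - χ b‖ ≤ 2 * η := by
    intro η hη
    obtain ⟨δ0, hδ0, hδ⟩ := hbar η hη
    obtain ⟨R, hR0, hR⟩ : ∃ R : ℝ, 0 ≤ R ∧ ∀ x ∈ X, ‖x - w‖ ≤ R := by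
      have hXb : IsBounded X := (isCompact_iff_compactSpace.2 inferInstance).isBounded
      obtain ⟨R, hR⟩ := hXb.subset_closedBall w
      refine ⟨max R 0, le_max_right _ _, fun x hx => ?_⟩
      have := hR hx
      rw [mem_closedBall, dist_eq_norm] at this
      exact this.trans (le_max_left _ _)
    set δ := min δ0 (infDist w X / 2) with hδd
    have hδpos : 0 < δ := lt_min hδ0 (by linarith)
    refine le_of_pow_le (C := (R / δ) * (R / δ)) (norm_nonneg _) (by positivity) (fun n => ?_)
    have := main_est hΩ hdisj hK hχ hψ hw hb hδpos hη.le hR0 hR hR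
      ((min_le_right _ _).trans_lt (by linarith)) (fun w' h1 h2 => hδ w' h1 (h2.le.trans (min_le_left _ _))) n
    rw [al_self hwX, hψ.pow (A.sub_mem hb (A.algebraMap_mem _)), map_sub, hψ.algebraMap, norm_pow] at this
    exact this
  have : ‖ψ b - χ b‖ ≤ 0 := by
    refine le_of_forall_pos_le_add fun ε hε => ?_
    have := key (ε / 2) (by linarith)
    linarith
  exact (sub_eq_zero.1 (norm_le_zero_iff.1 this)).symm

theorem rep_max {Ω : Set ℂ} (hΩ : IsOpen Ω) (hdisj : Disjoint Ω X) (hK : IsCompact (Ω ∪ X))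
    {c0 z : ℂ} {r : ℝ} (hball : closedBall c0 r ⊆ Ω) (hz : z ∈ ball c0 r)
    (χ : ℂ → C(X, ℂ) →L[ℂ] ℂ) (hχ : ∀ w ∈ sphere c0 r, Rep A (χ w) w)
    (hψ : Rep A ψ z) {b : C(X, ℂ)} (hb : b ∈ A) (hbar : BarB Ω A b) {M : ℝ}
    (hM : ∀ w ∈ sphere c0 r, ‖χ w b‖ ≤ M) : ‖ψ b‖ ≤ M := by
  have hr : 0 < r := dist_nonneg.trans_lt hz
  have hdX : ∀ w ∈ closedBall c0 r, w ∉ X := fun w hw h => disjoint_left.1 hdisj (hball hw) h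
  have hM0 : 0 ≤ M := by
    have hne : (sphere c0 r).Nonempty := NormedSpace.sphere_nonempty.2 hr.le
    obtain ⟨w, hw⟩ := hne
    exact (norm_nonneg _).trans (hM w hw)
  obtain ⟨δ1, hδ1, hδ1'⟩ : ∃ δ1 : ℝ, 0 < δ1 ∧ ∀ w ∈ closedBall c0 r, δ1 ≤ infDist w X := by
    obtain ⟨w0, hw0, hmin⟩ := (isCompact_closedBall c0 r).exists_isMinOn
      ⟨c0, mem_closedBall_self hr.le⟩ (continuous_infDist_pt X).continuousOn
    exact ⟨infDist w0 X, infDist_pos' hψ.nonempty (hdX w0 hw0), fun w hw => hmin hw⟩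
  obtain ⟨R, hR0, hR⟩ : ∃ R : ℝ, 0 ≤ R ∧ ∀ x ∈ X, ∀ w ∈ closedBall c0 r, ‖x - w‖ ≤ R := by
    obtain ⟨C, hC⟩ := hK.isBounded.exists_norm_le
    refine ⟨max (C + C) 0, le_max_right _ _, fun x hx w hw => ?_⟩
    exact ((norm_sub_le _ _).trans (add_le_add (hC x (Or.inr hx)) (hC w (Or.inl (hball hw))))).trans
      (le_max_left _ _)
  have key : ∀ η : ℝ, 0 < η → ‖ψ b‖ ≤ M + 2 * η := by
    intro η hη
    obtain ⟨δ0, hδ0, hδ⟩ := hbar η hη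
    set δ := min δ0 (δ1 / 2) with hδd
    have hδpos : 0 < δ := lt_min hδ0 (by linarith)
    have hδlt : δ < δ1 := (min_le_right _ _).trans_lt (by linarith)
    refine le_of_pow_le (C := (R / δ) * (R / δ)) (norm_nonneg _) (by positivity) (fun n => ?_)
    rw [← norm_pow, ← hψ.pow hb, ← al_self (w := z) (hdX z (ball_subset_closedBall hz)) (χ := ψ)]
    refine Complex.norm_le_of_forall_mem_frontier_norm_le (U := ball c0 r) isBounded_ball
      (f := fun w' => al ψ z w' (b ^ n)) (DifferentiableOn.diffContOnCl ?_) ?_ (subset_closure hz)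
    · rw [closure_ball c0 hr.ne']
      exact (al_diff ψ z _).mono hdX
    · intro w hw
      rw [frontier_ball c0 hr.ne'] at hw
      have hwc := sphere_subset_closedBall hw
      set t := χ w b with ht
      have hexp : b ^ n = ∑ k ∈ Finset.range (n + 1),
          (t ^ k * (n.choose k : ℂ)) • (b - algebraMap ℂ C(X, ℂ) t) ^ (n - k) := by
        conv_lhs => rw [← add_sub_cancel (algebraMap ℂ C(X, ℂ) t) b, add_pow]
        refine Finset.sum_congr rfl fun k _ => ?_
        rw [Algebra.smul_def, map_mul, map_pow, map_natCast]; ring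
      rw [hexp, map_sum, add_pow, Finset.mul_sum]
      refine (norm_sum_le _ _).trans (Finset.sum_le_sum fun k _ => ?_)
      rw [map_smul, norm_smul, norm_mul, norm_pow, Complex.norm_natCast]
      have := main_est hΩ hdisj hK (hχ w hw) hψ (hball hwc) hb hδpos hη.le hR0
        (fun x hx => hR x hx w hwc) (fun x hx => hR x hx z (ball_subset_closedBall hz))
        (hδlt.trans_le (hδ1' w hwc)) (fun w' h1 h2 => hδ w' h1 (h2.le.trans (min_le_left _ _))) (n - k)
      calc ‖t‖ ^ k * (n.choose k : ℝ) * ‖al ψ z w ((b - algebraMap ℂ C(X, ℂ) t) ^ (n - k))‖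
          ≤ M ^ k * (n.choose k : ℝ) * ((R / δ) * (R / δ) * (2 * η) ^ (n - k)) := by
            gcongr
            exact hM w hw
        _ = _ := by ring
  refine le_of_forall_pos_le_add fun ε hε => ?_
  have := key (ε / 2) (by linarith)
  linarith

end rep

end Slice
end

open Set Metric Bornology MvPolynomial
noncomputable section

namespace Slice
open Filter Topology

theorem exists_char {X : Set ℂ} [CompactSpace X] {Q : Type*} [CommRing Q] [Algebra ℂ Q]
    (e : Q →ₐ[ℂ] C(X, ℂ)) (p : Q →ₐ[ℂ] ℂ) (h : ∀ q, ‖p q‖ ≤ ‖e q‖) :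
    ∃ χ : C(X, ℂ) →L[ℂ] ℂ, ‖χ‖ ≤ 1 ∧ (∀ q, χ (e q) = p q) ∧
      ∀ a ∈ e.range.topologicalClosure, ∀ b ∈ e.range.topologicalClosure, χ (a * b) = χ a * χ b := by
  have hker : LinearMap.ker e.toLinearMap ≤ LinearMap.ker p.toLinearMap := by
    intro q hq
    rw [LinearMap.mem_ker] at hq ⊢
    have := h q
    simp only [AlgHom.toLinearMap_apply] at hq ⊢
    rw [hq, norm_zero] at this
    exact norm_le_zero_iff.1 this
  let M : Submodule ℂ C(X, ℂ) := LinearMap.range e.toLinearMap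
  let l : M →ₗ[ℂ] ℂ := ((LinearMap.ker e.toLinearMap).liftQ p.toLinearMap hker) ∘ₗ
    (e.toLinearMap.quotKerEquivRange.symm : M →ₗ[ℂ] _)
  have hl : ∀ q, l ⟨e q, ⟨q, rfl⟩⟩ = p q := by
    intro q
    have : e.toLinearMap.quotKerEquivRange.symm ⟨e q, ⟨q, rfl⟩⟩ = Submodule.Quotient.mk q := by
      rw [LinearEquiv.symm_apply_eq]
      rfl
    simp only [l, LinearMap.comp_apply, LinearEquiv.coe_coe]
    rw [this]; rfl
  have hb : ∀ m : M, ‖l m‖ ≤ 1 * ‖m‖ := by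
    rintro ⟨_, q, rfl⟩
    rw [one_mul]
    have := hl q
    simp only [AlgHom.toLinearMap_apply] at this ⊢
    rw [this]
    exact h q
  obtain ⟨χ, hχ, hn⟩ := exists_extension_norm_eq M (l.mkContinuous 1 hb)
  have hχ' : ∀ q, χ (e q) = p q := by
    intro q
    have := hχ ⟨e q, ⟨q, rfl⟩⟩
    rw [← hl q]
    exact this
  refine ⟨χ, ?_, hχ', ?_⟩
  · rw [hn]; exact LinearMap.mkContinuous_norm_le _ zero_le_one _
  · have key : ∀ a ∈ e.range, ∀ b ∈ e.range, χ (a * b) = χ a * χ b := by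
      rintro _ ⟨q, rfl⟩ _ ⟨r, rfl⟩
      have : e q * e r = e (q * r) := (map_mul e q r).symm
      show χ (e q * e r) = χ (e q) * χ (e r)
      rw [this, hχ', hχ', hχ', map_mul]
    have k2 : ∀ a ∈ e.range, ∀ b ∈ closure (e.range : Set C(X, ℂ)), χ (a * b) = χ a * χ b := by
      intro a ha b hb
      have hc : IsClosed {b : C(X, ℂ) | χ (a * b) = χ a * χ b} :=
        isClosed_eq (by fun_prop) (by fun_prop)
      exact closure_minimal (s := (e.range : Set C(X, ℂ))) (fun b hb => key a ha b hb) hc hb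
    intro a ha b hb
    have hc : IsClosed {a : C(X, ℂ) | χ (a * b) = χ a * χ b} :=
        isClosed_eq (by fun_prop) (by fun_prop)
    exact closure_minimal (s := (e.range : Set C(X, ℂ))) (fun a ha => k2 a ha b hb) hc ha

/-- Hahn–Banach membership in a closed subspace -/
theorem mem_closure_of_dual {F : Type*} [NormedAddCommGroup F] [NormedSpace ℂ F]
    (M : Submodule ℂ F) (x : F)
    (h : ∀ ν : F →L[ℂ] ℂ, (∀ m ∈ M, ν m = 0) → ν x = 0) : x ∈ closure (M : Set F) := by
  by_contra hx
  have hn : ‖M.mkQ x‖ ≠ 0 := by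
    intro h0
    apply hx
    exact (QuotientAddGroup.norm_mk_eq_zero_iff_mem_closure (S := M.toAddSubgroup)).1 h0
  obtain ⟨g, _, hg⟩ := exists_dual_vector ℂ (M.mkQ x) hn
  have := h (g.comp M.mkQL) (by
    intro m hm
    have : M.mkQ m = 0 := by simpa using hm
    show g (M.mkQ m) = 0
    rw [this, map_zero])
  have h2 : g (M.mkQ x) = 0 := this
  rw [hg] at h2
  exact hn (Complex.ofReal_eq_zero.1 h2)

variable {E : Type*} [NormedAddCommGroup E] [NormedSpace ℂ E]

/-- generators -/
def QS (D : Set E) : Set (E × ℂ → ℂ) :=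
  {q | ∃ (g : E → ℂ) (U : Set E), IsOpen U ∧ closure D ⊆ U ∧ DifferentiableOn ℂ g U ∧
    q = fun p => g p.1} ∪ {Prod.snd}

/-- polynomials in the last variable with coefficients holomorphic near `closure D` -/
def QA (D : Set E) : Subalgebra ℂ (E × ℂ → ℂ) := Algebra.adjoin ℂ (QS D)

theorem QA_diff {D : Set E} {q : E × ℂ → ℂ} (hq : q ∈ QA D) :
    ∃ U : Set E, IsOpen U ∧ closure D ⊆ U ∧ DifferentiableOn ℂ q (U ×ˢ univ) := by
  induction hq using Algebra.adjoin_induction with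
  | mem q hq =>
    rcases hq with ⟨g, U, hU, hDU, hg, rfl⟩ | hq
    · exact ⟨U, hU, hDU, hg.comp differentiableOn_fst (fun p hp => hp.1)⟩
    · rw [mem_singleton_iff] at hq
      subst hq
      exact ⟨univ, isOpen_univ, subset_univ _, differentiableOn_snd⟩
  | algebraMap r =>
    exact ⟨univ, isOpen_univ, subset_univ _, differentiableOn_const r⟩
  | add p q _ _ hp hq =>
    obtain ⟨U, hU, hDU, h⟩ := hp
    obtain ⟨V, hV, hDV, h'⟩ := hq
    exact ⟨U ∩ V, hU.inter hV, subset_inter hDU hDV,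
      (h.mono (prod_mono inter_subset_left subset_rfl)).add
      (h'.mono (prod_mono inter_subset_right subset_rfl))⟩
  | mul p q _ _ hp hq =>
    obtain ⟨U, hU, hDU, h⟩ := hp
    obtain ⟨V, hV, hDV, h'⟩ := hq
    exact ⟨U ∩ V, hU.inter hV, subset_inter hDU hDV,
      (h.mono (prod_mono inter_subset_left subset_rfl)).mul
      (h'.mono (prod_mono inter_subset_right subset_rfl))⟩

theorem QA_cont {D : Set E} {q : E × ℂ → ℂ} (hq : q ∈ QA D) : ContinuousOn q (closure D ×ˢ univ) := by
  obtain ⟨U, hU, hDU, h⟩ := QA_diff hq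
  exact h.continuousOn.mono (prod_mono hDU subset_rfl)

theorem QA_fst {D : Set E} {g : E → ℂ} {U : Set E} (hU : IsOpen U) (hD : closure D ⊆ U)
    (hg : DifferentiableOn ℂ g U) : (fun p : E × ℂ => g p.1) ∈ QA D :=
  Algebra.subset_adjoin (Or.inl ⟨g, U, hU, hD, hg, rfl⟩)

theorem QA_snd {D : Set E} : (Prod.snd : E × ℂ → ℂ) ∈ QA D :=
  Algebra.subset_adjoin (Or.inr rfl)

/-- the hull values -/
def SS (D : Set E) (f : E → ℂ) (X : Set E) (p : E) : Set ℂ :=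
  {l | ∀ q ∈ QA D, ∀ C : ℝ, (∀ z ∈ X, ‖q (z, f z)‖ ≤ C) → ‖q (p, l)‖ ≤ C}

theorem SS_mono {D : Set E} {f : E → ℂ} {X Y : Set E} {p : E} (h : X ⊆ Y) : SS D f X p ⊆ SS D f Y p :=
  fun _ hl q hq C hC => hl q hq C (fun z hz => hC z (h hz))

/-- evaluation on `X` -/
def evA (D : Set E) (f : E → ℂ) (φ : ℂ → E) (X : Set ℂ)
    (hc : ∀ q ∈ QA D, ContinuousOn (fun w => q (φ w, f (φ w))) X) : QA D →ₐ[ℂ] C(X, ℂ) where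
  toFun q := ⟨fun x => q.1 (φ x, f (φ x)), (hc q.1 q.2).comp_continuous continuous_subtype_val (fun x => x.2)⟩
  map_one' := by ext x; rfl
  map_mul' a b := by ext x; rfl
  map_zero' := by ext x; rfl
  map_add' a b := by ext x; rfl
  commutes' r := by ext x; rfl

theorem evA_apply {D : Set E} {f : E → ℂ} {φ : ℂ → E} {X : Set ℂ}
    (hc : ∀ q ∈ QA D, ContinuousOn (fun w => q (φ w, f (φ w))) X) (q : QA D) (x : X) :
    evA D f φ X hc q x = q.1 (φ x, f (φ x)) := rfl

/-- evaluation at a point -/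
def pt (D : Set E) (p : E × ℂ) : QA D →ₐ[ℂ] ℂ := (Pi.evalAlgHom ℂ (fun _ : E × ℂ => ℂ) p).comp (QA D).val

theorem pt_apply {D : Set E} (p : E × ℂ) (q : QA D) : pt D p q = q.1 p := rfl

section
variable {D : Set E} {f : E → ℂ} {G : Set ℂ} {φ : ℂ → E} {ξ : E → ℂ} {X : Set ℂ} [CompactSpace X]

theorem evA_cont (hs : IsSlice D G φ ξ) (hf : ContinuousOn f (frontier D)) (hX : X = SX D G φ) :
    ∀ q ∈ QA D, ContinuousOn (fun w => q (φ w, f (φ w))) X := by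
  intro q hq
  have h1 : ContinuousOn φ X := hs.φ_diff.continuousOn.mono (by rw [hX]; exact inter_subset_left)
  have h2 : MapsTo φ X (frontier D) := by rw [hX]; exact fun w hw => hw.2
  exact (QA_cont hq).comp (h1.prodMk (hf.comp h1 h2)) (fun w hw => ⟨frontier_subset_closure (h2 hw), mem_univ _⟩)

/-- the closed slice algebra -/
def AX (D : Set E) (f : E → ℂ) (φ : ℂ → E) (X : Set ℂ) [CompactSpace X]
    (hc : ∀ q ∈ QA D, ContinuousOn (fun w => q (φ w, f (φ w))) X) : Subalgebra ℂ C(X, ℂ) :=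
  (evA D f φ X hc).range.topologicalClosure

theorem evA_mem (hc : ∀ q ∈ QA D, ContinuousOn (fun w => q (φ w, f (φ w))) X) (q : QA D) :
    evA D f φ X hc q ∈ AX D f φ X hc :=
  subset_closure ⟨q, rfl⟩

theorem xi_eq_ev (hs : IsSlice D G φ ξ) (hX : X = SX D G φ)
    (hc : ∀ q ∈ QA D, ContinuousOn (fun w => q (φ w, f (φ w))) X) :
    evA D f φ X hc ⟨fun p => ξ p.1, QA_fst isOpen_univ (subset_univ _) hs.ξ_diff.differentiableOn⟩ = xi X := by
  ext x
  rw [evA_apply, xi_apply]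
  have hx : (x : ℂ) ∈ SX D G φ := by rw [← hX]; exact x.2
  exact hs.ξφ _ hx.1

theorem rep_of_SS (hs : IsSlice D G φ ξ) (hX : X = SX D G φ)
    (hc : ∀ q ∈ QA D, ContinuousOn (fun w => q (φ w, f (φ w))) X) {w l : ℂ} (hw : w ∈ G)
    (hl : l ∈ SS D f (φ '' X) (φ w)) :
    ∃ χ : C(X, ℂ) →L[ℂ] ℂ, Rep (AX D f φ X hc) χ w ∧
      ∀ q : QA D, χ (evA D f φ X hc q) = q.1 (φ w, l) := by
  obtain ⟨χ, h1, h2, h3⟩ := exists_char (evA D f φ X hc) (pt D (φ w, l)) (by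
    intro q
    apply hl q.1 q.2
    rintro _ ⟨x, hx, rfl⟩
    exact (evA D f φ X hc q).norm_coe_le_norm ⟨x, hx⟩)
  refine ⟨χ, ⟨h1, ?_, h3, ?_, ?_⟩, h2⟩
  · have := h2 1
    rw [map_one (evA D f φ X hc), map_one (pt D (φ w, l))] at this
    exact this
  · rw [← xi_eq_ev hs hX hc]; exact evA_mem hc _
  · rw [← xi_eq_ev hs hX hc, h2, pt_apply]
    exact hs.ξφ _ hw

theorem cm_comp_mem (hs : IsSlice D G φ ξ) (hX : X = SX D G φ)
    (hc : ∀ q ∈ QA D, ContinuousOn (fun w => q (φ w, f (φ w))) X) {g : E → ℂ} {U : Set E}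
    (hU : IsOpen U) (hD : closure D ⊆ U) (hg : DifferentiableOn ℂ g U) :
    cm X (g ∘ φ) = evA D f φ X hc ⟨_, QA_fst hU hD hg⟩ := by
  ext x
  rw [evA_apply, cm_apply]
  · rfl
  · exact hc _ (QA_fst hU hD hg)

theorem rs_mem (hs : IsSlice D G φ ξ) (hX : X = SX D G φ) (hDc : IsCompact (closure D))
    (hst : HasSteinNeighbourhoodBasis (closure D))
    (hc : ∀ q ∈ QA D, ContinuousOn (fun w => q (φ w, f (φ w))) X) {c : ℂ} (hcG : c ∈ G)
    (hcD : φ c ∉ closure D) : rs X c ∈ AX D f φ X hc := by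
  obtain ⟨U, hU, hDU, hUc⟩ := hst {φ c}ᶜ isOpen_compl_singleton (fun z hz h => hcD (h ▸ hz))
  apply mem_closure_of_dual (Subalgebra.toSubmodule (evA D f φ X hc).range)
  intro ν hν
  refine (stein_key hs hDc X hX U hU hDU ν ?_).1 c hcG (fun h => hUc h rfl)
  intro g hg
  rw [cm_comp_mem hs hX hc hU.1 hDU hg]
  exact hν _ ⟨_, rfl⟩

theorem rs_mul_mem (hs : IsSlice D G φ ξ) (hX : X = SX D G φ) (hDc : IsCompact (closure D))
    (hst : HasSteinNeighbourhoodBasis (closure D)) 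
    (hc : ∀ q ∈ QA D, ContinuousOn (fun w => q (φ w, f (φ w))) X) {a : ℂ} (haG : a ∈ G)
    (haD : φ a ∈ closure D) (haF : φ a ∉ frontier D) {g : E → ℂ} {V : Set E}
    (hV : IsOpen V) (hDV : closure D ⊆ V) (hg : DifferentiableOn ℂ g V) :
    rs X a * (cm X (g ∘ φ) - algebraMap ℂ _ (g (φ a))) ∈ AX D f φ X hc := by
  obtain ⟨U, hU, hDU, hUV⟩ := hst V hV hDV
  apply mem_closure_of_dual (Subalgebra.toSubmodule (evA D f φ X hc).range)
  intro ν hν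
  have := (stein_key hs hDc X hX U hU hDU ν (by
    intro g hg
    rw [cm_comp_mem hs hX hc hU.1 hDU hg]
    exact hν _ ⟨_, rfl⟩)).2 a haG haD haF g (hg.mono hUV)
  rw [mul_sub, map_sub, this]
  have h2 : rs X a * algebraMap ℂ C(X, ℂ) (g (φ a)) = g (φ a) • rs X a := by
    rw [mul_comm, ← Algebra.smul_def]
  rw [h2, map_smul, smul_eq_mul, sub_self]

theorem SS_nonempty (hs : IsSlice D G φ ξ) (hX : X = SX D G φ) (hDc : IsCompact (closure D))
    (hst : HasSteinNeighbourhoodBasis (closure D)) 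
    (hc : ∀ q ∈ QA D, ContinuousOn (fun w => q (φ w, f (φ w))) X) {a : ℂ} (haG : a ∈ G)
    (haD : φ a ∈ closure D) (haF : φ a ∉ frontier D)
    (hA : ∀ q ∈ QA D, ∃ x ∈ X, 1/2 ≤ ‖(x - a) * q (φ x, f (φ x)) - 1‖) :
    (SS D f (φ '' X) (φ a)).Nonempty := by
  set A := AX D f φ X hc with hAdef
  have haX : a ∉ X := by rw [hX]; exact fun h => haF h.2
  have hxi : xi X ∈ A := by rw [← xi_eq_ev hs hX hc]; exact evA_mem hc _
  have : IsClosed (A : Set C(X, ℂ)) := Subalgebra.isClosed_topologicalClosure _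
  haveI : CompleteSpace A := this.completeSpace_coe
  let y : A := ⟨xi X, hxi⟩ - algebraMap ℂ A a
  have hy : ¬ IsUnit y := by
    rintro ⟨u, hu⟩
    have hinv : ((↑u⁻¹ : A) : C(X, ℂ)) ∈ closure ((evA D f φ X hc).range : Set C(X, ℂ)) := (↑u⁻¹ : A).2
    have h1 : (xi X - algebraMap ℂ _ a) * ((↑u⁻¹ : A) : C(X, ℂ)) = 1 := by
      have : (u : A) * (↑u⁻¹ : A) = 1 := u.mul_inv
      rw [hu] at this
      exact congrArg Subtype.val this
    obtain ⟨_, ⟨q, rfl⟩, hq⟩ := Metric.mem_closure_iff.1 hinv (1 / 4 / (1 + ‖xi X - algebraMap ℂ _ a‖)) (by positivity)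
    obtain ⟨x, hx, hx2⟩ := hA q.1 q.2
    have h3 : ‖(xi X - algebraMap ℂ _ a) * (evA D f φ X hc q) - 1‖ < 1 / 2 := by
      rw [← h1, ← mul_sub]
      refine (norm_mul_le _ _).trans_lt ?_
      rw [dist_eq_norm, norm_sub_rev, lt_div_iff₀ (by positivity)] at hq
      have h0 := norm_nonneg ((evA D f φ X hc) q - ((↑u⁻¹ : A) : C(X, ℂ)))
      have h4 : ‖(evA D f φ X hc) q - ((↑u⁻¹ : A) : C(X, ℂ))‖ * (1 + ‖xi X - algebraMap ℂ C(X, ℂ) a‖) < 1 / 4 := hq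
      nlinarith
    have h5 := ((xi X - algebraMap ℂ _ a) * (evA D f φ X hc q) - 1).norm_coe_le_norm ⟨x, hx⟩
    have h6 : ((xi X - algebraMap ℂ _ a) * (evA D f φ X hc q) - 1 : C(X, ℂ)) ⟨x, hx⟩ = (x - a) * q.1 (φ x, f (φ x)) - 1 := rfl
    rw [h6] at h5
    linarith
  obtain ⟨χ, hχ⟩ := WeakDual.CharacterSpace.exists_apply_eq_zero hy
  have hχa : χ ⟨xi X, hxi⟩ = a := by
    simp only [y, map_sub] at hχ
    rw [sub_eq_zero] at hχ
    rw [hχ]; exact AlgHomClass.commutes χ a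
  let ev : QA D → A := fun q => ⟨evA D f φ X hc q, evA_mem hc q⟩
  refine ⟨χ (ev ⟨_, QA_snd⟩), ?_⟩
  have key : ∀ q (hq : q ∈ QA D), χ (ev ⟨q, hq⟩) = q (φ a, χ (ev ⟨_, QA_snd⟩)) := by
    intro q hq
    induction hq using Algebra.adjoin_induction with
    | mem q hq =>
      rcases hq with ⟨g, U, hU, hDU, hg, rfl⟩ | hq
      · have hm := rs_mul_mem hs hX hDc hst hc haG haD haF hU hDU hg
        have h1 : (⟨xi X, hxi⟩ - algebraMap ℂ A a) * (⟨_, hm⟩ : A) = ev ⟨_, QA_fst hU hDU hg⟩ - algebraMap ℂ A (g (φ a)) := by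
          apply Subtype.ext
          show (xi X - algebraMap ℂ _ a) * (rs X a * (cm X (g ∘ φ) - algebraMap ℂ _ (g (φ a)))) = evA D f φ X hc ⟨_, QA_fst hU hDU hg⟩ - algebraMap ℂ C(X, ℂ) (g (φ a))
          rw [← mul_assoc, xi_mul_rs haX, one_mul, cm_comp_mem hs hX hc hU hDU hg]
        have h2 := congrArg χ h1
        rw [map_mul, map_sub, map_sub, hχa, AlgHomClass.commutes, AlgHomClass.commutes] at h2
        simp only [Algebra.algebraMap_self, RingHom.id_apply, sub_self, zero_mul] at h2
        exact (sub_eq_zero.1 h2.symm)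
      · rw [mem_singleton_iff] at hq
        subst hq
        rfl
    | algebraMap r =>
      exact AlgHomClass.commutes χ r
    | add p q hp hq h1 h2 =>
      have : ev ⟨p + q, add_mem hp hq⟩ = ev ⟨p, hp⟩ + ev ⟨q, hq⟩ := by
        apply Subtype.ext; exact map_add (evA D f φ X hc) ⟨p, hp⟩ ⟨q, hq⟩
      rw [this, map_add, h1, h2]; rfl
    | mul p q hp hq h1 h2 =>
      have : ev ⟨p * q, mul_mem hp hq⟩ = ev ⟨p, hp⟩ * ev ⟨q, hq⟩ := by
        apply Subtype.ext; exact map_mul (evA D f φ X hc) ⟨p, hp⟩ ⟨q, hq⟩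
      rw [this, map_mul, h1, h2]; rfl
  intro q hq C hC
  rw [← key q hq]
  obtain ⟨x, hx, _⟩ := hA q hq
  have hC0 : 0 ≤ C := (norm_nonneg _).trans (hC _ ⟨x, hx, rfl⟩)
  haveI : Nontrivial C(X, ℂ) := by
    haveI : Nonempty X := ⟨⟨x, hx⟩⟩
    infer_instance
  haveI : NormOneClass A := ⟨by
    haveI : Nonempty X := ⟨⟨x, hx⟩⟩
    show ‖(1 : C(X, ℂ))‖ = 1
    exact norm_one⟩
  refine (spectrum.norm_le_norm_of_mem (AlgHom.apply_mem_spectrum χ (ev ⟨q, hq⟩))).trans ?_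
  show ‖evA D f φ X hc ⟨q, hq⟩‖ ≤ C
  rw [ContinuousMap.norm_le _ hC0]
  intro x
  exact hC _ ⟨x, x.2, rfl⟩

end
end Slice
end

open Set Metric Bornology MvPolynomial
noncomputable section

namespace Slice
open Filter Topology

variable {E : Type*} [NormedAddCommGroup E] [NormedSpace ℂ E]

theorem SS_bound {D : Set E} {f : E → ℂ} {X : Set E} {p : E} {l : ℂ} {R : ℝ}
    (hl : l ∈ SS D f X p) (hR : ∀ z ∈ X, ‖f z‖ ≤ R) : ‖l‖ ≤ R :=
  hl _ QA_snd R hR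

theorem SS_usc {D : Set E} {f : E → ℂ} (hfc : IsCompact (frontier D))
    (hf : ContinuousOn f (frontier D)) {X0 : Set E} (hX0 : X0 ⊆ frontier D) {p0 : E}
    (hp0 : p0 ∈ closure D) {l0 : ℂ} (h0 : SS D f X0 p0 ⊆ {l0}) {ε : ℝ} (hε : 0 < ε) :
    ∃ W : Set E, IsOpen W ∧ X0 ⊆ W ∧ ∀ᶠ p in 𝓝 p0, ∀ X : Set E, X ⊆ W → X ⊆ frontier D →
      ∀ l ∈ SS D f X p, ‖l - l0‖ < ε := by
  obtain ⟨R, hR⟩ := hfc.exists_bound_of_continuousOn hf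
  have hcomp : IsCompact (closedBall (0 : ℂ) R \ ball l0 ε) :=
    (isCompact_closedBall 0 R).diff isOpen_ball
  have key : ∃ W : Set E, IsOpen W ∧ X0 ⊆ W ∧ ∀ᶠ p in 𝓝 p0, ∀ X : Set E, X ⊆ W → X ⊆ frontier D →
      ∀ l ∈ SS D f X p, l ∉ (closedBall (0 : ℂ) R \ ball l0 ε) := by
    refine hcomp.induction_on (p := fun S => ∃ W : Set E, IsOpen W ∧ X0 ⊆ W ∧ ∀ᶠ p in 𝓝 p0,
      ∀ X : Set E, X ⊆ W → X ⊆ frontier D → ∀ l ∈ SS D f X p, l ∉ S) ?_ ?_ ?_ ?_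
    · exact ⟨univ, isOpen_univ, subset_univ _, Eventually.of_forall (fun _ _ _ _ _ _ h => h)⟩
    · rintro s t hst ⟨W, hW, hXW, h⟩
      refine ⟨W, hW, hXW, h.mono ?_⟩
      intro p hp X h1 h2 l hl hs
      exact hp X h1 h2 l hl (hst hs)
    · rintro s t ⟨W, hW, hXW, h⟩ ⟨W', hW', hXW', h'⟩
      refine ⟨W ∩ W', hW.inter hW', subset_inter hXW hXW', ?_⟩
      filter_upwards [h, h'] with p hp hp' X h1 h2 l hl hs
      rcases hs with hs | hs
      · exact hp X (h1.trans inter_subset_left) h2 l hl hs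
      · exact hp' X (h1.trans inter_subset_right) h2 l hl hs
    · intro l1 hl1
      have hne : l1 ∉ SS D f X0 p0 := by
        intro h
        have := h0 h
        rw [mem_singleton_iff] at this
        rw [this] at hl1
        exact hl1.2 (mem_ball_self hε)
      simp only [SS, mem_ofPred_eq, not_forall, not_le] at hne
      obtain ⟨q, hq, C, hC, hlt⟩ := hne
      obtain ⟨m, hm1, hm2⟩ := exists_between hlt
      obtain ⟨U, hU, hDU, hqU⟩ := QA_diff hq
      have hqf : ContinuousOn (fun z => ‖q (z, f z)‖) (frontier D) :=
        ((QA_cont hq).comp (continuousOn_id.prodMk hf)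
          (fun z hz => ⟨frontier_subset_closure hz, mem_univ _⟩)).norm
      obtain ⟨W, hW, hWeq⟩ := (_root_.continuousOn_iff'.1 hqf) (Iio m) isOpen_Iio
      have hqc : ContinuousAt q (p0, l1) :=
        hqU.continuousOn.continuousAt ((hU.prod isOpen_univ).mem_nhds ⟨hDU hp0, mem_univ _⟩)
      have hev : ∀ᶠ p in 𝓝 (p0, l1), m < ‖q p‖ := hqc.norm.eventually (lt_mem_nhds hm2)
      rw [nhds_prod_eq] at hev
      obtain ⟨pa, hpa, pb, hpb, hab⟩ := eventually_prod_iff.1 hev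
      refine ⟨{l | pb l}, mem_nhdsWithin_of_mem_nhds hpb, W, hW, ?_, ?_⟩
      · intro z hz
        have : z ∈ (fun z => ‖q (z, f z)‖) ⁻¹' Iio m ∩ frontier D := ⟨(hC z hz).trans_lt hm1, hX0 hz⟩
        rw [hWeq] at this
        exact this.1
      · filter_upwards [hpa] with p hp X h1 h2 l hl hs
        have := hl q hq m (by
          intro z hz
          have : z ∈ W ∩ frontier D := ⟨h1 hz, h2 hz⟩
          rw [← hWeq] at this
          exact le_of_lt this.1)
        exact absurd (hab hp hs) (not_lt.2 this)
  obtain ⟨W, hW, hXW, h⟩ := key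
  refine ⟨W, hW, hXW, ?_⟩
  filter_upwards [h] with p hp X h1 h2 l hl
  by_contra hcon
  refine hp X h1 h2 l hl ⟨?_, ?_⟩
  · rw [mem_closedBall_zero_iff]
    exact SS_bound hl (fun z hz => hR z (h2 hz))
  · rwa [mem_ball, dist_eq_norm]

/-- local barrier condition -/
def BarLoc (D : Set E) (G : Set ℂ) (φ : ℂ → E) (X : Set ℂ) (x0 : ℂ) : Prop :=
  ∃ κ : ℝ, 0 < κ ∧ ∀ τ : ℝ, 0 < τ → ∀ᶠ w in 𝓝 x0, w ∈ G → φ w ∈ D →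
    ∃ c ∈ G, φ c ∉ closure D ∧ ‖w - c‖ ≤ τ ∧ ∀ x ∈ X, κ * ‖w - c‖ ≤ ‖x - c‖

theorem BarLoc.ev {D : Set E} {G : Set ℂ} {φ : ℂ → E} {X : Set ℂ} [CompactSpace X] {x0 : ℂ}
    (hx0 : x0 ∈ X) (h : BarLoc D G φ X x0) (b : C(X, ℂ)) {η : ℝ} (hη : 0 < η) :
    ∀ᶠ w in 𝓝 x0, w ∈ G → φ w ∈ D → ∃ c ∈ G, φ c ∉ closure D ∧ ∃ μ : ℂ,
      ∀ x : X, ‖b x - μ‖ * ‖w - c‖ ≤ η * ‖(x : ℂ) - c‖ := by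
  obtain ⟨κ, hκ, h⟩ := h
  have hbc : ContinuousAt b ⟨x0, hx0⟩ := b.continuous.continuousAt
  obtain ⟨ρ, hρ, hρ'⟩ := Metric.continuousAt_iff.1 hbc (η * κ) (by positivity)
  set τ := min (ρ / 4) (η * ρ / (4 * (‖b‖ + 1))) with hτ
  have hτ0 : 0 < τ := lt_min (by positivity) (by positivity)
  have hnear : ∀ᶠ w in 𝓝 x0, dist w x0 < ρ / 4 := ball_mem_nhds x0 (by positivity)
  filter_upwards [h τ hτ0, hnear] with w hw hw2 hwG hwD
  obtain ⟨c, hcG, hcD, hwc, hx⟩ := hw hwG hwD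
  refine ⟨c, hcG, hcD, b ⟨x0, hx0⟩, fun x => ?_⟩
  by_cases hd : dist (x : ℂ) x0 < ρ
  · have h1 := hρ' (x := x) hd
    rw [dist_eq_norm] at h1
    have h2 := hx x x.2
    calc ‖b x - b ⟨x0, hx0⟩‖ * ‖w - c‖ ≤ (η * κ) * ‖w - c‖ := by gcongr
      _ = η * (κ * ‖w - c‖) := by ring
      _ ≤ _ := by gcongr
  · push Not at hd
    have h1 : ‖b x - b ⟨x0, hx0⟩‖ ≤ 2 * ‖b‖ := by
      refine (norm_sub_le _ _).trans ?_
      have := b.norm_coe_le_norm x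
      have := b.norm_coe_le_norm ⟨x0, hx0⟩
      linarith
    have h2 : ρ / 2 ≤ ‖(x : ℂ) - c‖ := by
      have := dist_triangle4 (x : ℂ) c w x0
      rw [dist_eq_norm (x : ℂ) c, dist_eq_norm c w, norm_sub_rev c w] at this
      have := hwc.trans (min_le_left _ _)
      linarith
    have h3 : ‖w - c‖ ≤ η * ρ / (4 * (‖b‖ + 1)) := hwc.trans (min_le_right _ _)
    rw [le_div_iff₀ (by positivity)] at h3
    have h4 : 0 ≤ ‖b‖ := norm_nonneg _
    have h5 : 0 ≤ ‖w - c‖ := norm_nonneg _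
    calc ‖b x - b ⟨x0, hx0⟩‖ * ‖w - c‖ ≤ (2 * ‖b‖) * ‖w - c‖ := by gcongr
      _ ≤ η * (ρ / 2) := by nlinarith
      _ ≤ _ := by gcongr

section
variable {D : Set E} {f : E → ℂ} {G : Set ℂ} {φ : ℂ → E} {ξ : E → ℂ} {X : Set ℂ} [CompactSpace X]

theorem barB_of_loc (hs : IsSlice D G φ ξ) (hX : X = SX D G φ) (hXne : X.Nonempty)
    (hDc : IsCompact (closure D))
    (hst : HasSteinNeighbourhoodBasis (closure D))
    (hc : ∀ q ∈ QA D, ContinuousOn (fun w => q (φ w, f (φ w))) X)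
    (hB : ∀ x0 ∈ X, BarLoc D G φ X x0) (b : C(X, ℂ)) :
    BarB (G ∩ φ ⁻¹' D) (AX D f φ X hc) b := by
  intro η hη
  have hXc : IsCompact X := isCompact_iff_compactSpace.2 inferInstance
  have h1 : ∀ᶠ w in 𝓝ˢ X, w ∈ G → φ w ∈ D → ∃ c ∈ G, φ c ∉ closure D ∧ ∃ μ : ℂ,
      ∀ x : X, ‖b x - μ‖ * ‖w - c‖ ≤ η * ‖(x : ℂ) - c‖ := by
    rw [Filter.Eventually, mem_nhdsSet_iff_forall]
    intro x0 hx0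
    exact (hB x0 hx0).ev hx0 b hη
  obtain ⟨V, hV, hXV, hVs⟩ := mem_nhdsSet_iff_exists.1 h1
  obtain ⟨δ, hδ, hδV⟩ := hXc.exists_cthickening_subset_open hV hXV
  refine ⟨δ, hδ, fun w hw hwd => ?_⟩
  have hwV : w ∈ V := by
    apply hδV
    rw [mem_cthickening_iff]
    exact (ENNReal.le_ofReal_iff_toReal_le (infEDist_ne_top hXne) hδ.le).2 hwd
  obtain ⟨c, hcG, hcD, μ, hμ⟩ := hVs hwV hw.1 hw.2
  refine ⟨c, ?_, ?_, rs_mem hs hX hDc hst hc hcG hcD, μ, hμ⟩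
  · rw [hX]; exact fun h => hcD (frontier_subset_closure h.2)
  · rintro rfl; exact hcD (subset_closure hw.2)

theorem slice_D0 (hs : IsSlice D G φ ξ) (hX : X = SX D G φ)
    (hDc : IsCompact (closure D))
    (hst : HasSteinNeighbourhoodBasis (closure D)) (hf : ContinuousOn f (frontier D))
    {w l c μ : ℂ} (hw : w ∈ G) (hwD : φ w ∈ closure D) (hwF : φ w ∉ frontier D)
    (hl : l ∈ SS D f (φ '' X) (φ w))
    (hcG : c ∈ G) (hcD : φ c ∉ closure D) {η : ℝ} (hη : 0 < η)
    (hbar : ∀ x ∈ X, ‖f (φ x) - μ‖ * ‖w - c‖ ≤ η * ‖x - c‖) : ‖l - μ‖ ≤ η := by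
  have hc := evA_cont hs hf hX
  obtain ⟨χ, hχ, hχe⟩ := rep_of_SS hs hX hc hw hl
  have hwX : w ∉ X := by rw [hX]; exact fun h => hwF h.2
  have hcX : c ∉ X := by rw [hX]; exact fun h => hcD (frontier_subset_closure h.2)
  have hpos := infDist_pos' hχ.nonempty hwX
  obtain ⟨R, hR0, hR⟩ : ∃ R : ℝ, 0 ≤ R ∧ ∀ x ∈ X, ‖x - w‖ ≤ R := by
      have hXb : IsBounded X := (isCompact_iff_compactSpace.2 inferInstance).isBounded
      obtain ⟨R, hR⟩ := hXb.subset_closedBall w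
      refine ⟨max R 0, le_max_right _ _, fun x hx => ?_⟩
      have := hR hx
      rw [mem_closedBall, dist_eq_norm] at this
      exact this.trans (le_max_left _ _)
  refine le_of_pow_le (C := R / infDist w X) (norm_nonneg _) hη (fun n => ?_)
  have hbA : evA D f φ X hc ⟨_, QA_snd⟩ - algebraMap ℂ _ μ ∈ AX D f φ X hc :=
    Subalgebra.sub_mem _ (evA_mem hc _) (Subalgebra.algebraMap_mem _ _)
  have := al_pow_bound hχ hcX (by rintro rfl; exact hcD hwD) (rs_mem hs hX hDc hst hc hcG hcD)
    hbA hpos hR0 hR (fun x hx => by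
      rw [← dist_eq_norm, dist_comm]; exact infDist_le_dist_of_mem hx) hη.le
    (fun x => hbar x x.2) n
  rw [al_self hwX, hχ.pow hbA, map_sub, hχ.algebraMap, hχe, norm_pow] at this
  exact this

theorem slice_holo (hs : IsSlice D G φ ξ) (hX : X = SX D G φ) (hDo : IsOpen D)
    (hDc : IsCompact (closure D))
    (hst : HasSteinNeighbourhoodBasis (closure D)) (hf : ContinuousOn f (frontier D))
    (hA : ∀ a ∈ G, φ a ∈ D → ∀ q ∈ QA D, ∃ x ∈ X, 1/2 ≤ ‖(x - a) * q (φ x, f (φ x)) - 1‖)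
    (hB : ∀ x0 ∈ X, BarLoc D G φ X x0) :
    ∃ F : ℂ → ℂ, DifferentiableOn ℂ F (G ∩ φ ⁻¹' D) ∧
      ∀ w ∈ G, φ w ∈ D → SS D f (φ '' X) (φ w) = {F w} := by
  have hc := evA_cont hs hf hX
  have hDF : ∀ z ∈ D, z ∉ frontier D := fun z hz h => by
    rw [hDo.frontier_eq] at h; exact h.2 hz
  have hΩ : IsOpen (G ∩ φ ⁻¹' D) := hs.φ_diff.continuousOn.isOpen_inter_preimage hs.G_open hDo
  have hdisj : Disjoint (G ∩ φ ⁻¹' D) X := by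
    rw [disjoint_left, hX]; exact fun w h1 h2 => hDF _ h1.2 h2.2
  have hK : IsCompact ((G ∩ φ ⁻¹' D) ∪ X) := by
    convert hs.K_compact using 1
    rw [hX, SX, ← inter_union_distrib_left, ← preimage_union, closure_eq_self_union_frontier]
  have hne : ∀ a ∈ G, φ a ∈ D → (SS D f (φ '' X) (φ a)).Nonempty := fun a ha haD =>
    SS_nonempty hs hX hDc hst hc ha (subset_closure haD) (hDF _ haD) (hA a ha haD)
  have huniq : ∀ w ∈ G, φ w ∈ D → ∀ l ∈ SS D f (φ '' X) (φ w), ∀ l' ∈ SS D f (φ '' X) (φ w), l = l' := by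
    intro w hw hwD l hl l' hl'
    obtain ⟨χ, hχ, hχe⟩ := rep_of_SS hs hX hc hw hl
    obtain ⟨ψ, hψ, hψe⟩ := rep_of_SS hs hX hc hw hl'
    have := rep_uniq hΩ hdisj hK hχ hψ ⟨hw, hwD⟩ (evA_mem hc ⟨_, QA_snd⟩)
      (barB_of_loc hs hX hχ.nonempty hDc hst hc hB _)
    rwa [hχe, hψe] at this
  choose! F hF using hne
  have hSS : ∀ w ∈ G, φ w ∈ D → SS D f (φ '' X) (φ w) = {F w} := by
    intro w hw hwD
    refine Subset.antisymm (fun l hl => ?_) (fun l hl => ?_)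
    · exact huniq w hw hwD l hl _ (hF w hw hwD)
    · rw [mem_singleton_iff] at hl
      rw [hl]; exact hF w hw hwD
  refine ⟨F, ?_, hSS⟩
  have hXF : φ '' X ⊆ frontier D := by
    rintro _ ⟨x, hx, rfl⟩
    rw [hX] at hx; exact hx.2
  have hFc : ContinuousOn F (G ∩ φ ⁻¹' D) := by
    intro w hw
    apply ContinuousAt.continuousWithinAt
    rw [Metric.continuousAt_iff']
    intro ε hε
    obtain ⟨W, hW, hXW, hev⟩ := SS_usc (hDc.of_isClosed_subset isClosed_frontier frontier_subset_closure)
      hf hXF (subset_closure hw.2) (hSS w hw.1 hw.2).subset hε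
    have hφc : ContinuousAt φ w := (hs.φ_diff.continuousOn).continuousAt (hs.G_open.mem_nhds hw.1)
    filter_upwards [hφc.eventually hev, hΩ.mem_nhds hw] with w' h1 h2
    rw [dist_eq_norm]
    exact h1 _ hXW hXF _ (hF w' h2.1 h2.2)
  intro c hcΩ
  obtain ⟨r, hr, hball⟩ := Metric.nhds_basis_closedBall.mem_iff.1 (hΩ.mem_nhds hcΩ)
  have hdiff : DifferentiableOn ℂ F (ball c r) := by
    apply OneVar.holo_of_max F c r hr (hFc.mono (sphere_subset_closedBall.trans hball))
    intro p q M hM z hz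
    have hrep : ∀ w ∈ closedBall c r, ∃ χ : C(X, ℂ) →L[ℂ] ℂ, Rep (AX D f φ X hc) χ w ∧
      ∀ q : QA D, χ (evA D f φ X hc q) = q.1 (φ w, F w) := fun w hw =>
      rep_of_SS hs hX hc (hball hw).1 (hF w (hball hw).1 (hball hw).2)
    have hpd : ∀ p : Polynomial ℂ, Differentiable ℂ (fun z => p.eval (ξ z)) :=
      fun p => p.differentiable.comp hs.ξ_diff
    let Q : QA D := ⟨_, QA_fst isOpen_univ (subset_univ _) (hpd q).differentiableOn⟩ * ⟨_, QA_snd⟩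
      + ⟨_, QA_fst isOpen_univ (subset_univ _) (hpd p).differentiableOn⟩
    have hQ : ∀ w ∈ G, Q.1 (φ w, F w) = q.eval w * F w + p.eval w := by
      intro w hw
      show q.eval (ξ (φ w)) * F w + p.eval (ξ (φ w)) = _
      rw [hs.ξφ w hw]
    choose! χ hχ hχe using hrep
    have hzc := ball_subset_closedBall hz
    have := rep_max hΩ hdisj hK hball hz χ (fun w hw => hχ w (sphere_subset_closedBall hw))
      (hχ z hzc) (evA_mem hc Q) (barB_of_loc hs hX (hχ z hzc).nonempty hDc hst hc hB _) (M := M) (by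
        intro w hw
        have hw' := sphere_subset_closedBall hw
        rw [hχe w hw', hQ w (hball hw').1]
        exact hM w hw)
    rw [hχe z hzc, hQ z (hball hzc).1] at this
    exact this
  exact (hdiff.differentiableAt (ball_mem_nhds c hr)).differentiableWithinAt

end
end Slice
end

open Set Metric Bornology MvPolynomial
noncomputable section

namespace Slice
open Filter Topology

/-- parametrization of the slice -/
def pφ {N : ℕ} (T : EuclideanSpace ℂ (Fin N) ≃L[ℂ] EuclideanSpace ℂ (Fin N)) (p0 : EuclideanSpace ℂ (Fin N))
    (s : ℂ → ℂ) (t : ℂ) (i i' : Fin N) (w : ℂ) : EuclideanSpace ℂ (Fin N) :=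
  p0 + T.symm (w • EuclideanSpace.single i' 1 + (t / s w) • EuclideanSpace.single i 1)

/-- vector assembled from coordinates -/
def mkv {N : ℕ} (i i' : Fin N) (u v : ℂ) (w : Fin N → ℂ) : EuclideanSpace ℂ (Fin N) :=
  WithLp.toLp 2 (fun k => if k = i then u else if k = i' then v else w k)

theorem mkv_i {N : ℕ} (i i' : Fin N) (u v : ℂ) (w : Fin N → ℂ) : mkv i i' u v w i = u := by
  simp [mkv]

theorem mkv_i' {N : ℕ} {i i' : Fin N} (h : i' ≠ i) (u v : ℂ) (w : Fin N → ℂ) : mkv i i' u v w i' = v := by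
  simp [mkv, h]

theorem mkv_k {N : ℕ} {i i' k : Fin N} (h : k ≠ i) (h' : k ≠ i') (u v : ℂ) (w : Fin N → ℂ) :
    mkv i i' u v w k = w k := by
  simp [mkv, h, h']

theorem mkv_diff {N : ℕ} {E : Type*} [NormedAddCommGroup E] [NormedSpace ℂ E] (i i' : Fin N) {U : Set E}
    {u v : E → ℂ} {w : E → Fin N → ℂ} (hu : DifferentiableOn ℂ u U) (hv : DifferentiableOn ℂ v U)
    (hw : DifferentiableOn ℂ w U) : DifferentiableOn ℂ (fun z => mkv i i' (u z) (v z) (w z)) U := by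
  rw [differentiableOn_euclidean]
  intro k
  by_cases h : k = i
  · simpa [mkv, h] using hu
  by_cases h' : k = i'
  · have h2 : ¬ i' = i := h' ▸ h
    simpa [mkv, h', h2] using hv
  · simpa [mkv, h, h'] using differentiableOn_pi.1 hw k

theorem mkv_cont {N : ℕ} {E : Type*} [TopologicalSpace E] (i i' : Fin N) {U : Set E}
    {u v : E → ℂ} {w : E → Fin N → ℂ} (hu : ContinuousOn u U) (hv : ContinuousOn v U)
    (hw : ContinuousOn w U) : ContinuousOn (fun z => mkv i i' (u z) (v z) (w z)) U := by
  refine (PiLp.continuous_toLp 2 _).comp_continuousOn ?_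
  rw [continuousOn_pi]
  intro k
  by_cases h : k = i
  · simpa [h] using hu
  by_cases h' : k = i'
  · have h2 : ¬ i' = i := h' ▸ h
    simpa [h', h2] using hv
  · simpa [h, h'] using continuousOn_pi.1 hw k

/-- The degree hypothesis. -/
def DegHyp {N : ℕ} (D : Set (EuclideanSpace ℂ (Fin N)))
    (𝒟 : BrouwerDegreeTheory (EuclideanSpace ℂ (Fin N)))
    (Φ : EuclideanSpace ℂ (Fin N) → EuclideanSpace ℂ (Fin N)) : Prop :=
  ∀ (U : Set (EuclideanSpace ℂ (Fin N)))
        (G : EuclideanSpace ℂ (Fin N) → EuclideanSpace ℂ (Fin N)),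
        IsOpen U → closure D ⊆ U → DifferentiableOn ℂ G U →
        (∀ z ∈ frontier D, Φ z + G z ≠ 0) →
        ∀ F : EuclideanSpace ℂ (Fin N) → EuclideanSpace ℂ (Fin N),
          ContinuousOn F (closure D) →
          (∀ z ∈ frontier D, F z = Φ z + G z) →
          0 ≤ 𝒟.deg F D 0

theorem degA {N : ℕ} (D : Set (EuclideanSpace ℂ (Fin N)))
    (hDo : IsOpen D) (hDb : IsBounded D) (𝒟 : BrouwerDegreeTheory (EuclideanSpace ℂ (Fin N)))
    (Φ : EuclideanSpace ℂ (Fin N) → EuclideanSpace ℂ (Fin N)) (hΦ : Continuous Φ)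
    (hdeg : DegHyp D 𝒟 Φ) (i i' : Fin N) (hii : i' ≠ i)
    (T : EuclideanSpace ℂ (Fin N) ≃L[ℂ] EuclideanSpace ℂ (Fin N)) (p0 : EuclideanSpace ℂ (Fin N))
    (s : ℂ → ℂ) (hs : Differentiable ℂ s) (t : ℂ) (hst : ∀ w, s w = 0 → t ≠ 0)
    (a : ℂ) (ha : s a ≠ 0) (haD : pφ T p0 s t i i' a ∈ D)
    (q : EuclideanSpace ℂ (Fin N) × ℂ → ℂ) (hq : q ∈ QA D) :
    ∃ x, s x ≠ 0 ∧ pφ T p0 s t i i' x ∈ frontier D ∧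
      1 / 2 ≤ ‖(x - a) * q (pφ T p0 s t i i' x, Φ (pφ T p0 s t i i' x) i) - 1‖ := by
  by_contra hcon
  push Not at hcon
  have hDc : IsCompact (closure D) := hDb.isCompact_closure
  have hFc : IsCompact (frontier D) := hDc.of_isClosed_subset isClosed_frontier frontier_subset_closure
  let y : EuclideanSpace ℂ (Fin N) → EuclideanSpace ℂ (Fin N) := fun z => T (z - p0)
  have hyd : Differentiable ℂ y := T.differentiable.comp (differentiable_id.sub_const p0)
  have hyk : ∀ k, Differentiable ℂ (fun z => y z k) := fun k => differentiable_euclidean.1 hyd k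
  have hykc : ∀ k, Continuous (fun z => y z k) := fun k => (hyk k).continuous
  let h : EuclideanSpace ℂ (Fin N) → ℂ := fun z => s (y z i') * y z i - t
  have hhd : Differentiable ℂ h := ((hs.comp (hyk i')).mul (hyk i)).sub_const t
  have hhc : Continuous h := hhd.continuous
  obtain ⟨U, hU, hDU, hqU⟩ := QA_diff hq
  -- on the slice
  have hslice : ∀ z, h z = 0 → (∀ k, k ≠ i → k ≠ i' → y z k = 0) →
      s (y z i') ≠ 0 ∧ z = pφ T p0 s t i i' (y z i') := by
    intro z h0 hk
    have hne : s (y z i') ≠ 0 := by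
      intro h1
      apply hst _ h1
      have : s (y z i') * y z i - t = 0 := h0
      rw [h1, zero_mul, zero_sub, neg_eq_zero] at this
      exact this
    refine ⟨hne, ?_⟩
    have h1 : y z i = t / s (y z i') := by
      rw [eq_div_iff hne, mul_comm]
      exact sub_eq_zero.1 h0
    have h2 : y z = y z i' • EuclideanSpace.single i' 1 + (t / s (y z i')) • EuclideanSpace.single i 1 := by
      ext k
      by_cases hki : k = i
      · subst hki; simp [h1, hii.symm]
      by_cases hki' : k = i'
      · subst hki'; simp [hki]
      · simp [hk k hki hki', hki, hki']
    rw [pφ, ← h2]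
    simp [y]
  -- tau
  obtain ⟨τ, hτ, hest⟩ : ∃ τ > 0, ∀ z ∈ frontier D, ‖h z‖ ≤ τ → (∀ k, k ≠ i → k ≠ i' → ‖y z k‖ ≤ τ) →
      ‖(y z i' - a) * q (z, Φ z i) - 1‖ < 1 / 2 := by
    let H : EuclideanSpace ℂ (Fin N) → (Fin N → ℂ) := fun z k => if k = i then h z else if k = i' then 0 else y z k
    have hHc : Continuous H := by
      refine continuous_pi fun k => ?_
      by_cases hki : k = i
      · simpa [H, hki] using hhc
      by_cases hki' : k = i'
      · have h2 : (fun z => H z k) = fun _ => 0 := by funext z; simp [H, hki', hii]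
        rw [h2]; exact continuous_const
      · simpa [H, hki, hki'] using hykc k
    let B := {z ∈ frontier D | 1 / 2 ≤ ‖(y z i' - a) * q (z, Φ z i) - 1‖}
    have hBc : IsCompact B := by
      have hcont : ContinuousOn (fun z => ‖(y z i' - a) * q (z, Φ z i) - 1‖) (frontier D) := by
        have h1 : ContinuousOn (fun z => q (z, Φ z i)) (frontier D) :=
          (QA_cont hq).comp (f := fun z => (z, Φ z i)) (by fun_prop)
            (fun z hz => ⟨frontier_subset_closure hz, mem_univ _⟩)
        exact ((((hykc i').sub continuous_const).continuousOn.mul h1).sub continuousOn_const).norm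
      exact hFc.of_isClosed_subset (hcont.preimage_isClosed_of_isClosed isClosed_frontier isClosed_Ici)
        inter_subset_left
    have hpos : ∀ z ∈ B, 0 < ‖H z‖ := by
      rintro z ⟨hz1, hz2⟩
      rw [norm_pos_iff]
      intro h0
      have h1 : h z = 0 := by simpa [H] using congrFun h0 i
      obtain ⟨h2, h3⟩ := hslice z h1 (fun k hk hk' => by simpa [H, hk, hk'] using congrFun h0 k)
      have := hcon (y z i') h2 (h3 ▸ hz1)
      rw [← h3] at this
      linarith
    obtain ⟨τ, hτ, hτ'⟩ : ∃ τ > 0, ∀ z ∈ B, τ < ‖H z‖ := by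
      rcases B.eq_empty_or_nonempty with he | hne
      · exact ⟨1, one_pos, fun z hz => by rw [he] at hz; exact absurd hz (notMem_empty _)⟩
      · obtain ⟨z0, hz0, hmin⟩ := hBc.exists_isMinOn hne hHc.norm.continuousOn
        refine ⟨‖H z0‖ / 2, by have := hpos z0 hz0; positivity, fun z hz => ?_⟩
        have h1 := isMinOn_iff.1 hmin z hz
        have h2 := hpos z0 hz0
        linarith
    refine ⟨τ, hτ, fun z hz h1 h2 => ?_⟩
    by_contra h3
    push Not at h3
    have := hτ' z ⟨hz, h3⟩
    refine absurd this (not_lt.2 ((pi_norm_le_iff_of_nonneg hτ.le).2 fun k => ?_))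
    by_cases hki : k = i
    · simpa [H, hki] using h1
    by_cases hki' : k = i'
    · simpa [H, hki', hii] using hτ.le
    · simpa [H, hki, hki'] using h2 k hki hki'
  obtain ⟨R0, hR0⟩ := hFc.exists_bound_of_continuousOn hΦ.continuousOn
  obtain ⟨S0, hS0⟩ := hFc.exists_bound_of_continuousOn ((hykc i').sub (continuous_const (y := a))).continuousOn
  set R := max R0 1 with hRdef
  set S := max S0 1 with hSdef
  have hR1 : 1 ≤ R := le_max_right _ _
  have hS1 : 1 ≤ S := le_max_right _ _
  have hR : ∀ z ∈ frontier D, ∀ k, ‖Φ z k‖ ≤ R := fun z hz k =>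
    (PiLp.norm_apply_le (Φ z) k).trans ((hR0 z hz).trans (le_max_left _ _))
  have hS : ∀ z ∈ frontier D, ‖y z i' - a‖ ≤ S := fun z hz => (hS0 z hz).trans (le_max_left _ _)
  set ε : ℝ := τ / R with hεdef
  have hε : 0 < ε := by positivity
  set M : ℝ := R / τ + 2 * R * S + 1 with hMdef
  have hM : 0 < M := by positivity
  have hM1 : R / M ≤ τ := by
    rw [div_le_iff₀ hM]
    have : R = τ * (R / τ) := by field_simp
    nlinarith [mul_pos hτ (show 0 < R by linarith), mul_pos (mul_pos hτ (show 0 < R by linarith)) (show 0 < S by linarith)]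
  have hM2 : R * S < M / 2 := by
    have : 0 < R / τ := by positivity
    linarith
  have hεC : (ε : ℂ) ≠ 0 := by exact_mod_cast hε.ne'
  have hMC : (M : ℂ) ≠ 0 := by exact_mod_cast hM.ne'
  let Gm : EuclideanSpace ℂ (Fin N) → EuclideanSpace ℂ (Fin N) := fun z =>
    mkv i i' (h z / ε) (M * q (z, - (h z / ε))) (fun k => M * y z k)
  have hhed : Differentiable ℂ (fun z => h z / (ε : ℂ)) := by
    simp only [div_eq_mul_inv]; exact hhd.mul_const _
  have hGd : DifferentiableOn ℂ Gm U := by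
    apply mkv_diff
    · exact hhed.differentiableOn
    · have h1 : DifferentiableOn ℂ (fun z => (z, -(h z / ε))) U :=
        (differentiable_id.prodMk hhed.neg).differentiableOn
      exact (differentiableOn_const _).mul (hqU.comp h1 (fun z hz => ⟨hz, mem_univ _⟩))
    · exact differentiableOn_pi.2 fun k => ((hyk k).const_mul _).differentiableOn
  let Ψ : EuclideanSpace ℂ (Fin N) → EuclideanSpace ℂ (Fin N) := fun z => Φ z + Gm z
  let Ψ1 : EuclideanSpace ℂ (Fin N) → EuclideanSpace ℂ (Fin N) := fun z =>
    mkv i i' (Φ z i + h z / ε) (M * (starRingEnd ℂ) (y z i' - a)) (fun k => M * y z k)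
  let Ψ2 : EuclideanSpace ℂ (Fin N) → EuclideanSpace ℂ (Fin N) := fun z =>
    mkv i i' ((s a * y z i - t) / ε) (M * (starRingEnd ℂ) (y z i' - a)) (fun k => M * y z k)
  have hΨc : ContinuousOn Ψ (closure D) := hΦ.continuousOn.add (hGd.continuousOn.mono hDU)
  have hpc : Continuous (fun z => fun k => (M : ℂ) * y z k) := continuous_pi fun k => continuous_const.mul (hykc k)
  have hΦi : Continuous (fun z => Φ z i) := by fun_prop
  have hcj : Continuous (fun z => (M : ℂ) * (starRingEnd ℂ) (y z i' - a)) :=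
    continuous_const.mul (Complex.continuous_conj.comp ((hykc i').sub continuous_const))
  have hΨ1c : ContinuousOn Ψ1 (closure D) :=
    mkv_cont i i' (hΦi.add (hhc.div_const _)).continuousOn hcj.continuousOn hpc.continuousOn
  have hΨ2c : ContinuousOn Ψ2 (closure D) :=
    mkv_cont i i' (((continuous_const.mul (hykc i)).sub continuous_const).div_const _).continuousOn hcj.continuousOn hpc.continuousOn
  have hhε : ∀ z ∈ frontier D, ∀ u : ℂ, ‖u‖ ≤ 1 → u * Φ z i + h z / ε = 0 → ‖h z‖ ≤ τ := by
    intro z hz u hu h0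
    have h1 : h z = -(ε * (u * Φ z i)) := by
      field_simp at h0
      linear_combination h0
    rw [h1, norm_neg, norm_mul, norm_mul, Complex.norm_real, Real.norm_of_nonneg hε.le]
    have h2 := hR z hz i
    have h3 : ‖u‖ * ‖Φ z i‖ ≤ 1 * R := mul_le_mul hu h2 (norm_nonneg _) zero_le_one
    calc ε * (‖u‖ * ‖Φ z i‖) ≤ ε * (1 * R) := by gcongr
      _ = τ := by rw [hεdef]; field_simp
  have key1 : ∀ z ∈ frontier D, ∀ r ∈ Icc (0:ℝ) 1, (1 - r) • Ψ z + r • Ψ1 z ≠ 0 := by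
    intro z hz r hr h0
    have hc : ∀ k, ((1 - r : ℝ) : ℂ) * Ψ z k + (r : ℂ) * Ψ1 z k = 0 := by
      intro k
      have := congrArg (fun v : EuclideanSpace ℂ (Fin N) => v k) h0
      simpa using this
    have c1 := hc i
    have c2 := hc i'
    simp only [Ψ, Gm, Ψ1, PiLp.add_apply, mkv_i, mkv_i' hii] at c1 c2
    have e1 : Φ z i + h z / ε = 0 := by
      push_cast at c1
      linear_combination c1
    have hh := hhε z hz 1 (by simp) (by rw [one_mul]; exact e1)
    have e2 : -(h z / ε) = Φ z i := by linear_combination -e1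
    rw [e2] at c2
    have hes := hest z hz hh (fun k hk hk' => by
      have c3 := hc k
      simp only [Ψ, Gm, Ψ1, PiLp.add_apply, mkv_k hk hk'] at c3
      have : y z k = -(((1 - r : ℝ) : ℂ) * Φ z k / M) := by
        field_simp
        push_cast at c3 ⊢
        linear_combination c3
      rw [this, norm_neg, norm_div, norm_mul, Complex.norm_real, Complex.norm_real, Real.norm_of_nonneg hM.le,
        Real.norm_of_nonneg (by linarith [hr.2])]
      refine le_trans ?_ hM1
      gcongr
      have := hR z hz k
      have := norm_nonneg (Φ z k)
      nlinarith [hr.1, hr.2])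
    set x := y z i' - a with hx
    set Q := q (z, Φ z i)
    have hmul := congrArg (fun c => (c * x).re) c2
    simp only [zero_mul, Complex.zero_re] at hmul
    have e3 : (((1 - r : ℝ) : ℂ) * (Φ z i' + M * Q) + r * (M * (starRingEnd ℂ) x)) * x
        = ((1 - r : ℝ) : ℂ) * (Φ z i' * x) + ((1 - r : ℝ) * M : ℝ) * (x * Q - 1) + ((1 - r : ℝ) * M : ℝ)
          + ((r * M * Complex.normSq x : ℝ) : ℂ) := by
      have := Complex.mul_conj x
      push_cast
      linear_combination ((r : ℂ) * M) * this
    rw [e3] at hmul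
    simp only [Complex.add_re, Complex.re_ofReal_mul, Complex.ofReal_re] at hmul
    have b1 : |(Φ z i' * x).re| ≤ R * S := (Complex.abs_re_le_norm _).trans (by
      rw [norm_mul]; exact mul_le_mul (hR z hz i') (hS z hz) (norm_nonneg _) (by linarith))
    have b2 : |(x * Q - 1).re| < 1 / 2 := (Complex.abs_re_le_norm _).trans_lt hes
    have b3 : 0 < Complex.normSq x := by
      rw [Complex.normSq_pos]
      intro hx0
      rw [hx0] at hes
      norm_num at hes
    have b4 := (abs_le.1 b1).1
    have b5 := (abs_lt.1 b2).1
    have b6 : 0 ≤ 1 - r := by linarith [hr.2]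
    have b7 : 0 < (Φ z i' * x).re + M * (x * Q - 1).re + M := by nlinarith
    have b8 : (1 - r) * ((Φ z i' * x).re + M * (x * Q - 1).re + M) + r * (M * Complex.normSq x) = 0 := by
      linarith
    have b9 : 0 < M * Complex.normSq x := by positivity
    rcases hr.1.eq_or_lt with h | h
    · rw [← h] at b8
      linarith
    · nlinarith [mul_pos h b9, mul_nonneg b6 b7.le]
  have key2 : ∀ z ∈ frontier D, ∀ r ∈ Icc (0:ℝ) 1, (1 - r) • Ψ1 z + r • Ψ2 z ≠ 0 := by
    intro z hz r hr h0
    have hc : ∀ k, ((1 - r : ℝ) : ℂ) * Ψ1 z k + (r : ℂ) * Ψ2 z k = 0 := by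
      intro k
      have := congrArg (fun v : EuclideanSpace ℂ (Fin N) => v k) h0
      simpa using this
    have c1 := hc i
    have c2 := hc i'
    simp only [Ψ1, Ψ2, mkv_i, mkv_i' hii] at c1 c2
    have e1 : y z i' - a = 0 := by
      have : (M : ℂ) * (starRingEnd ℂ) (y z i' - a) = 0 := by
        push_cast at c2
        linear_combination c2
      have h2 := (mul_eq_zero.1 this).resolve_left hMC
      exact (map_eq_zero (starRingEnd ℂ)).1 h2
    have e2 : y z i' = a := sub_eq_zero.1 e1
    have e3 : h z = s a * y z i - t := by simp only [h, e2]
    rw [← e3] at c1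
    have hh := hhε z hz ((1 - r : ℝ) : ℂ) (by
      rw [Complex.norm_real, Real.norm_of_nonneg (by linarith [hr.2])]; linarith [hr.1]) (by
      push_cast at c1 ⊢
      linear_combination c1)
    have hes := hest z hz hh (fun k hk hk' => by
      have c3 := hc k
      simp only [Ψ1, Ψ2, mkv_k hk hk'] at c3
      have : (M : ℂ) * y z k = 0 := by
        push_cast at c3
        linear_combination c3
      have : y z k = 0 := by simpa [hMC] using this
      rw [this, norm_zero]; exact hτ.le)
    rw [e1] at hes
    norm_num at hes
  have d0 := hdeg U Gm hU hDU hGd (fun z hz h0 => key1 z hz 0 (by simp) (by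
    have : Ψ z = 0 := h0
    simp [this])) Ψ hΨc (fun z _ => rfl)
  have d1 := 𝒟.deg_segment Ψ Ψ1 D hDo hDb hΨc hΨ1c key1
  have d2 := 𝒟.deg_segment Ψ1 Ψ2 D hDo hDb hΨ1c hΨ2c key2
  -- linear map
  let A0 : EuclideanSpace ℂ (Fin N) →ₗ[ℂ] EuclideanSpace ℂ (Fin N) :=
    { toFun := fun v => mkv i i' (s a / ε * T v i) (M * T v i') (fun k => M * T v k)
      map_add' := by
        intro u v
        ext k
        simp only [mkv, map_add, PiLp.add_apply]
        split_ifs <;> ring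
      map_smul' := by
        intro c v
        ext k
        simp only [mkv, map_smul, PiLp.smul_apply, smul_eq_mul, RingHom.id_apply]
        split_ifs <;> ring }
  have hA0 : Function.Injective A0 := by
    rw [← LinearMap.ker_eq_bot, LinearMap.ker_eq_bot']
    intro v hv
    have hc : ∀ k, mkv i i' (s a / ε * T v i) (M * T v i') (fun k => M * T v k) k = 0 := by
      intro k
      exact congrArg (fun v : EuclideanSpace ℂ (Fin N) => v k) hv
    have : T v = 0 := by
      ext k
      have h1 := hc k
      by_cases hki : k = i
      · subst hki
        rw [mkv_i] at h1
        have : s a / ε ≠ 0 := div_ne_zero ha hεC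
        simpa [this] using h1
      by_cases hki' : k = i'
      · subst hki'
        rw [mkv_i' hii] at h1
        simpa [hMC] using h1
      · rw [mkv_k hki hki'] at h1
        simpa [hMC] using h1
    simpa using this
  let ℓ : EuclideanSpace ℂ (Fin N) →L[ℝ] ℝ :=
    Complex.imCLM.comp ((EuclideanSpace.proj (𝕜 := ℂ) i' : EuclideanSpace ℂ (Fin N) →L[ℂ] ℂ).restrictScalars ℝ)
  let e : EuclideanSpace ℂ (Fin N) := EuclideanSpace.single i' Complex.I
  have hℓe : ℓ e = 1 := by simp [ℓ, e]
  have d3 := 𝒟.deg_comp_complex (BrouwerDegreeTheory.refl' ℓ e) (BrouwerDegreeTheory.refl'_inj ℓ e hℓe)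
    (LinearMap.toContinuousLinearMap A0) hA0 D hDo hDb _ haD
  rw [𝒟.deg_refl ℓ e hℓe D hDo hDb _ haD] at d3
  have d4 : (fun z => BrouwerDegreeTheory.refl' ℓ e ((LinearMap.toContinuousLinearMap A0) (z - pφ T p0 s t i i' a))) = Ψ2 := by
    funext z
    have hT : T (z - pφ T p0 s t i i' a) = y z - (a • EuclideanSpace.single i' 1 + (t / s a) • EuclideanSpace.single i 1) := by
      simp only [pφ, y, map_sub, map_add, ContinuousLinearEquiv.apply_symm_apply]
      abel
    rw [BrouwerDegreeTheory.refl'_apply]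
    have hAz : (LinearMap.toContinuousLinearMap A0) (z - pφ T p0 s t i i' a) =
      mkv i i' ((s a * y z i - t) / ε) (M * (y z i' - a)) (fun k => M * T (z - pφ T p0 s t i i' a) k) := by
      show mkv _ _ _ _ _ = _
      congr 1
      · rw [hT]
        simp [hii.symm]
        field_simp
      · rw [hT]
        simp [hii]
    rw [hAz]
    have hl : ∀ u v w, ℓ (mkv i i' u v w) = v.im := by
      intro u v w
      show (mkv _ _ _ _ _ i').im = _
      rw [mkv_i' hii]
    ext k
    by_cases hki : k = i
    · subst hki
      simp only [PiLp.sub_apply, PiLp.smul_apply, mkv_i, Ψ2, e, EuclideanSpace.single_apply, if_neg hii.symm,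
        smul_zero, sub_zero]
    by_cases hki' : k = i'
    · rw [hki']
      simp only [PiLp.sub_apply, PiLp.smul_apply, mkv_i' hii, Ψ2, e, EuclideanSpace.single_apply, if_true, hl]
      apply Complex.ext <;> simp
      ring
    · simp only [PiLp.sub_apply, PiLp.smul_apply, mkv_k hki hki', Ψ2, e, EuclideanSpace.single_apply, if_neg hki',
        smul_zero, sub_zero, hT]
      simp [hki, hki']
  rw [d4] at d3
  rw [d1, d2, d3] at d0
  norm_num at d0

end Slice
end

open Set Metric Bornology MvPolynomial
noncomputable section

namespace Slice
open Filter Topology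

section
variable {E : Type*} [NormedAddCommGroup E] [NormedSpace ℂ E]

/-- `u` points out of `D` at `z`, locally uniformly -/
def OutDir (D : Set E) (z u : E) : Prop :=
  ∃ δ : ℝ, 0 < δ ∧ ∀ z' ∈ frontier D, dist z' z < δ → ∀ s : ℝ, 0 < s → s < δ → ∀ u', dist u' u < δ →
    z' + (s : ℂ) • u' ∉ closure D

theorem OutDir.eventually {D : Set E} {z u : E} (h : OutDir D z u) :
    ∀ᶠ p in 𝓝 ((z, u) : E × E), OutDir D p.1 p.2 := by
  obtain ⟨δ, hδ, h⟩ := h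
  filter_upwards [ball_mem_nhds (z, u) (half_pos hδ)] with p hp
  rw [mem_ball, Prod.dist_eq, max_lt_iff] at hp
  refine ⟨δ / 2, half_pos hδ, fun z' hz' h1 s hs hs' u' h2 => h z' hz' ?_ s hs (by linarith) u' ?_⟩
  · linarith [dist_triangle z' p.1 z]
  · linarith [dist_triangle u' p.2 u]

theorem out1 {D : Set E} {G : Set ℂ} {φ : ℂ → E} (hG : IsOpen G) (hφ : DifferentiableOn ℂ φ G) [CompleteSpace E]
    {x0 : ℂ} (hx0 : x0 ∈ G) {e : ℂ} (h : OutDir D (φ x0) (e • deriv φ x0)) :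
    ∃ δ : ℝ, 0 < δ ∧ ∀ x, dist x x0 < δ → φ x ∈ frontier D → ∀ s : ℝ, 0 < s → s < δ → ∀ e', dist e' e < δ →
      x + s * e' ∈ G ∧ φ (x + s * e') ∉ closure D := by
  obtain ⟨δ, hδ, h⟩ := h
  have hsd : HasStrictDerivAt φ (deriv φ x0) x0 := by
    have : AnalyticAt ℂ φ x0 := (hφ.analyticOnNhd hG) x0 hx0
    exact this.hasStrictDerivAt
  set v := deriv φ x0 with hv
  set ε := δ / (4 * (‖e‖ + 1)) with hε
  have hε0 : 0 < ε := by positivity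
  have h1 := (hasStrictDerivAt_iff_hasStrictFDerivAt.1 hsd).isLittleO.def hε0
  obtain ⟨δ1, hδ1, h1⟩ := Metric.eventually_nhds_iff.1 h1
  obtain ⟨δ2, hδ2, h2⟩ := Metric.isOpen_iff.1 hG x0 hx0
  obtain ⟨δ3, hδ3, h3⟩ := Metric.continuousAt_iff.1 ((hφ.continuousOn).continuousAt (hG.mem_nhds hx0)) δ hδ
  set m := min (min δ1 δ2) (min δ3 δ) with hm
  have hm0 : 0 < m := by positivity
  have hm1 : m ≤ δ1 := (min_le_left _ _).trans (min_le_left _ _)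
  have hm2 : m ≤ δ2 := (min_le_left _ _).trans (min_le_right _ _)
  have hm3 : m ≤ δ3 := (min_le_right _ _).trans (min_le_left _ _)
  have hm4 : m ≤ δ := (min_le_right _ _).trans (min_le_right _ _)
  set r := min (min (m / (2 * (‖e‖ + 1))) (m / 2)) (min 1 (δ / (4 * (‖v‖ + 1)))) with hr
  have hr0 : 0 < r := by positivity
  have hr1 : r ≤ m / (2 * (‖e‖ + 1)) := (min_le_left _ _).trans (min_le_left _ _)
  have hr2 : r ≤ m / 2 := (min_le_left _ _).trans (min_le_right _ _)
  have hr3 : r ≤ 1 := (min_le_right _ _).trans (min_le_left _ _)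
  have hr4 : r ≤ δ / (4 * (‖v‖ + 1)) := (min_le_right _ _).trans (min_le_right _ _)
  refine ⟨r, hr0, fun x hx hxF s hs hsr e' he' => ?_⟩
  have he2 : ‖e'‖ ≤ ‖e‖ + 1 := by
    have := norm_sub_norm_le e' e
    rw [dist_eq_norm] at he'
    linarith
  have hse : ‖(s : ℂ) * e'‖ < m / 2 := by
    rw [norm_mul, Complex.norm_real, Real.norm_of_nonneg hs.le]
    calc s * ‖e'‖ ≤ s * (‖e‖ + 1) := by gcongr
      _ < (m / (2 * (‖e‖ + 1))) * (‖e‖ + 1) := by gcongr; linarith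
      _ = m / 2 := by field_simp
  have hxs : dist (x + s * e') x0 < m := by
    rw [dist_eq_norm] at hx ⊢
    calc ‖x + s * e' - x0‖ = ‖(x - x0) + s * e'‖ := by congr 1; ring
      _ ≤ ‖x - x0‖ + ‖s * e'‖ := norm_add_le _ _
      _ < m := by linarith
  refine ⟨h2 (by rw [mem_ball]; linarith), ?_⟩
  have h4 := h1 (y := (x + s * e', x)) (by
    rw [Prod.dist_eq, max_lt_iff]; exact ⟨by simp only; linarith, by simp only; linarith⟩)
  have hs0 : (s : ℂ) ≠ 0 := by exact_mod_cast hs.ne'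
  have h5 := h (φ x) hxF (h3 (by linarith)) s hs (by linarith) ((s : ℂ)⁻¹ • (φ (x + s * e') - φ x)) ?_
  · rwa [smul_smul, mul_inv_cancel₀ hs0, one_smul, add_sub_cancel] at h5
  · rw [dist_eq_norm]
    have h6 : (s : ℂ)⁻¹ • (φ (x + s * e') - φ x) - e • v =
        (s : ℂ)⁻¹ • (φ (x + s * e') - φ x - (s * e') • v) + (e' - e) • v := by
      rw [smul_sub ((s : ℂ)⁻¹) (φ (x + s * e') - φ x), smul_smul, ← mul_assoc, inv_mul_cancel₀ hs0, one_mul,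
        sub_smul]; abel
    have h7 : ‖φ (x + s * e') - φ x - (s * e') • v‖ ≤ ε * (s * ‖e'‖) := by
      have : ‖φ (x + s * e') - φ x - (s * e') • v‖ ≤ ε * ‖(s : ℂ) * e'‖ := by simpa using h4
      rwa [norm_mul, Complex.norm_real, Real.norm_of_nonneg hs.le] at this
    rw [h6]
    refine (norm_add_le _ _).trans_lt ?_
    rw [norm_smul, norm_smul, norm_inv, Complex.norm_real, Real.norm_of_nonneg hs.le]
    have h8 : s⁻¹ * ‖φ (x + s * e') - φ x - (s * e') • v‖ ≤ δ / 4 := by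
      calc s⁻¹ * ‖φ (x + s * e') - φ x - (s * e') • v‖ ≤ s⁻¹ * (ε * (s * (‖e‖ + 1))) := by
            gcongr; exact h7.trans (by gcongr)
        _ = δ / 4 := by rw [hε]; field_simp
    have h9 : ‖e' - e‖ * ‖v‖ ≤ δ / 4 := by
      rw [dist_eq_norm] at he'
      calc ‖e' - e‖ * ‖v‖ ≤ (δ / (4 * (‖v‖ + 1))) * (‖v‖ + 1) := by gcongr <;> linarith
        _ = δ / 4 := by field_simp
    linarith

theorem barLoc_of_outDir {D : Set E} {G : Set ℂ} {φ : ℂ → E} {ξ : E → ℂ} [CompleteSpace E] (hDo : IsOpen D)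
    (hs : IsSlice D G φ ξ)
    {x0 : ℂ} (hx0 : x0 ∈ SX D G φ) {e : ℂ} (h : OutDir D (φ x0) (e • deriv φ x0)) :
    BarLoc D G φ (SX D G φ) x0 := by
  obtain ⟨δ, hδ, h⟩ := out1 hs.G_open hs.φ_diff hx0.1 h
  refine ⟨δ / (4 * (‖e‖ + 1)), by positivity, fun τ hτ => ?_⟩
  set r := min (δ / 4) (min (δ * δ / 4) (τ * δ / (4 * (‖e‖ + 1)))) with hr
  have hr0 : 0 < r := by positivity
  filter_upwards [ball_mem_nhds x0 hr0] with w hw hwG hwD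
  obtain ⟨x1, hx1, hd⟩ := hs.X_compact.exists_infDist_eq_dist ⟨x0, hx0⟩ w
  have hmin : ∀ x ∈ SX D G φ, dist w x1 ≤ dist w x := fun x hx => hd ▸ infDist_le_dist_of_mem hx
  have hd1 : dist w x1 < r := (hmin x0 hx0).trans_lt hw
  have hne : w ≠ x1 := by
    rintro rfl
    have := hx1.2
    rw [mem_preimage, hDo.frontier_eq] at this
    exact this.2 hwD
  set d := dist w x1 with hdd
  have hd0 : 0 < d := dist_pos.2 hne
  set s := 2 * d / δ with hsd
  have hs0 : 0 < s := by positivity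
  have hsc : (s : ℂ) ≠ 0 := by exact_mod_cast hs0.ne'
  have hsδ : s < δ := by
    rw [hsd, div_lt_iff₀ hδ]
    have : r ≤ δ * δ / 4 := (min_le_right _ _).trans (min_le_left _ _)
    nlinarith
  have hsd' : d = s * (δ / 2) := by rw [hsd]; field_simp
  have hx1x0 : dist x1 x0 < δ := by
    have : r ≤ δ / 4 := min_le_left _ _
    rw [mem_ball] at hw
    have h2 := dist_triangle x1 w x0
    rw [dist_comm x1 w] at h2
    linarith
  -- points near c
  have hout : ∀ y, ‖y - (w + s * e)‖ < s * (δ / 4) → y ∈ G ∧ φ y ∉ closure D := by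
    intro y hy
    have := h x1 hx1x0 hx1.2 s hs0 hsδ ((s : ℂ)⁻¹ * (y - x1)) ?_
    · rwa [← mul_assoc, mul_inv_cancel₀ hsc, one_mul, add_sub_cancel] at this
    · rw [dist_eq_norm]
      have h6 : (s : ℂ)⁻¹ * (y - x1) - e = (s : ℂ)⁻¹ * ((y - (w + s * e)) + (w - x1)) := by
        field_simp; ring
      rw [h6, norm_mul, norm_inv, Complex.norm_real, Real.norm_of_nonneg hs0.le, inv_mul_lt_iff₀ hs0]
      have h7 := norm_add_le (y - (w + s * e)) (w - x1)
      rw [← dist_eq_norm w x1, ← hdd] at h7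
      nlinarith
  have hc := hout (w + s * e) (by simp; positivity)
  have hwc : ‖w - (w + s * e)‖ = s * ‖e‖ := by
    rw [sub_add_cancel_left, norm_neg, norm_mul, Complex.norm_real, Real.norm_of_nonneg hs0.le]
  refine ⟨w + s * e, hc.1, hc.2, ?_, fun x hx => ?_⟩
  · rw [hwc]
    have h3 : r ≤ τ * δ / (4 * (‖e‖ + 1)) := (min_le_right _ _).trans (min_le_right _ _)
    have : s ≤ τ / (‖e‖ + 1) := by
      rw [hsd, div_le_div_iff₀ hδ (by positivity)]
      rw [le_div_iff₀ (by positivity)] at h3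
      have : 0 < ‖e‖ + 1 := by positivity
      nlinarith
    calc s * ‖e‖ ≤ (τ / (‖e‖ + 1)) * (‖e‖ + 1) := by gcongr; linarith
      _ = τ := by field_simp
  · rw [hwc]
    by_contra hcon
    push Not at hcon
    refine (hout x (hcon.trans_le ?_)).2 (frontier_subset_closure hx.2)
    rw [div_mul_eq_mul_div, div_le_iff₀ (by positivity)]
    have : 0 < s * δ := by positivity
    nlinarith [norm_nonneg e]

end

end Slice
end

open Set Metric Bornology MvPolynomial
noncomputable section

namespace Slice
open Filter Topology

theorem exists_T {N : ℕ} {i i' : Fin N} (hii : i' ≠ i) {v v' : EuclideanSpace ℂ (Fin N)}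
    (hv : LinearIndependent ℂ ![v, v']) :
    ∃ T : EuclideanSpace ℂ (Fin N) ≃L[ℂ] EuclideanSpace ℂ (Fin N),
      T.symm (EuclideanSpace.single i' 1) = v ∧ T.symm (EuclideanSpace.single i 1) = v' := by
  classical
  let b := Module.Basis.sumExtend hv
  have hfin : Finite (Fin 2 ⊕ Module.Basis.sumExtendIndex hv) :=
    Module.Finite.finite_basis b
  letI : Fintype (Fin 2 ⊕ Module.Basis.sumExtendIndex hv) := Fintype.ofFinite _
  have hcard : Fintype.card (Fin 2 ⊕ Module.Basis.sumExtendIndex hv) = Fintype.card (Fin N) := by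
    rw [← Module.finrank_eq_card_basis b]; simp
  let e0 : (Fin 2 ⊕ Module.Basis.sumExtendIndex hv) ≃ Fin N := Fintype.equivOfCardEq hcard
  let e1 := e0.trans (Equiv.swap (e0 (Sum.inl 0)) i')
  have he1 : e1 (Sum.inl 0) = i' := by simp [e1]
  let e := e1.trans (Equiv.swap (e1 (Sum.inl 1)) i)
  have he : e (Sum.inl 1) = i := by simp [e]
  have he' : e (Sum.inl 0) = i' := by
    have h1 : i' ≠ e1 (Sum.inl 1) := by
      rw [← he1]; intro h; simpa using e1.injective h
    simp only [e, Equiv.trans_apply, he1]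
    exact Equiv.swap_apply_of_ne_of_ne h1 hii
  have hb : ∀ k, b (Sum.inl k) = ![v, v'] k := by
    intro k
    change (Module.Basis.sumExtend hv) (Sum.inl k) = _
    unfold Module.Basis.sumExtend
    rw [Module.Basis.reindex_apply, Module.Basis.extend_apply_self]
    rfl
  let B := (EuclideanSpace.basisFun (Fin N) ℂ).toBasis
  let T := (b.equiv B e).toContinuousLinearEquiv
  refine ⟨T, ?_, ?_⟩
  · rw [ContinuousLinearEquiv.symm_apply_eq]
    have h1 : b (Sum.inl 0) = v := hb 0
    have : T (b (Sum.inl 0)) = B (e (Sum.inl 0)) := Module.Basis.equiv_apply _ _ _ _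
    rw [← h1, this, he']; simp [B]
  · rw [ContinuousLinearEquiv.symm_apply_eq]
    have h1 : b (Sum.inl 1) = v' := hb 1
    have : T (b (Sum.inl 1)) = B (e (Sum.inl 1)) := Module.Basis.equiv_apply _ _ _ _
    rw [← h1, this, he]; simp [B]

/-- slice parametrization -/
def cφ {E : Type*} [NormedAddCommGroup E] [NormedSpace ℂ E] (a v v' : E) (s : ℂ → ℂ) (t : ℂ) (w : ℂ) : E :=
  a + w • v + (t / s w) • v'

structure Setup {N : ℕ} (D : Set (EuclideanSpace ℂ (Fin N))) (f : EuclideanSpace ℂ (Fin N) → ℂ) : Prop where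
  hDo : IsOpen D
  hDb : IsBounded D
  hst : HasSteinNeighbourhoodBasis (closure D)
  hf : Continuous f
  hA : ∃ i i' : Fin N, i' ≠ i ∧ ∀ (T : EuclideanSpace ℂ (Fin N) ≃L[ℂ] EuclideanSpace ℂ (Fin N))
    (p0 : EuclideanSpace ℂ (Fin N)) (s : ℂ → ℂ), Differentiable ℂ s → ∀ t : ℂ, (∀ w, s w = 0 → t ≠ 0) →
    ∀ a : ℂ, s a ≠ 0 → pφ T p0 s t i i' a ∈ D → ∀ q ∈ QA D, ∃ x, s x ≠ 0 ∧ pφ T p0 s t i i' x ∈ frontier D ∧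
      1 / 2 ≤ ‖(x - a) * q (pφ T p0 s t i i' x, f (pφ T p0 s t i i' x)) - 1‖

variable {N : ℕ} {D : Set (EuclideanSpace ℂ (Fin N))} {f : EuclideanSpace ℂ (Fin N) → ℂ}

theorem Setup.hDc (S : Setup D f) : IsCompact (closure D) := S.hDb.isCompact_closure
theorem Setup.hFc (S : Setup D f) : IsCompact (frontier D) :=
  S.hDc.of_isClosed_subset isClosed_frontier frontier_subset_closure

theorem Setup.slice0 (S : Setup D f) {a v v' : EuclideanSpace ℂ (Fin N)}
    (hv : LinearIndependent ℂ ![v, v']) {s : ℂ → ℂ} (hs : Differentiable ℂ s) {t : ℂ} (hst : ∀ w, s w = 0 → t ≠ 0) :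
    (∃ ξ : EuclideanSpace ℂ (Fin N) → ℂ, Differentiable ℂ ξ ∧ ∀ w, ξ (cφ a v v' s t w) = w) ∧
    ∀ b : ℂ, s b ≠ 0 → cφ a v v' s t b ∈ D → ∀ q ∈ QA D, ∃ x, s x ≠ 0 ∧ cφ a v v' s t x ∈ frontier D ∧
      1 / 2 ≤ ‖(x - b) * q (cφ a v v' s t x, f (cφ a v v' s t x)) - 1‖ := by
  obtain ⟨i, i', hii, h⟩ := S.hA
  obtain ⟨T, hT1, hT2⟩ := exists_T hii hv
  have hp : ∀ w, pφ T a s t i i' w = cφ a v v' s t w := by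
    intro w
    simp only [pφ, cφ, map_add, map_smul, hT1, hT2, add_assoc]
  refine ⟨⟨fun z => T (z - a) i', ?_, ?_⟩, ?_⟩
  · exact differentiable_euclidean.1 (T.differentiable.comp (differentiable_id.sub_const a)) i'
  · intro w
    rw [← hp]
    simp [pφ, hii]
  · intro b hb hbD q hq
    have := h T a s hs t hst b hb (by rwa [hp]) q hq
    simpa only [hp] using this

theorem Setup.slice1 (S : Setup D f) {a v v' : EuclideanSpace ℂ (Fin N)}
    (hv : LinearIndependent ℂ ![v, v']) {s : ℂ → ℂ} (hs : Differentiable ℂ s) {t : ℂ} (hst : ∀ w, s w = 0 → t ≠ 0)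
    (hconn : IsPreconnected {w | s w ≠ 0}) (hun : ∀ R : ℝ, ∃ w ∈ {w | s w ≠ 0}, R < ‖w‖)
    (hK : IsCompact ({w | s w ≠ 0} ∩ cφ a v v' s t ⁻¹' closure D)) :
    ∃ ξ, IsSlice D {w | s w ≠ 0} (cφ a v v' s t) ξ := by
  obtain ⟨⟨ξ, hξ, hξ'⟩, -⟩ := S.slice0 (a := a) hv hs hst
  refine ⟨ξ, isOpen_ne_fun hs.continuous continuous_const, hconn, hun, ?_, hξ, fun w _ => hξ' w, hK⟩
  intro w hw
  have : DifferentiableAt ℂ (cφ a v v' s t) w := by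
    unfold cφ
    exact ((differentiableAt_const _).add (differentiableAt_id.smul_const v)).add
      (((differentiableAt_const t).div (hs w) hw).smul_const v')
  exact this.differentiableWithinAt

theorem Setup.slice (S : Setup D f) {a v v' : EuclideanSpace ℂ (Fin N)}
    (hv : LinearIndependent ℂ ![v, v']) {s : ℂ → ℂ} (hs : Differentiable ℂ s) {t : ℂ} (hst : ∀ w, s w = 0 → t ≠ 0)
    (hconn : IsPreconnected {w | s w ≠ 0}) (hun : ∀ R : ℝ, ∃ w ∈ {w | s w ≠ 0}, R < ‖w‖)
    (hK : IsCompact ({w | s w ≠ 0} ∩ cφ a v v' s t ⁻¹' closure D))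
    (hB : ∀ x, s x ≠ 0 → cφ a v v' s t x ∈ frontier D →
      ∃ e : ℂ, OutDir D (cφ a v v' s t x) (e • deriv (cφ a v v' s t) x)) :
    ∃ F : ℂ → ℂ, DifferentiableOn ℂ F ({w | s w ≠ 0} ∩ cφ a v v' s t ⁻¹' D) ∧
      ∀ w, s w ≠ 0 → cφ a v v' s t w ∈ D →
        SS D f (cφ a v v' s t '' SX D {w | s w ≠ 0} (cφ a v v' s t)) (cφ a v v' s t w) = {F w} := by
  obtain ⟨ξ, hsl⟩ := S.slice1 (a := a) hv hs hst hconn hun hK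
  haveI : CompactSpace (SX D {w | s w ≠ 0} (cφ a v v' s t)) := isCompact_iff_compactSpace.1 hsl.X_compact
  refine slice_holo hsl rfl S.hDo S.hDc S.hst S.hf.continuousOn ?_ ?_
  · intro b hb hbD q hq
    obtain ⟨x, h1, h2, h3⟩ := (S.slice0 (a := a) hv hs hst).2 b hb hbD q hq
    exact ⟨x, ⟨h1, h2⟩, h3⟩
  · intro x hx
    obtain ⟨e, he⟩ := hB x hx.1 hx.2
    exact barLoc_of_outDir S.hDo hsl hx he

end Slice
end

open Set Metric Bornology MvPolynomial
noncomputable section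

namespace Slice
open Filter Topology

section
variable {E : Type*} [NormedAddCommGroup E] [NormedSpace ℂ E]

/-- the line through `a` with direction `v` is transversal to the boundary -/
def Good (D : Set E) (a v : E) : Prop :=
  ∀ ζ : ℂ, a + ζ • v ∈ frontier D → ∃ θ : ℂ, OutDir D (a + ζ • v) (θ • v)

/-- boundary points on the line -/
def LX (D : Set E) (a v : E) : Set E := {z | z ∈ frontier D ∧ ∃ ζ : ℂ, z = a + ζ • v}

/-- boundary points on the conic -/
def CX (D : Set E) (a v v' : E) (t : ℂ) : Set E :=
  {z | z ∈ frontier D ∧ ∃ ζ : ℂ, ζ ≠ 0 ∧ z = a + ζ • v + (t / ζ) • v'}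

theorem LX_sub (D : Set E) (a v : E) : LX D a v ⊆ frontier D := fun _ h => h.1
theorem CX_sub (D : Set E) (a v v' : E) (t : ℂ) : CX D a v v' t ⊆ frontier D := fun _ h => h.1

theorem LX_shift (D : Set E) (a v : E) (w : ℂ) : LX D (a + w • v) v = LX D a v := by
  ext z
  constructor
  · rintro ⟨h, ζ, rfl⟩; exact ⟨h, w + ζ, by rw [add_smul, add_assoc]⟩
  · rintro ⟨h, ζ, rfl⟩; exact ⟨h, ζ - w, by rw [sub_smul]; abel⟩

theorem Good.shift {D : Set E} {a v : E} (h : Good D a v) (w : ℂ) : Good D (a + w • v) v := by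
  intro ζ hζ
  have : a + w • v + ζ • v = a + (w + ζ) • v := by rw [add_smul, add_assoc]
  rw [this] at hζ ⊢
  exact h _ hζ

theorem LX_scale (D : Set E) (a v : E) {c : ℂ} (hc : c ≠ 0) : LX D a (c • v) = LX D a v := by
  ext z
  constructor
  · rintro ⟨h, ζ, rfl⟩; exact ⟨h, ζ * c, by rw [smul_smul]⟩
  · rintro ⟨h, ζ, rfl⟩; exact ⟨h, ζ / c, by rw [smul_smul, div_mul_cancel₀ _ hc]⟩

theorem compact_ev {Y : Type*} [TopologicalSpace Y] {C : Set Y} (hC : IsCompact C) {g : Y → ℝ} (hg : Continuous g)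
    (hg0 : ∀ y, 0 ≤ g y) {P : Y → Prop} (h : ∀ p ∈ C, g p = 0 → ∀ᶠ q in 𝓝 p, P q) :
    ∃ τ : ℝ, 0 < τ ∧ ∀ q ∈ C, g q < τ → P q := by
  have hK : IsCompact (C \ interior {q | P q}) := hC.diff isOpen_interior
  rcases (C \ interior {q | P q}).eq_empty_or_nonempty with he | hne
  · refine ⟨1, one_pos, fun q hq _ => ?_⟩
    exact interior_subset (sdiff_eq_empty.1 he hq)
  · obtain ⟨x, hx, hmin⟩ := hK.exists_isMinOn hne hg.continuousOn
    have hpos : 0 < g x := by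
      rcases (hg0 x).lt_or_eq with h1 | h1
      · exact h1
      · exact absurd (mem_interior_iff_mem_nhds.2 (h x hx.1 h1.symm)) hx.2
    refine ⟨g x, hpos, fun q hq hlt => ?_⟩
    by_contra hP
    have : q ∈ C \ interior {q | P q} := ⟨hq, fun h => hP (interior_subset h)⟩
    exact absurd (hmin this) (by simpa using hlt)

theorem pair_inj {v v' : E} (hv : LinearIndependent ℂ ![v, v']) :
    Topology.IsClosedEmbedding (fun p : ℂ × ℂ => p.1 • v + p.2 • v') := by
  let L : ℂ × ℂ →ₗ[ℂ] E := (LinearMap.toSpanSingleton ℂ E v).coprod (LinearMap.toSpanSingleton ℂ E v')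
  have h : LinearMap.ker L = ⊥ := by
    rw [LinearMap.ker_eq_bot']
    rintro ⟨x, y⟩ h
    have := LinearIndependent.pair_iff.1 hv x y (by simpa [L] using h)
    simp [this]
  have h2 := LinearMap.isClosedEmbedding_of_injective h
  have h3 : (L : ℂ × ℂ → E) = (fun p : ℂ × ℂ => p.1 • v + p.2 • v') := by
    ext p; simp [L]
  rwa [h3] at h2

theorem pair_compact {v v' : E} (hv : LinearIndependent ℂ ![v, v']) (a : E) {K : Set E} (hK : IsCompact K) :
    IsCompact {p : ℂ × ℂ | a + p.1 • v + p.2 • v' ∈ K} := by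
  have h : Topology.IsClosedEmbedding (fun p : ℂ × ℂ => a + (p.1 • v + p.2 • v')) :=
    (Homeomorph.addLeft a).isClosedEmbedding.comp (pair_inj hv)
  convert h.isCompact_preimage hK using 1
  ext p; simp [add_assoc]

theorem conic_near {D : Set E} (hDo : IsOpen D) {v v' a : E} (hv : LinearIndependent ℂ ![v, v'])
    (hF : IsCompact (frontier D)) (ha : a ∈ D)
    {P : ℂ × ℂ → Prop}
    (h1 : ∀ ζ : ℂ, ζ ≠ 0 → a + ζ • v ∈ frontier D → ∀ᶠ p in 𝓝 ((ζ, 0) : ℂ × ℂ), P p)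
    (h2 : ∀ ζ : ℂ, ζ ≠ 0 → a + ζ • v' ∈ frontier D → ∀ᶠ p in 𝓝 ((0, ζ) : ℂ × ℂ), P p) :
    ∃ τ : ℝ, 0 < τ ∧ ∀ t : ℂ, ‖t‖ < τ → ∀ ζ : ℂ, ζ ≠ 0 → a + ζ • v + (t / ζ) • v' ∈ frontier D →
      P (ζ, t / ζ) := by
  have haF : a ∉ frontier D := by rw [hDo.frontier_eq]; exact fun h => h.2 ha
  obtain ⟨τ, hτ, h⟩ := compact_ev (pair_compact hv a hF) (g := fun p => ‖p.1 * p.2‖) (by fun_prop)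
    (fun _ => norm_nonneg _) (P := P) (by
      rintro ⟨ξ, η⟩ hp h0
      simp only [mem_ofPred_eq, norm_eq_zero, mul_eq_zero] at hp h0
      rcases h0 with rfl | rfl
      · have hη : η ≠ 0 := by rintro rfl; simp at hp; exact haF hp
        exact h2 η hη (by simpa using hp)
      · have hη : ξ ≠ 0 := by rintro rfl; simp at hp; exact haF hp
        exact h1 ξ hη (by simpa using hp))
  refine ⟨τ, hτ, fun t ht ζ hζ hz => h (ζ, t / ζ) hz ?_⟩
  simpa [mul_div_cancel₀ _ hζ] using ht

theorem cφ_deriv (a v v' : E) (t : ℂ) {ξ : ℂ} (hξ : ξ ≠ 0) :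
    deriv (cφ a v v' id t) ξ = v - (t / ξ ^ 2) • v' := by
  have h : HasDerivAt (cφ a v v' id t) ((1 : ℂ) • v + (((0 : ℂ) * ξ - t * 1) / ξ ^ 2) • v') ξ := by
    unfold cφ
    exact (((hasDerivAt_id ξ).smul_const v).const_add a).add
      (((hasDerivAt_const ξ t).div (hasDerivAt_id ξ) hξ).smul_const v')
  rw [h.deriv]
  simp [sub_eq_add_neg, neg_div]

theorem conic_good {D : Set E} (hDo : IsOpen D) {v v' a : E} (hv : LinearIndependent ℂ ![v, v'])
    (hF : IsCompact (frontier D)) (ha : a ∈ D) (hg : Good D a v) (hg' : Good D a v') :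
    ∃ τ : ℝ, 0 < τ ∧ ∀ t : ℂ, ‖t‖ < τ → ∀ ζ : ℂ, ζ ≠ 0 → cφ a v v' id t ζ ∈ frontier D →
      ∃ e : ℂ, OutDir D (cφ a v v' id t ζ) (e • deriv (cφ a v v' id t) ζ) := by
  refine Exists.imp ?_ (conic_near hDo hv hF ha
    (P := fun p => ∃ e : ℂ, OutDir D (a + p.1 • v + p.2 • v') (e • (p.1 • v - p.2 • v'))) ?_ ?_)
  · rintro τ ⟨hτ, h⟩
    refine ⟨hτ, fun t ht ζ hζ hz => ?_⟩
    obtain ⟨e, he⟩ := h t ht ζ hζ hz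
    refine ⟨e * ζ, ?_⟩
    rw [cφ_deriv _ _ _ _ hζ, mul_smul, smul_sub ζ, smul_smul]
    have : ζ * (t / ζ ^ 2) = t / ζ := by field_simp
    rw [this]
    exact he
  · intro ζ hζ hz
    obtain ⟨θ, hθ⟩ := hg ζ hz
    have hc : ContinuousAt (fun p : ℂ × ℂ => ((a + p.1 • v + p.2 • v', (θ / p.1) • (p.1 • v - p.2 • v')) : E × E))
        (ζ, 0) := by
      refine ContinuousAt.prodMk (by fun_prop) (ContinuousAt.smul ?_ (by fun_prop))
      exact continuousAt_const.div continuousAt_fst hζ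
    have he := hθ.eventually
    have h3 : ((a + ζ • v, θ • v) : E × E) = (a + ζ • v + (0 : ℂ) • v', (θ / ζ) • (ζ • v - (0 : ℂ) • v')) := by
      simp [smul_smul, div_mul_cancel₀ _ hζ]
    rw [h3] at he
    filter_upwards [hc.eventually he] with p hp
    exact ⟨_, hp⟩
  · intro ζ hζ hz
    obtain ⟨θ, hθ⟩ := hg' ζ hz
    have hc : ContinuousAt (fun p : ℂ × ℂ => ((a + p.1 • v + p.2 • v', (-θ / p.2) • (p.1 • v - p.2 • v')) : E × E))
        (0, ζ) := by
      refine ContinuousAt.prodMk (by fun_prop) (ContinuousAt.smul ?_ (by fun_prop))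
      exact continuousAt_const.div continuousAt_snd hζ
    have he := hθ.eventually
    have h3 : ((a + ζ • v', θ • v') : E × E) = (a + (0 : ℂ) • v + ζ • v', (-θ / ζ) • ((0 : ℂ) • v - ζ • v')) := by
      simp [smul_smul, div_mul_cancel₀ _ hζ, neg_div]
    rw [h3] at he
    filter_upwards [hc.eventually he] with p hp
    exact ⟨_, hp⟩

theorem conic_W {D : Set E} (hDo : IsOpen D) {v v' a : E} (hv : LinearIndependent ℂ ![v, v'])
    (hF : IsCompact (frontier D)) (ha : a ∈ D) {W : Set E} (hW : IsOpen W) (h1 : LX D a v ∪ LX D a v' ⊆ W) :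
    ∃ τ : ℝ, 0 < τ ∧ ∀ t : ℂ, ‖t‖ < τ → CX D a v v' t ⊆ W := by
  refine Exists.imp ?_ (conic_near hDo hv hF ha (P := fun p => a + p.1 • v + p.2 • v' ∈ W) ?_ ?_)
  · rintro τ ⟨hτ, h⟩
    refine ⟨hτ, fun t ht => ?_⟩
    rintro z ⟨hz, ζ, hζ, rfl⟩
    exact h t ht ζ hζ hz
  · intro ζ hζ hz
    have hc : ContinuousAt (fun p : ℂ × ℂ => a + p.1 • v + p.2 • v') (ζ, 0) := by fun_prop
    refine hc.eventually (hW.mem_nhds ?_)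
    exact h1 (Or.inl ⟨by simpa using hz, ζ, by simp⟩)
  · intro ζ hζ hz
    have hc : ContinuousAt (fun p : ℂ × ℂ => a + p.1 • v + p.2 • v') (0, ζ) := by fun_prop
    refine hc.eventually (hW.mem_nhds ?_)
    exact h1 (Or.inr ⟨by simpa using hz, ζ, by simp⟩)

end

variable {N : ℕ} {D : Set (EuclideanSpace ℂ (Fin N))} {f : EuclideanSpace ℂ (Fin N) → ℂ}

theorem Setup.exists_indep (S : Setup D f) {v : EuclideanSpace ℂ (Fin N)} (hv : v ≠ 0) :
    ∃ v', LinearIndependent ℂ ![v, v'] := by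
  obtain ⟨i, i', hii, -⟩ := S.hA
  have : 1 < Module.finrank ℂ (EuclideanSpace ℂ (Fin N)) := by
    rw [finrank_euclideanSpace_fin]
    have h1 := i.2
    have h2 := i'.2
    have h3 : (i : ℕ) ≠ i' := fun h => hii (Fin.ext h.symm)
    omega
  exact exists_linearIndependent_pair_of_one_lt_finrank this hv

theorem cφ_one {E : Type*} [NormedAddCommGroup E] [NormedSpace ℂ E] (a v v' : E) :
    cφ a v v' (fun _ => 1) 0 = fun w => a + w • v := by
  ext w; simp [cφ]

theorem SX_line {E : Type*} [NormedAddCommGroup E] [NormedSpace ℂ E] (D : Set E) (a v : E) {G : Set ℂ} (hG : G = univ) :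
    (fun w : ℂ => a + w • v) '' SX D G (fun w : ℂ => a + w • v) = LX D a v := by
  subst hG
  ext z
  constructor
  · rintro ⟨w, hw, rfl⟩; exact ⟨hw.2, w, rfl⟩
  · rintro ⟨hz, w, rfl⟩; exact ⟨w, ⟨mem_univ _, hz⟩, rfl⟩

theorem line_compact {E : Type*} [NormedAddCommGroup E] [NormedSpace ℂ E] {v v' : E}
    (hv : LinearIndependent ℂ ![v, v']) (a : E) {K : Set E} (hK : IsCompact K) :
    IsCompact {w : ℂ | a + w • v ∈ K} := by
  have h := ((pair_compact hv a hK).inter_right (isClosed_eq continuous_snd continuous_const : IsClosed {p : ℂ × ℂ | p.2 = 0})).image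
    continuous_fst
  convert h using 1
  ext w
  constructor
  · intro hw; exact ⟨(w, 0), ⟨by simpa using hw, rfl⟩, rfl⟩
  · rintro ⟨⟨x, y⟩, ⟨h1, h2⟩, rfl⟩
    simp only [mem_ofPred_eq] at h1 h2 ⊢
    subst h2
    simpa using h1

theorem Setup.line_isSlice (S : Setup D f) (a : EuclideanSpace ℂ (Fin N)) {v : EuclideanSpace ℂ (Fin N)} (hv : v ≠ 0) :
    ∃ ξ, IsSlice D univ (fun w : ℂ => a + w • v) ξ := by
  obtain ⟨v', hvv⟩ := S.exists_indep hv
  have hu : {w : ℂ | (fun _ => (1 : ℂ)) w ≠ 0} = univ := by simp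
  have := S.slice1 (a := a) hvv (s := fun _ => 1) (differentiable_const _) (t := 0) (by simp) (by simpa using isPreconnected_univ)
    (fun R => ⟨((|R| + 1 : ℝ) : ℂ), by simp, by
      rw [Complex.norm_real, Real.norm_of_nonneg (by positivity)]; linarith [le_abs_self R]⟩)
    (by rw [cφ_one, hu, univ_inter]; exact line_compact hvv a S.hDc)
  rwa [cφ_one, hu] at this

theorem Setup.line (S : Setup D f) {a v : EuclideanSpace ℂ (Fin N)} (hv : v ≠ 0) (hg : Good D a v) :
    ∃ F : ℂ → ℂ, DifferentiableOn ℂ F {w | a + w • v ∈ D} ∧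
      ∀ w, a + w • v ∈ D → SS D f (LX D a v) (a + w • v) = {F w} := by
  obtain ⟨v', hvv⟩ := S.exists_indep hv
  have hu : {w : ℂ | (fun _ => (1 : ℂ)) w ≠ 0} = univ := by simp
  have := S.slice (a := a) hvv (s := fun _ => 1) (differentiable_const _) (t := 0) (by simp) (by simpa using isPreconnected_univ)
    (fun R => ⟨((|R| + 1 : ℝ) : ℂ), by simp, by
      rw [Complex.norm_real, Real.norm_of_nonneg (by positivity)]; linarith [le_abs_self R]⟩)
    (by rw [cφ_one, hu, univ_inter]; exact line_compact hvv a S.hDc)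
    (by
      rw [cφ_one]
      intro x _ hx
      obtain ⟨θ, hθ⟩ := hg x hx
      refine ⟨θ, ?_⟩
      have : deriv (fun w : ℂ => a + w • v) x = v := by
        have h : HasDerivAt (fun w : ℂ => a + w • v) ((1 : ℂ) • v) x :=
          ((hasDerivAt_id x).smul_const v).const_add a
        rw [h.deriv, one_smul]
      rwa [this])
  rw [cφ_one, SX_line D a v hu, hu, univ_inter] at this
  obtain ⟨F, h1, h2⟩ := this
  exact ⟨F, h1, fun w hw => h2 w one_ne_zero hw⟩

theorem Setup.line_ne (S : Setup D f) {a v : EuclideanSpace ℂ (Fin N)} (ha : a ∈ D) (hv : v ≠ 0) :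
    (LX D a v).Nonempty := by
  obtain ⟨v', hvv⟩ := S.exists_indep hv
  obtain ⟨x, -, h, -⟩ := (S.slice0 (a := a) hvv (s := fun _ => 1) (differentiable_const _) (t := 0) (by simp)).2 0 one_ne_zero
    (by rw [cφ_one]; simpa using ha) 0 (Subalgebra.zero_mem _)
  rw [cφ_one] at h
  exact ⟨_, h, x, rfl⟩

theorem Setup.line_D0 (S : Setup D f) {a v : EuclideanSpace ℂ (Fin N)} (hv : v ≠ 0) (ha : a ∈ D) {l μ : ℂ}
    (hl : l ∈ SS D f (LX D a v) a) {c : ℂ} (hc : a + c • v ∉ closure D) {η : ℝ} (hη : 0 < η)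
    (hbar : ∀ x : ℂ, a + x • v ∈ frontier D → ‖f (a + x • v) - μ‖ * ‖c‖ ≤ η * ‖x - c‖) : ‖l - μ‖ ≤ η := by
  obtain ⟨ξ, hs⟩ := S.line_isSlice a hv
  have haF : a ∉ frontier D := by rw [S.hDo.frontier_eq]; exact fun h => h.2 ha
  haveI : CompactSpace (SX D univ (fun w : ℂ => a + w • v)) := isCompact_iff_compactSpace.1 hs.X_compact
  rw [← SX_line D a v rfl] at hl
  refine slice_D0 hs rfl S.hDc S.hst S.hf.continuousOn (w := 0) (mem_univ _) (c := c) (by simpa using subset_closure ha)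
    (by simpa using haF) (by simpa using hl) (mem_univ _) hc hη ?_
  intro x hx
  simpa using hbar x hx.2

theorem Setup.conic (S : Setup D f) {a v v' : EuclideanSpace ℂ (Fin N)} (hv : LinearIndependent ℂ ![v, v'])
    (ha : a ∈ D) (hg : Good D a v) (hg' : Good D a v') :
    ∃ τ : ℝ, 0 < τ ∧ ∀ t : ℂ, t ≠ 0 → ‖t‖ < τ → ∃ F : ℂ → ℂ,
      DifferentiableOn ℂ F {w | w ≠ 0 ∧ a + w • v + (t / w) • v' ∈ D} ∧
      ∀ w, w ≠ 0 → a + w • v + (t / w) • v' ∈ D → SS D f (CX D a v v' t) (a + w • v + (t / w) • v') = {F w} := by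
  obtain ⟨τ, hτ, h⟩ := conic_good S.hDo hv S.hFc ha hg hg'
  refine ⟨τ, hτ, fun t ht htτ => ?_⟩
  have h1 := S.slice (a := a) hv (s := id) differentiable_id (t := t) (fun _ _ => ht)
    (by
      have : {w : ℂ | id w ≠ 0} = {0}ᶜ := by ext; simp
      rw [this]
      exact (isConnected_compl_singleton_of_one_lt_rank (by simp [Complex.rank_real_complex]) 0).isPreconnected)
    (fun R => ⟨((|R| + 1 : ℝ) : ℂ), by
        simp only [mem_ofPred_eq, id]; exact_mod_cast (by positivity : |R| + 1 ≠ 0), by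
      rw [Complex.norm_real, Real.norm_of_nonneg (by positivity)]; linarith [le_abs_self R]⟩)
    (by
      have h := ((pair_compact hv a S.hDc).inter_right (isClosed_eq (continuous_fst.mul continuous_snd) continuous_const :
        IsClosed {p : ℂ × ℂ | p.1 * p.2 = t})).image continuous_fst
      convert h using 1
      ext w
      constructor
      · rintro ⟨hw, hw2⟩
        exact ⟨(w, t / w), ⟨hw2, mul_div_cancel₀ _ hw⟩, rfl⟩
      · rintro ⟨⟨x, y⟩, ⟨h1, h2⟩, rfl⟩
        simp only [mem_ofPred_eq] at h1 h2 ⊢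
        have hx : x ≠ 0 := by rintro rfl; simp at h2; exact ht h2.symm
        refine ⟨hx, ?_⟩
        have : y = t / x := by rw [← h2]; field_simp
        rw [this] at h1
        exact h1)
    (h t htτ)
  obtain ⟨F, hF1, hF2⟩ := h1
  have h3 : cφ a v v' id t '' SX D {w | id w ≠ 0} (cφ a v v' id t) = CX D a v v' t := by
    ext z
    constructor
    · rintro ⟨w, hw, rfl⟩; exact ⟨hw.2, w, hw.1, rfl⟩
    · rintro ⟨hz, w, hw, rfl⟩; exact ⟨w, ⟨hw, hz⟩, rfl⟩
  rw [h3] at hF2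
  exact ⟨F, hF1, hF2⟩

end Slice
end

open Set Metric Bornology MvPolynomial
noncomputable section

namespace Slice
open Filter Topology

theorem avg_tendsto {τ R : ℝ} (hτ : 0 < τ) {F : ℝ → ℝ → ℂ} {g : ℝ → ℂ}
    (hF : ∀ t, 0 < t → t < τ → Continuous (F t)) (hb : ∀ t, 0 < t → t < τ → ∀ θ, ‖F t θ‖ ≤ R)
    (hl : ∀ θ, Tendsto (fun t => F t θ) (𝓝[>] 0) (𝓝 (g θ))) :
    Tendsto (fun t => ∫ θ in (0)..(2 * Real.pi), F t θ) (𝓝[>] 0) (𝓝 (∫ θ in (0)..(2 * Real.pi), g θ)) := by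
  have hev : ∀ᶠ t in 𝓝[>] (0 : ℝ), t ∈ Ioo 0 τ := Ioo_mem_nhdsGT hτ
  refine intervalIntegral.tendsto_integral_filter_of_dominated_convergence (fun _ => R) ?_ ?_ ?_ ?_
  · filter_upwards [hev] with t ht
    exact (hF t ht.1 ht.2).aestronglyMeasurable
  · filter_upwards [hev] with t ht
    exact Filter.Eventually.of_forall fun θ _ => hb t ht.1 ht.2 θ
  · exact intervalIntegrable_const
  · exact Filter.Eventually.of_forall fun θ _ => hl θ

theorem mean_neg {ρ : ℝ} (hρ : 0 < ρ) {F : ℂ → ℂ} {U : Set ℂ} (hU : IsOpen U) (hF : DifferentiableOn ℂ F U)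
    (hb : closedBall 0 ρ ⊆ U) :
    (2 * Real.pi)⁻¹ • ∫ θ in (0)..(2 * Real.pi), F (circleMap 0 ρ θ) = F 0 ∧
    (2 * Real.pi)⁻¹ • ∫ θ in (0)..(2 * Real.pi), F (circleMap 0 ρ (-θ)) = F 0 := by
  have h1 : Real.circleAverage F 0 ρ = F 0 := by
    refine circleAverage_of_differentiable_on_off_countable countable_empty ?_ ?_
    · rw [abs_of_pos hρ]; exact hF.continuousOn.mono hb
    · rw [abs_of_pos hρ]
      intro z hz
      exact (hF z (hb (ball_subset_closedBall hz.1))).differentiableAt (hU.mem_nhds (hb (ball_subset_closedBall hz.1)))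
  refine ⟨h1, ?_⟩
  rw [← h1, Real.circleAverage_def]
  congr 1
  rw [intervalIntegral.integral_comp_neg (fun θ => F (circleMap 0 ρ θ))]
  have hp : Function.Periodic (fun θ => F (circleMap 0 ρ θ)) (2 * Real.pi) := by
    intro θ; simp only [periodic_circleMap 0 ρ θ]
  have := hp.intervalIntegral_add_eq (-(2 * Real.pi)) 0
  simpa using this

theorem annulus_eq {r ρ : ℝ} (hr : 0 < r) (hle : r ≤ ρ) {F : ℂ → ℂ} {U : Set ℂ} (hU : IsOpen U)
    (hF : DifferentiableOn ℂ F U) (hb : closedBall 0 ρ \ ball 0 r ⊆ U) :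
    (2 * Real.pi)⁻¹ • ∫ θ in (0)..(2 * Real.pi), F (circleMap 0 ρ θ) =
    (2 * Real.pi)⁻¹ • ∫ θ in (0)..(2 * Real.pi), F (circleMap 0 r θ) := by
  change Real.circleAverage F 0 ρ = Real.circleAverage F 0 r
  rw [Real.circleAverage_eq_circleIntegral (hr.trans_le hle).ne', Real.circleAverage_eq_circleIntegral hr.ne']
  congr 1
  refine Complex.circleIntegral_sub_center_inv_smul_eq_of_differentiable_on_annulus_off_countable hr hle
    countable_empty (hF.continuousOn.mono hb) ?_
  intro z hz
  have : z ∈ U := hb ⟨ball_subset_closedBall hz.1.1, fun h => hz.1.2 (ball_subset_closedBall h)⟩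
  exact (hF z this).differentiableAt (hU.mem_nhds this)

variable {N : ℕ} {D : Set (EuclideanSpace ℂ (Fin N))} {f : EuclideanSpace ℂ (Fin N) → ℂ}

theorem Setup.SS_union_sub (S : Setup D f) {a v v' : EuclideanSpace ℂ (Fin N)} (hv : LinearIndependent ℂ ![v, v'])
    (ha : a ∈ D) {w : ℂ} (hw : w ≠ 0) :
    SS D f (LX D a v ∪ LX D a v') (a + w • v) ⊆ SS D f (LX D a v) (a + w • v) := by
  intro l hl q hq C hC
  obtain ⟨i, i', hii, -⟩ := S.hA
  obtain ⟨T, hT1, hT2⟩ := exists_T hii hv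
  let ξ : EuclideanSpace ℂ (Fin N) → ℂ := fun z => T (z - a) i'
  have hξd : Differentiable ℂ ξ :=
    differentiable_euclidean.1 (T.differentiable.comp (differentiable_id.sub_const a)) i'
  have hξ1 : ∀ ζ : ℂ, ξ (a + ζ • v) = ζ := by intro ζ; simp [ξ, ← hT1]
  have hξ2 : ∀ ζ : ℂ, ξ (a + ζ • v') = 0 := by intro ζ; simp [ξ, ← hT2, hii]
  obtain ⟨M, hM⟩ := S.hFc.exists_bound_of_continuousOn hξd.continuous.continuousOn
  have hv0 : v ≠ 0 := by simpa using hv.ne_zero 0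
  obtain ⟨z0, hz0⟩ := S.line_ne ha hv0
  have hM0 : 0 ≤ M := (norm_nonneg _).trans (hM z0 hz0.1)
  have hC0 : 0 ≤ C := (norm_nonneg _).trans (hC z0 hz0)
  have hξQ : (fun p : EuclideanSpace ℂ (Fin N) × ℂ => ξ p.1) ∈ QA D :=
    QA_fst isOpen_univ (subset_univ _) hξd.differentiableOn
  refine le_of_forall_gt_imp_ge_of_dense fun r hr => ?_
  have hr0 : 0 < r := hC0.trans_lt hr
  refine le_of_pow_le (C := M / ‖w‖) (norm_nonneg _) hr0 fun n => ?_
  have h1 := hl (q ^ n * fun p => ξ p.1) (mul_mem (pow_mem hq n) hξQ) (r ^ n * M) (by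
    intro z hz
    simp only [Pi.mul_apply, Pi.pow_apply, norm_mul, norm_pow]
    rcases hz with hz | hz
    · have := hC z hz
      have h2 := hM z hz.1
      gcongr
      exact this.trans hr.le
    · obtain ⟨hzF, ζ, rfl⟩ := hz
      rw [hξ2]; simp; positivity)
  simp only [Pi.mul_apply, Pi.pow_apply, norm_mul, norm_pow, hξ1] at h1
  have hw0 : 0 < ‖w‖ := norm_pos_iff.2 hw
  rw [div_mul_eq_mul_div, le_div_iff₀ hw0]
  linarith

theorem Setup.conic_conv (S : Setup D f) {a v v' : EuclideanSpace ℂ (Fin N)} (hv : LinearIndependent ℂ ![v, v'])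
    (ha : a ∈ D) {p0 : EuclideanSpace ℂ (Fin N)} (hp0 : p0 ∈ closure D) {l0 : ℂ}
    (h0 : SS D f (LX D a v ∪ LX D a v') p0 ⊆ {l0}) {p : ℝ → EuclideanSpace ℂ (Fin N)} {l : ℝ → ℂ}
    (hp : Tendsto p (𝓝[>] 0) (𝓝 p0)) (hl : ∀ᶠ t : ℝ in 𝓝[>] 0, l t ∈ SS D f (CX D a v v' t) (p t)) :
    Tendsto l (𝓝[>] 0) (𝓝 l0) := by
  rw [Metric.tendsto_nhds]
  intro ε hε
  obtain ⟨W, hW, hXW, h⟩ := SS_usc S.hFc S.hf.continuousOn (union_subset (LX_sub D a v) (LX_sub D a v')) hp0 h0 hε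
  obtain ⟨τ, hτ, h2⟩ := conic_W S.hDo hv S.hFc ha hW hXW
  have hev : ∀ᶠ t in 𝓝[>] (0 : ℝ), t ∈ Ioo 0 τ := Ioo_mem_nhdsGT hτ
  filter_upwards [hp.eventually h, hl, hev] with t h3 h4 h5
  rw [dist_eq_norm]
  refine h3 _ (h2 t ?_) (CX_sub _ _ _ _ _) _ h4
  rw [Complex.norm_real, Real.norm_of_nonneg h5.1.le]; exact h5.2

theorem Setup.consist (S : Setup D f) {a v v' : EuclideanSpace ℂ (Fin N)} (hv : LinearIndependent ℂ ![v, v'])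
    (ha : a ∈ D) (hg : Good D a v) (hg' : Good D a v') {l l' : ℂ}
    (hl : SS D f (LX D a v) a = {l}) (hl' : SS D f (LX D a v') a = {l'}) : l = l' := by
  have hv0 : v ≠ 0 := by simpa using hv.ne_zero 0
  have hv0' : v' ≠ 0 := by simpa using hv.ne_zero 1
  have hv' : LinearIndependent ℂ ![v', v] := by
    rw [LinearIndependent.pair_iff] at hv ⊢
    intro s t h
    exact (hv t s (by rw [← h, add_comm])).symm
  obtain ⟨τ0, hτ0, hF⟩ := S.conic hv ha hg hg'
  obtain ⟨FL, hFLd, hFL⟩ := S.line hv0 hg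
  obtain ⟨FL', hFLd', hFL'⟩ := S.line hv0' hg'
  have e1 : l = FL 0 := by
    have := hFL 0 (by simpa using ha)
    rw [zero_smul, add_zero, hl] at this
    simpa using this
  have e2 : l' = FL' 0 := by
    have := hFL' 0 (by simpa using ha)
    rw [zero_smul, add_zero, hl'] at this
    simpa using this
  obtain ⟨ρ, hρ, hbi⟩ : ∃ ρ : ℝ, 0 < ρ ∧ ∀ ξ η : ℂ, ‖ξ‖ ≤ ρ → ‖η‖ ≤ ρ → a + ξ • v + η • v' ∈ D := by
    have hc : ContinuousAt (fun p : ℂ × ℂ => a + p.1 • v + p.2 • v') (0, 0) := by fun_prop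
    have h := hc.eventually (S.hDo.mem_nhds (by simpa using ha))
    obtain ⟨ρ, hρ, h⟩ := Metric.eventually_nhds_iff.1 h
    refine ⟨ρ / 2, half_pos hρ, fun ξ η h1 h2 => h (y := (ξ, η)) ?_⟩
    rw [Prod.dist_eq, max_lt_iff]
    simp only [dist_zero_right]
    constructor <;> linarith
  have hbi1 : ∀ ξ : ℂ, ‖ξ‖ ≤ ρ → a + ξ • v ∈ D := fun ξ h => by simpa using hbi ξ 0 h (by simpa using hρ.le)
  have hbi2 : ∀ ξ : ℂ, ‖ξ‖ ≤ ρ → a + ξ • v' ∈ D := fun ξ h => by simpa using hbi 0 ξ (by simpa using hρ.le) h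
  have hF' : ∀ t : ℝ, ∃ F : ℂ → ℂ, 0 < t → t < τ0 →
      DifferentiableOn ℂ F {w | w ≠ 0 ∧ a + w • v + ((t : ℂ) / w) • v' ∈ D} ∧
      ∀ w, w ≠ 0 → a + w • v + ((t : ℂ) / w) • v' ∈ D →
        SS D f (CX D a v v' t) (a + w • v + ((t : ℂ) / w) • v') = {F w} := by
    intro t
    by_cases h : 0 < t ∧ t < τ0
    · obtain ⟨F, h1⟩ := hF t (by exact_mod_cast h.1.ne') (by
        rw [Complex.norm_real, Real.norm_of_nonneg h.1.le]; exact h.2)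
      exact ⟨F, fun _ _ => h1⟩
    · exact ⟨0, fun h1 h2 => absurd ⟨h1, h2⟩ h⟩
  choose F hF using hF'
  set τ := min τ0 (ρ * ρ) with hτ
  have hτpos : 0 < τ := by positivity
  have hev : ∀ᶠ t in 𝓝[>] (0 : ℝ), t ∈ Ioo 0 τ := Ioo_mem_nhdsGT hτpos
  -- membership of annulus
  have hann : ∀ t : ℝ, 0 < t → t < τ → ∀ w : ℂ, t / ρ ≤ ‖w‖ → ‖w‖ ≤ ρ → w ≠ 0 ∧ a + w • v + ((t : ℂ) / w) • v' ∈ D := by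
    intro t h1 h2 w h3 h4
    have hw : 0 < ‖w‖ := (by positivity : 0 < t / ρ).trans_le h3
    refine ⟨norm_pos_iff.1 hw, hbi _ _ h4 ?_⟩
    rw [norm_div, Complex.norm_real, Real.norm_of_nonneg h1.le, div_le_iff₀ hw]
    rw [div_le_iff₀ hρ] at h3
    linarith
  have htρ : ∀ t : ℝ, 0 < t → t < τ → t / ρ ≤ ρ := fun t h1 h2 => by
    rw [div_le_iff₀ hρ]; exact (h2.trans_le (min_le_right _ _)).le
  have hmem : ∀ t : ℝ, 0 < t → t < τ → ∀ w : ℂ, t / ρ ≤ ‖w‖ → ‖w‖ ≤ ρ →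
      F t w ∈ SS D f (CX D a v v' t) (a + w • v + ((t : ℂ) / w) • v') := by
    intro t h1 h2 w h3 h4
    have := hann t h1 h2 w h3 h4
    rw [(hF t h1 (h2.trans_le (min_le_left _ _))).2 w this.1 this.2]
    rfl
  obtain ⟨R, hR⟩ := S.hFc.exists_bound_of_continuousOn S.hf.continuousOn
  have hbd : ∀ t : ℝ, 0 < t → t < τ → ∀ w : ℂ, t / ρ ≤ ‖w‖ → ‖w‖ ≤ ρ → ‖F t w‖ ≤ R := fun t h1 h2 w h3 h4 =>
    SS_bound (hmem t h1 h2 w h3 h4) (fun z hz => hR z (CX_sub _ _ _ _ _ hz))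
  have hopen : ∀ t : ℝ, IsOpen {w : ℂ | w ≠ 0 ∧ a + w • v + ((t : ℂ) / w) • v' ∈ D} := by
    intro t
    have hc : ContinuousOn (fun w : ℂ => a + w • v + ((t : ℂ) / w) • v') {w | w ≠ 0} := by
      intro w hw
      refine ContinuousAt.continuousWithinAt ?_
      have : ContinuousAt (fun w : ℂ => (t : ℂ) / w) w := continuousAt_const.div continuousAt_id hw
      fun_prop
    exact hc.isOpen_inter_preimage isOpen_ne S.hDo
  have hn1 : ∀ θ, ‖circleMap 0 ρ θ‖ = ρ := fun θ => by rw [norm_circleMap_zero, abs_of_pos hρ]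
  have hn2 : ∀ t, 0 < t → ∀ θ, ‖circleMap 0 (t / ρ) θ‖ = t / ρ := fun t ht θ => by
    rw [norm_circleMap_zero, abs_of_pos (by positivity)]
  -- first limit
  have hsm : ∀ w : ℂ, ‖w‖ = ρ → Tendsto (fun t : ℝ => (t : ℂ) / w) (𝓝[>] 0) (𝓝 0) := by
    intro w _
    have : Tendsto (fun t : ℝ => (t : ℂ) / w) (𝓝 0) (𝓝 (((0 : ℝ) : ℂ) / w)) :=
      (Complex.continuous_ofReal.tendsto 0).div_const w
    simp only [Complex.ofReal_zero, zero_div] at this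
    exact this.mono_left nhdsWithin_le_nhds
  have hlim1 : ∀ w : ℂ, ‖w‖ = ρ → Tendsto (fun t : ℝ => F t w) (𝓝[>] 0) (𝓝 (FL w)) := by
    intro w hw
    have hw0 : w ≠ 0 := norm_pos_iff.1 (hw ▸ hρ)
    refine S.conic_conv hv ha (p0 := a + w • v) (subset_closure (hbi1 w hw.le)) ?_
      (p := fun t : ℝ => a + w • v + ((t : ℂ) / w) • v') ?_ ?_
    · rw [← hFL w (hbi1 w hw.le)]; exact S.SS_union_sub hv ha hw0
    · have := ((hsm w hw).smul_const v').const_add (a + w • v)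
      simpa using this
    · filter_upwards [hev] with t ht
      exact hmem t ht.1 ht.2 w (by rw [hw]; exact htρ t ht.1 ht.2) hw.le
  have hlim2 : ∀ w : ℂ, ‖w‖ = ρ → Tendsto (fun t : ℝ => F t (t / w)) (𝓝[>] 0) (𝓝 (FL' w)) := by
    intro w hw
    have hw0 : w ≠ 0 := norm_pos_iff.1 (hw ▸ hρ)
    refine S.conic_conv hv ha (p0 := a + w • v') (subset_closure (hbi2 w hw.le)) ?_
      (p := fun t : ℝ => a + ((t : ℂ) / w) • v + w • v') ?_ ?_
    · rw [← hFL' w (hbi2 w hw.le), union_comm]; exact S.SS_union_sub hv' ha hw0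
    · have := (((hsm w hw).smul_const v).const_add a).add_const (w • v')
      simpa using this
    · filter_upwards [hev] with t ht
      have ht0 : (t : ℂ) ≠ 0 := by exact_mod_cast ht.1.ne'
      have hn : ‖(t : ℂ) / w‖ = t / ρ := by
        rw [norm_div, hw, Complex.norm_real, Real.norm_of_nonneg ht.1.le]
      have := hmem t ht.1 ht.2 (t / w) hn.ge (hn.le.trans (htρ t ht.1 ht.2))
      rwa [div_div_cancel₀ ht0] at this
  have hcm : ∀ t θ : ℝ, circleMap 0 (t / ρ) θ = (t : ℂ) / circleMap 0 ρ (-θ) := by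
    intro t θ
    rw [circleMap_zero, circleMap_zero]
    push_cast
    rw [neg_mul, Complex.exp_neg]
    field_simp
  have T1 := avg_tendsto (F := fun t θ => F t (circleMap 0 ρ θ)) (g := fun θ => FL (circleMap 0 ρ θ)) hτpos
    (fun t h1 h2 => (hF t h1 (h2.trans_le (min_le_left _ _))).1.continuousOn.comp_continuous (continuous_circleMap 0 ρ)
      (fun θ => hann t h1 h2 _ (by rw [hn1]; exact htρ t h1 h2) (hn1 θ).le))
    (fun t h1 h2 θ => hbd t h1 h2 _ (by rw [hn1]; exact htρ t h1 h2) (hn1 θ).le)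
    (fun θ => hlim1 _ (hn1 θ))
  have T2 := avg_tendsto (F := fun t θ => F t (circleMap 0 (t / ρ) θ)) (g := fun θ => FL' (circleMap 0 ρ (-θ))) hτpos
    (fun t h1 h2 => (hF t h1 (h2.trans_le (min_le_left _ _))).1.continuousOn.comp_continuous (continuous_circleMap 0 _)
      (fun θ => hann t h1 h2 _ (hn2 t h1 θ).ge ((hn2 t h1 θ).le.trans (htρ t h1 h2))))
    (fun t h1 h2 θ => hbd t h1 h2 _ (hn2 t h1 θ).ge ((hn2 t h1 θ).le.trans (htρ t h1 h2)))
    (fun θ => by simpa only [hcm] using hlim2 _ (hn1 (-θ)))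
  have T1' := T1.const_smul (2 * Real.pi)⁻¹
  have T2' := T2.const_smul (2 * Real.pi)⁻¹
  have hD1 : IsOpen {w : ℂ | a + w • v ∈ D} := S.hDo.preimage (by fun_prop)
  have hD2 : IsOpen {w : ℂ | a + w • v' ∈ D} := S.hDo.preimage (by fun_prop)
  rw [(mean_neg hρ hD1 hFLd (fun w hw => hbi1 w (by simpa using hw))).1] at T1'
  rw [(mean_neg hρ hD2 hFLd' (fun w hw => hbi2 w (by simpa using hw))).2] at T2'
  rw [e1, e2]
  refine tendsto_nhds_unique T1' (T2'.congr' ?_)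
  filter_upwards [hev] with t ht
  symm
  refine annulus_eq (div_pos ht.1 hρ) (htρ t ht.1 ht.2) (hopen t) (hF t ht.1 (ht.2.trans_le (min_le_left _ _))).1 ?_
  intro w hw
  exact hann t ht.1 ht.2 w (by simpa using hw.2) (by simpa using hw.1)

theorem Setup.consist' (S : Setup D f) {a v v' : EuclideanSpace ℂ (Fin N)} (hv : v ≠ 0) (hv' : v' ≠ 0)
    (ha : a ∈ D) (hg : Good D a v) (hg' : Good D a v') {l l' : ℂ}
    (hl : SS D f (LX D a v) a = {l}) (hl' : SS D f (LX D a v') a = {l'}) : l = l' := by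
  by_cases h : LinearIndependent ℂ ![v, v']
  · exact S.consist h ha hg hg' hl hl'
  · rw [LinearIndependent.pair_iff' hv] at h
    push Not at h
    obtain ⟨c, rfl⟩ := h
    have hc : c ≠ 0 := by rintro rfl; simp at hv'
    rw [LX_scale D a v hc, hl] at hl'
    simpa using hl'

end Slice
end

open Set Metric Bornology MvPolynomial
noncomputable section

namespace Slice
open Filter Topology MeasureTheory
open scoped Pointwise

section
variable {E : Type*} [NormedAddCommGroup E] [NormedSpace ℂ E] [NormedSpace ℝ E] [IsScalarTower ℝ ℂ E]

theorem coe_smul' (s : ℝ) (u : E) : (s : ℂ) • u = s • u := algebraMap_smul ℂ s u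

theorem outDir_of_chart {D U : Set E} {ρ : E → ℝ} (hU : IsOpen U)
    (hρ : ContDiffOn ℝ 2 ρ U) (hD : D ∩ U = {x ∈ U | ρ x < 0}) (hF : frontier D ∩ U = {x ∈ U | ρ x = 0})
    {z u : E} (hz : z ∈ U) (hu : 0 < fderiv ℝ ρ z u) : OutDir D z u := by
  have hs : HasStrictFDerivAt ρ (fderiv ℝ ρ z) z :=
    (hρ.contDiffAt (hU.mem_nhds hz)).hasStrictFDerivAt (by norm_num)
  set L := fderiv ℝ ρ z with hL
  set ε := L u / (4 * (‖u‖ + 1)) with hε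
  have hε0 : 0 < ε := by positivity
  obtain ⟨δ1, hδ1, h1⟩ := Metric.eventually_nhds_iff.1 (hs.isLittleO.def hε0)
  obtain ⟨δ2, hδ2, h2⟩ := Metric.isOpen_iff.1 hU z hz
  set m := min δ1 δ2 with hm
  have hm0 : 0 < m := by positivity
  set r := min (min (m / (2 * (‖u‖ + 1))) (m / 2)) (min 1 (L u / (4 * (‖L‖ + 1)))) with hr
  have hr0 : 0 < r := by positivity
  have hr1 : r ≤ m / (2 * (‖u‖ + 1)) := (min_le_left _ _).trans (min_le_left _ _)
  have hr2 : r ≤ m / 2 := (min_le_left _ _).trans (min_le_right _ _)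
  have hr3 : r ≤ 1 := (min_le_right _ _).trans (min_le_left _ _)
  have hr4 : r ≤ L u / (4 * (‖L‖ + 1)) := (min_le_right _ _).trans (min_le_right _ _)
  refine ⟨r, hr0, fun z' hz' hzz s hs0 hsr u' huu => ?_⟩
  have hsm : (s : ℂ) • u' = s • u' := coe_smul' s u'
  rw [hsm]
  rw [dist_eq_norm] at huu
  have he2 : ‖u'‖ ≤ ‖u‖ + 1 := by
    have := norm_sub_norm_le u' u
    linarith
  have hse : ‖s • u'‖ < m / 2 := by
    rw [norm_smul, Real.norm_of_nonneg hs0.le]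
    calc s * ‖u'‖ ≤ s * (‖u‖ + 1) := by gcongr
      _ < (m / (2 * (‖u‖ + 1))) * (‖u‖ + 1) := by gcongr; linarith
      _ = m / 2 := by field_simp
  have hxs : dist (z' + s • u') z < m := by
    rw [dist_eq_norm] at hzz ⊢
    calc ‖z' + s • u' - z‖ = ‖(z' - z) + s • u'‖ := by congr 1; abel
      _ ≤ ‖z' - z‖ + ‖s • u'‖ := norm_add_le _ _
      _ < m := by linarith
  have hm1 : m ≤ δ1 := min_le_left _ _
  have hm2 : m ≤ δ2 := min_le_right _ _
  have hzU : z' ∈ U := h2 (by rw [mem_ball]; linarith)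
  have hz2U : z' + s • u' ∈ U := h2 (by rw [mem_ball]; linarith)
  have hρ0 : ρ z' = 0 := by
    have : z' ∈ frontier D ∩ U := ⟨hz', hzU⟩
    rw [hF] at this; exact this.2
  have h4 := h1 (y := (z' + s • u', z')) (by
    rw [Prod.dist_eq, max_lt_iff]; exact ⟨by simp only; linarith, by simp only; linarith⟩)
  simp only [hρ0, sub_zero, add_sub_cancel_left, map_smul, smul_eq_mul] at h4
  rw [norm_smul, Real.norm_of_nonneg hs0.le, Real.norm_eq_abs] at h4
  have h5 : ε * (s * ‖u'‖) ≤ s * (L u / 4) := by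
    calc ε * (s * ‖u'‖) ≤ ε * (s * (‖u‖ + 1)) := by gcongr
      _ = s * (L u / 4) := by rw [hε]; field_simp
  have h6 : L u - L u / 4 ≤ L u' := by
    have h7 : ‖L (u' - u)‖ ≤ ‖L‖ * ‖u' - u‖ := L.le_opNorm _
    have h8 : ‖L‖ * ‖u' - u‖ ≤ L u / 4 := by
      calc ‖L‖ * ‖u' - u‖ ≤ (‖L‖ + 1) * (L u / (4 * (‖L‖ + 1))) := by
            gcongr <;> linarith
        _ = L u / 4 := by field_simp
    rw [map_sub, Real.norm_eq_abs] at h7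
    have := (abs_le.1 (h7.trans h8)).1
    linarith
  have h9 : 0 < ρ (z' + s • u') := by
    have := (abs_le.1 (h4.trans h5)).1
    nlinarith
  rw [closure_eq_self_union_frontier]
  rintro (h | h)
  · have : z' + s • u' ∈ D ∩ U := ⟨h, hz2U⟩
    rw [hD] at this
    exact absurd this.2 (by linarith)
  · have : z' + s • u' ∈ frontier D ∩ U := ⟨h, hz2U⟩
    rw [hF] at this
    exact absurd this.2 h9.ne'

theorem frontier_outDir {D : Set E} (hD : HasCkBoundary 2 D) {z : E} (hz : z ∈ frontier D) : ∃ u, OutDir D z u := by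
  obtain ⟨U, ρ, hU, hzU, hρ, hd, h1, h2⟩ := hD z hz
  obtain ⟨u, hu⟩ : ∃ u, fderiv ℝ ρ z u ≠ 0 := by
    by_contra h; push Not at h; exact hd z hzU (ContinuousLinearMap.ext h)
  rcases lt_or_gt_of_ne hu with h | h
  · exact ⟨-u, outDir_of_chart hU hρ h1 h2 hzU (by simpa using h)⟩
  · exact ⟨u, outDir_of_chart hU hρ h1 h2 hzU h⟩

theorem frontier_null [FiniteDimensional ℝ E] [MeasurableSpace E] [BorelSpace E] (μ : Measure E) [μ.IsAddHaarMeasure]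
    {D : Set E} (hD : HasCkBoundary 2 D) : μ (frontier D) = 0 := by
  haveI : ProperSpace E := FiniteDimensional.proper_real E
  refine measure_null_of_locally_null _ fun z hz => ?_
  obtain ⟨u, δ, hδ, h⟩ := frontier_outDir hD hz
  refine ⟨frontier D ∩ ball z δ, inter_mem self_mem_nhdsWithin (mem_nhdsWithin_of_mem_nhds (ball_mem_nhds z hδ)), ?_⟩
  set c : ℕ → ℝ := fun n => δ / (n + 2) with hc
  have hcpos : ∀ n, 0 < c n := fun n => by positivity
  have hclt : ∀ n, c n < δ := fun n => by
    rw [hc]; exact div_lt_self hδ (by have : (0 : ℝ) ≤ n := n.cast_nonneg; linarith)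
  have hinj : ∀ m n, m ≠ n → c m ≠ c n := by
    intro m n hmn h
    simp only [hc] at h
    have : (m : ℝ) + 2 = n + 2 := by
      field_simp at h; linarith
    exact hmn (by exact_mod_cast (by linarith : (m : ℝ) = n))
  have key : ∀ m n, c n < c m → Disjoint (({c m • u} : Set E) + (frontier D ∩ ball z δ)) (({c n • u} : Set E) + (frontier D ∩ ball z δ)) := by
    intro m n hmn
    rw [disjoint_left]
    rintro x hx hy
    rw [singleton_add, mem_image] at hx hy
    obtain ⟨p, hp, rfl⟩ := hx
    obtain ⟨q, hq, hpq⟩ := hy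
    refine h p hp.1 hp.2 (c m - c n) (by linarith) (by linarith [hclt m, hcpos n]) u (by simpa using hδ) ?_
    have : p + ((c m - c n : ℝ) : ℂ) • u = q := by
      rw [coe_smul', sub_smul]
      have : q = c m • u + p - c n • u := by rw [← hpq]; abel
      rw [this]; abel
    rw [this]
    exact frontier_subset_closure hq.1
  refine Measure.addHaar_eq_zero_of_disjoint_translates μ (fun n => c n • u) ?_ ?_
    (isClosed_frontier.measurableSet.inter measurableSet_ball)
  · refine (isBounded_closedBall (x := (0 : E)) (r := δ * ‖u‖)).subset ?_
    rintro _ ⟨n, rfl⟩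
    rw [mem_closedBall, dist_zero_right, norm_smul, Real.norm_of_nonneg (hcpos n).le]
    have := (hclt n).le
    gcongr
  · intro m n hmn
    rcases lt_or_gt_of_ne (hinj m n hmn) with h1 | h1
    · exact (key n m h1).symm
    · exact key m n h1

/-- complex gradient -/
def cA (ρ : E → ℝ) (z h : E) : ℂ := (fderiv ℝ ρ z h : ℂ) - Complex.I * (fderiv ℝ ρ z (Complex.I • h) : ℂ)

theorem cA_add (ρ : E → ℝ) (z h k : E) : cA ρ z (h + k) = cA ρ z h + cA ρ z k := by
  simp [cA]; ring

theorem cA_smul (ρ : E → ℝ) (z h : E) (c : ℂ) : cA ρ z (c • h) = c * cA ρ z h := by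
  have h1 : ∀ k : E, c • k = c.re • k + c.im • (Complex.I • k) := by
    intro k
    rw [← coe_smul' c.re, ← coe_smul' c.im, smul_smul, ← add_smul, Complex.re_add_im]
  have h2 : c.im • Complex.I • Complex.I • h = -(c.im • h) := by
    rw [smul_smul Complex.I, Complex.I_mul_I, neg_one_smul, smul_neg]
  unfold cA
  rw [smul_comm Complex.I c h, h1 h, h1 (Complex.I • h), h2]
  simp only [map_add, map_smul, map_neg, smul_eq_mul, Complex.ofReal_add, Complex.ofReal_mul, Complex.ofReal_neg]
  nth_rewrite 5 [← Complex.re_add_im c]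
  ring_nf
  rw [Complex.I_sq]; ring

theorem bad_null [FiniteDimensional ℝ E] [MeasurableSpace E] [BorelSpace E] (μ : Measure E) [μ.IsAddHaarMeasure]
    {D : Set E} (hD : HasCkBoundary 2 D) (hF : IsCompact (frontier D)) :
    (μ.prod μ) {p : E × E | ¬ Good D p.1 p.2} = 0 := by
  haveI : ProperSpace E := FiniteDimensional.proper_real E
  have hnull : (μ.prod μ) (frontier D ×ˢ univ) = 0 := by
    rw [Measure.prod_prod, frontier_null μ hD, zero_mul]
  have hloc : ∀ p ∈ frontier D, ∃ U ∈ 𝓝 p,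
      (μ.prod μ) {q : E × E | ∃ ζ : ℂ, q.1 + ζ • q.2 ∈ frontier D ∩ U ∧ ∀ θ : ℂ, ¬ OutDir D (q.1 + ζ • q.2) (θ • q.2)} = 0 := by
    intro p hp
    obtain ⟨U, ρ, hU, hpU, hρ, hd, h1, h2⟩ := hD p hp
    obtain ⟨e, he⟩ : ∃ e, fderiv ℝ ρ p e ≠ 0 := by
      by_contra h; push Not at h; exact hd p hpU (ContinuousLinearMap.ext h)
    have he' : cA ρ p e ≠ 0 := by
      intro h
      have := congrArg Complex.re h
      simp [cA] at this
      exact he this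
    have hfd : DifferentiableOn ℝ (fderiv ℝ ρ) U :=
      (hρ.fderiv_of_isOpen (m := 1) hU (by norm_num)).differentiableOn (by norm_num)
    have hcAd : ∀ {V : Set (E × E)} {g h : E × E → E}, (∀ x ∈ V, g x ∈ U) → DifferentiableOn ℝ g V → DifferentiableOn ℝ h V →
        DifferentiableOn ℝ (fun x => cA ρ (g x) (h x)) V := by
      intro V g h hg hgd hhd
      have h3 : DifferentiableOn ℝ (fun x => fderiv ℝ ρ (g x)) V := hfd.comp hgd hg
      have h4 : DifferentiableOn ℝ (fun x => fderiv ℝ ρ (g x) (h x)) V := h3.clm_apply hhd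
      have h5 : DifferentiableOn ℝ (fun x => fderiv ℝ ρ (g x) (Complex.I • h x)) V :=
        h3.clm_apply (hhd.const_smul Complex.I)
      unfold cA
      exact (Complex.ofRealCLM.differentiable.comp_differentiableOn h4).sub
        ((Complex.ofRealCLM.differentiable.comp_differentiableOn h5).const_mul _)
    set U' := {z ∈ U | cA ρ z e ≠ 0} with hU'
    have hU'n : U' ∈ 𝓝 p := by
      have hc : ContinuousAt (fun z => cA ρ z e) p := by
        have : ContinuousAt (fderiv ℝ ρ) p := (hfd p hpU).continuousWithinAt.continuousAt (hU.mem_nhds hpU)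
        have h3 : ContinuousAt (fun z => fderiv ℝ ρ z e) p := this.clm_apply continuousAt_const
        have h4 : ContinuousAt (fun z => fderiv ℝ ρ z (Complex.I • e)) p := this.clm_apply continuousAt_const
        unfold cA
        exact (Complex.continuous_ofReal.continuousAt.comp h3).sub
          (continuousAt_const.mul (Complex.continuous_ofReal.continuousAt.comp h4))
      exact inter_mem (hU.mem_nhds hpU) (hc.eventually_ne he')
    refine ⟨U', hU'n, ?_⟩
    let ℓ : E → ℂ := fun h => cA ρ p h / cA ρ p e
    let hh : E × E → E := fun x => x.2 - ℓ x.2 • e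
    let vv : E × E → E := fun x => hh x - (cA ρ x.1 (hh x) / cA ρ x.1 e) • e
    let Ψ : E × E → E × E := fun x => (x.1 - ℓ x.2 • vv x, vv x)
    have hℓd : ∀ V : Set (E × E), DifferentiableOn ℝ (fun x : E × E => ℓ x.2) V := by
      intro V
      have := hcAd (V := V) (g := fun _ => p) (h := fun x => x.2) (fun _ _ => hpU) (differentiableOn_const p) differentiableOn_snd
      simp only [ℓ, div_eq_mul_inv]
      exact this.mul_const _
    have hΨ : DifferentiableOn ℝ Ψ ((frontier D ∩ U') ×ˢ univ) := by
      have hx : ∀ x ∈ (frontier D ∩ U') ×ˢ (univ : Set E), x.1 ∈ U := fun x hx => hx.1.2.1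
      have hhd : DifferentiableOn ℝ hh ((frontier D ∩ U') ×ˢ univ) :=
        differentiableOn_snd.sub ((hℓd _).smul_const e)
      have h3 := hcAd hx differentiableOn_fst hhd
      have h4 := hcAd hx differentiableOn_fst (differentiableOn_const e)
      have h5 : DifferentiableOn ℝ (fun x : E × E => cA ρ x.1 (hh x) / cA ρ x.1 e) ((frontier D ∩ U') ×ˢ univ) := by
        simp only [div_eq_mul_inv]
        exact h3.mul (h4.inv (fun x hx => hx.1.2.2))
      have hvv : DifferentiableOn ℝ vv ((frontier D ∩ U') ×ˢ univ) := hhd.sub (h5.smul_const e)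
      exact (differentiableOn_fst.sub ((hℓd _).smul hvv)).prodMk hvv
    have hz : (μ.prod μ) ((frontier D ∩ U') ×ˢ univ) = 0 :=
      measure_mono_null (prod_mono inter_subset_left subset_rfl) hnull
    refine measure_mono_null ?_ (addHaar_image_eq_zero_of_differentiableOn_of_addHaar_eq_zero (μ.prod μ) hΨ hz)
    rintro ⟨a, v⟩ ⟨ζ, ⟨hzF, hzU, hze⟩, hno⟩
    simp only at hzF hzU hze hno
    have hAv : cA ρ (a + ζ • v) v = 0 := by
      have h3 : ∀ θ : ℂ, fderiv ℝ ρ (a + ζ • v) (θ • v) ≤ 0 := fun θ => by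
        by_contra h
        exact hno θ (outDir_of_chart hU hρ h1 h2 hzU (not_le.1 h))
      have h4 : ∀ θ : ℂ, fderiv ℝ ρ (a + ζ • v) (θ • v) = 0 := fun θ => by
        refine le_antisymm (h3 θ) ?_
        have := h3 (-θ)
        rw [neg_smul, map_neg] at this
        linarith
      have h5 := h4 1
      rw [one_smul] at h5
      simp [cA, h4, h5]
    set z := a + ζ • v with hzdef
    have hℓadd : ∀ x y : E, ℓ (x + y) = ℓ x + ℓ y := fun x y => by simp only [ℓ, cA_add, add_div]
    have hℓsm : ∀ (c : ℂ) (x : E), ℓ (c • x) = c * ℓ x := fun c x => by simp only [ℓ, cA_smul, mul_div_assoc]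
    have hℓe : ℓ e = 1 := div_self he'
    set h0 := v + (-ℓ v) • e with hh0
    have hℓh0 : ℓ h0 = 0 := by rw [hh0, hℓadd, hℓsm, hℓe]; ring
    have hℓv' : ℓ (h0 + ζ • e) = ζ := by rw [hℓadd, hℓsm, hℓe, hℓh0]; ring
    have e1 : hh (z, h0 + ζ • e) = h0 := by simp only [hh, hℓv']; abel
    have e2 : vv (z, h0 + ζ • e) = v := by
      simp only [vv, e1]
      have : cA ρ z h0 / cA ρ z e = -ℓ v := by
        rw [hh0, cA_add, cA_smul, hAv, zero_add, mul_div_assoc, div_self hze, mul_one]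
      rw [this, hh0]; abel
    refine ⟨(z, h0 + ζ • e), ⟨⟨hzF, hzU, hze⟩, mem_univ _⟩, ?_⟩
    simp only [Ψ, e2, hℓv']
    rw [hzdef, add_sub_cancel_right]
  choose! U hU hUn using hloc
  obtain ⟨t, ht, htc⟩ := hF.elim_nhds_subcover U hU
  refine measure_mono_null ?_ ((measure_biUnion_null_iff t.countable_toSet).2 (fun p hp => hUn p (ht p hp)))
  rintro ⟨a, v⟩ hbad
  have hbad' : ¬ Good D a v := hbad
  unfold Good at hbad'
  push Not at hbad'
  obtain ⟨ζ, hζ, hno⟩ := hbad'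
  obtain ⟨p, hp, hpU⟩ := mem_iUnion₂.1 (htc hζ)
  exact mem_iUnion₂.2 ⟨p, hp, ζ, ⟨hζ, hpU⟩, hno⟩

theorem good_dense [FiniteDimensional ℝ E]
    {D : Set E} (hD : HasCkBoundary 2 D) (hF : IsCompact (frontier D)) {V : Set (E × E)} (hV : IsOpen V)
    (hne : V.Nonempty) : ∃ p ∈ V, Good D p.1 p.2 := by
  haveI : ProperSpace E := FiniteDimensional.proper_real E
  borelize E
  let μ : Measure E := Measure.addHaar
  by_contra h
  push Not at h
  have h1 : V ⊆ {p : E × E | ¬ Good D p.1 p.2} := h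
  have h2 := measure_mono_null h1 (bad_null μ hD hF)
  exact (hV.measure_pos (μ.prod μ) hne).ne' h2
end

section
variable {E : Type*} [NormedAddCommGroup E] [NormedSpace ℂ E]

theorem line_ev {F : Set E} (hF : IsCompact F) {a v : E} (hv : v ≠ 0) {P : E × E → ℂ → Prop}
    (h : ∀ ζ : ℂ, a + ζ • v ∈ F → ∀ᶠ q in 𝓝 (((a, v), ζ) : (E × E) × ℂ), P q.1 q.2) :
    ∀ᶠ q in 𝓝 ((a, v) : E × E), ∀ ζ : ℂ, q.1 + ζ • q.2 ∈ F → P q ζ := by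
  obtain ⟨R, hR⟩ := hF.isBounded.exists_norm_le
  have hvp : 0 < ‖v‖ := norm_pos_iff.2 hv
  set M := (R + ‖a‖ + 1) / (‖v‖ / 2) with hM
  have h1 := (isCompact_closedBall (0 : ℂ) M).eventually_forall_of_forall_eventually (x₀ := ((a, v) : E × E))
    (P := fun q ζ => q.1 + ζ • q.2 ∈ F → P q ζ) (by
      intro ζ _
      by_cases hζ : a + ζ • v ∈ F
      · filter_upwards [h ζ hζ] with q hq _ using hq
      · have hc : ContinuousAt (fun q : (E × E) × ℂ => q.1.1 + q.2 • q.1.2) ((a, v), ζ) := by fun_prop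
        filter_upwards [hc.eventually (hF.isClosed.isOpen_compl.mem_nhds hζ)] with q hq hq2
        exact absurd hq2 hq)
  have h2 : ∀ᶠ q in 𝓝 ((a, v) : E × E), ‖v‖ / 2 < ‖q.2‖ :=
    (continuous_snd.norm.continuousAt (x := ((a, v) : E × E))).eventually (lt_mem_nhds (by simp only; linarith))
  have h3 : ∀ᶠ q in 𝓝 ((a, v) : E × E), ‖q.1‖ < ‖a‖ + 1 :=
    (continuous_fst.norm.continuousAt (x := ((a, v) : E × E))).eventually (gt_mem_nhds (by simp only; linarith))
  filter_upwards [h1, h2, h3] with q h1 h2 h3 ζ hζ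
  refine h1 ζ ?_ hζ
  rw [mem_closedBall, dist_zero_right, hM, le_div_iff₀ (by positivity)]
  have h4 : ‖ζ • q.2‖ ≤ R + ‖a‖ + 1 := by
    have h5 := norm_sub_le (q.1 + ζ • q.2) q.1
    rw [add_sub_cancel_left] at h5
    linarith [hR _ hζ]
  rw [norm_smul] at h4
  have : ‖ζ‖ * (‖v‖ / 2) ≤ ‖ζ‖ * ‖q.2‖ := by gcongr
  linarith

theorem Good.eventually {D : Set E} (hF : IsCompact (frontier D)) {a v : E} (hv : v ≠ 0) (h : Good D a v) :
    ∀ᶠ q in 𝓝 ((a, v) : E × E), Good D q.1 q.2 := by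
  refine line_ev hF hv (P := fun q ζ => ∃ θ : ℂ, OutDir D (q.1 + ζ • q.2) (θ • q.2)) ?_
  intro ζ hζ
  obtain ⟨θ, hθ⟩ := h ζ hζ
  have hc : ContinuousAt (fun q : (E × E) × ℂ => ((q.1.1 + q.2 • q.1.2, θ • q.1.2) : E × E)) ((a, v), ζ) := by
    fun_prop
  filter_upwards [hc.eventually hθ.eventually] with q hq
  exact ⟨θ, hq⟩

theorem LX_eventually {D : Set E} (hF : IsCompact (frontier D)) {a v : E} (hv : v ≠ 0) {W : Set E} (hW : IsOpen W)
    (h : LX D a v ⊆ W) : ∀ᶠ q in 𝓝 ((a, v) : E × E), LX D q.1 q.2 ⊆ W := by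
  have := line_ev hF hv (P := fun q ζ => q.1 + ζ • q.2 ∈ W) (by
    intro ζ hζ
    have hc : ContinuousAt (fun q : (E × E) × ℂ => q.1.1 + q.2 • q.1.2) ((a, v), ζ) := by
      fun_prop
    exact hc.eventually (hW.mem_nhds (h ⟨hζ, ζ, rfl⟩)))
  filter_upwards [this] with q hq
  rintro z ⟨hz, ζ, rfl⟩
  exact hq ζ hz
end

end Slice
end

open Set Metric Bornology MvPolynomial
noncomputable section

namespace Slice
open Filter Topology

section
variable {E : Type*} [NormedAddCommGroup E] [NormedSpace ℂ E]

theorem holo_of_lines [FiniteDimensional ℂ E] {F : E → ℂ} {a : E} {r L : ℝ} (hr : 0 < r) (hL0 : 0 ≤ L)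
    (hL : ∀ x ∈ ball a r, ∀ y ∈ ball a r, ‖F x - F y‖ ≤ L * ‖x - y‖)
    (hline : ∀ b v : E, DifferentiableOn ℂ (fun w : ℂ => F (b + w • v)) {w | b + w • v ∈ ball a r}) :
    DifferentiableAt ℂ F a := by
  have hopen : ∀ b v : E, IsOpen {w : ℂ | b + w • v ∈ ball a r} := fun b v =>
    isOpen_ball.preimage (by fun_prop : Continuous fun w : ℂ => b + w • v)
  have hamem : a ∈ ball a r := mem_ball_self hr
  have hmem : ∀ (v : E) (w : ℂ), ‖w‖ * ‖v‖ < r → a + w • v ∈ ball a r := fun v w h => by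
    rw [mem_ball, dist_eq_norm, add_sub_cancel_left, norm_smul]; exact h
  let d : E → ℂ := fun v => deriv (fun w : ℂ => F (a + w • v)) 0
  have hd : ∀ v, HasDerivAt (fun w : ℂ => F (a + w • v)) (d v) 0 := fun v =>
    ((hline a v).differentiableAt ((hopen a v).mem_nhds (by simpa using hr))).hasDerivAt
  have hdsm : ∀ (c : ℂ) (v : E), d (c • v) = c * d v := by
    intro c v
    have h1 : (fun w : ℂ => F (a + w • (c • v))) = fun w : ℂ => (fun w : ℂ => F (a + w • v)) (c * w) := by
      funext w; simp only [smul_smul, mul_comm]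
    have h2 := deriv_comp_mul_left c (fun w : ℂ => F (a + w • v)) 0
    rw [← h1] at h2
    simpa [d] using h2
  have hdb : ∀ v, ‖d v‖ ≤ L * ‖v‖ := by
    intro v
    refine norm_deriv_le_of_lip' (by positivity) ?_
    filter_upwards [(hopen a v).mem_nhds (show (0 : ℂ) ∈ _ by simpa using hr)] with w hw
    have := hL _ hw a hamem
    rw [add_sub_cancel_left, norm_smul] at this
    simp only [zero_smul, add_zero, sub_zero]
    linarith
  have hdadd : ∀ u v, d (u + v) = d u + d v := by
    intro u v
    have hk : HasDerivAt (fun s : ℂ => F (a + s • (u + v)) - F (a + s • u) - F (a + s • v) + F a)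
        (d (u + v) - d u - d v) 0 := (((hd (u + v)).sub (hd u)).sub (hd v)).add_const _
    set ρ := r / (2 * (‖u‖ + ‖v‖ + 1)) with hρ
    have hρ0 : 0 < ρ := by positivity
    have hρr : ρ * (‖u‖ + ‖v‖ + 1) = r / 2 := by rw [hρ]; field_simp
    have hk2 : HasDerivAt (fun s : ℂ => F (a + s • (u + v)) - F (a + s • u) - F (a + s • v) + F a) 0 0 := by
      have hO : (fun s : ℂ => F (a + s • (u + v)) - F (a + s • u) - F (a + s • v) + F a)
          =O[𝓝 0] fun s : ℂ => ‖s - 0‖ ^ 2 := by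
        refine Asymptotics.IsBigO.of_bound (2 * L * ‖u‖ / ρ) ?_
        filter_upwards [ball_mem_nhds (0 : ℂ) hρ0] with s hs
        have hsρ : ‖s‖ < ρ := by simpa using hs
        have hm : ∀ y : ℂ, ‖y‖ < ρ → (a + s • u) + y • v ∈ ball a r ∧ a + y • v ∈ ball a r := by
          intro y hy
          have h1 : ‖s‖ * ‖u‖ ≤ ρ * ‖u‖ := by gcongr
          have h2 : ‖y‖ * ‖v‖ ≤ ρ * ‖v‖ := by gcongr
          have h0 : 0 ≤ ρ * ‖u‖ := by positivity
          constructor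
          · rw [mem_ball, dist_eq_norm, add_assoc, add_sub_cancel_left]
            have := norm_add_le (s • u) (y • v)
            rw [norm_smul, norm_smul] at this
            nlinarith
          · refine hmem v y ?_
            nlinarith
        have hb : ∀ y : ℂ, ‖y‖ < ρ → ‖F ((a + s • u) + y • v) - F (a + y • v)‖ ≤ L * (‖s‖ * ‖u‖) := by
          intro y hy
          have := hL _ (hm y hy).1 _ (hm y hy).2
          rwa [show (a + s • u) + y • v - (a + y • v) = s • u by abel, norm_smul] at this
        have hsch := Complex.dist_le_div_mul_dist_of_mapsTo_ball (R₁ := ρ) (R₂ := 2 * L * ‖u‖ * ‖s‖) (c := (0 : ℂ)) (z := s)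
          (f := fun y : ℂ => F ((a + s • u) + y • v) - F (a + y • v))
          (((hline (a + s • u) v).mono (fun y hy => (hm y (by simpa using hy)).1)).sub
            ((hline a v).mono (fun y hy => (hm y (by simpa using hy)).2)))
          (fun y hy => by
            have hy' : ‖y‖ < ρ := by simpa using hy
            rw [mem_closedBall, dist_eq_norm]
            refine (norm_sub_le _ _).trans ?_
            have h1 := hb y hy'
            have h2 := hb 0 (by simpa using hρ0)
            linarith) hs
        rw [dist_eq_norm, dist_zero_right] at hsch
        simp only [zero_smul, add_zero] at hsch
        have e : F (a + s • (u + v)) - F (a + s • u) - F (a + s • v) + F a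
            = F ((a + s • u) + s • v) - F (a + s • v) - (F (a + s • u) - F a) := by
          rw [smul_add, add_assoc]; ring
        rw [e]
        refine hsch.trans (le_of_eq ?_)
        rw [sub_zero, Real.norm_of_nonneg (by positivity)]
        ring
      have := (hO.hasFDerivAt (𝕜 := ℂ) (by norm_num)).hasDerivAt
      simpa using this
    have := hk.unique hk2
    linear_combination this
  let A : E →ₗ[ℂ] ℂ := { toFun := d, map_add' := hdadd, map_smul' := hdsm }
  have hA : HasFDerivAt F (LinearMap.toContinuousLinearMap A) a := by
    rw [hasFDerivAt_iff_isLittleO_nhds_zero]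
    have hO : (fun v => F (a + v) - F a - (LinearMap.toContinuousLinearMap A) v) =O[𝓝 0] fun v : E => ‖v‖ ^ 2 := by
      refine Asymptotics.IsBigO.of_bound (2 * L / r) ?_
      filter_upwards [ball_mem_nhds (0 : E) hr] with v hv
      have hvr : ‖v‖ < r := by simpa using hv
      rw [Real.norm_of_nonneg (by positivity)]
      change ‖F (a + v) - F a - d v‖ ≤ _
      rcases eq_or_ne v 0 with rfl | hv0
      · have : d 0 = 0 := A.map_zero
        simp [this]
      have hvp : 0 < ‖v‖ := norm_pos_iff.2 hv0
      have hR1 : ∀ w : ℂ, w ∈ ball (0 : ℂ) (r / ‖v‖) → ‖w‖ * ‖v‖ < r := fun w hw => by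
        rw [mem_ball, dist_zero_right, lt_div_iff₀ hvp] at hw; exact hw
      have hsch := Complex.dist_le_mul_div_pow_of_mapsTo_ball_of_isLittleO (R₁ := r / ‖v‖) (R₂ := 2 * L * r) (c := (0 : ℂ))
        (z := 1) (n := 1) (f := fun w : ℂ => F (a + w • v) - w * d v)
        (((hline a v).mono (fun w hw => hmem v w (hR1 w hw))).sub (by fun_prop))
        (fun w hw => by
          rw [mem_closedBall, dist_eq_norm]
          have h1 := hL _ (hmem v w (hR1 w hw)) a hamem
          rw [add_sub_cancel_left, norm_smul] at h1
          have h2 : ‖w * d v‖ ≤ L * (‖w‖ * ‖v‖) := by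
            rw [norm_mul]; nlinarith [hdb v, norm_nonneg w]
          have h3 : L * (‖w‖ * ‖v‖) ≤ L * r := by gcongr; exact (hR1 w hw).le
          have e : F (a + w • v) - w * d v - (F (a + (0 : ℂ) • v) - 0 * d v) = (F (a + w • v) - F a) - w * d v := by
            simp; ring
          rw [e]
          refine (norm_sub_le _ _).trans ?_
          linarith)
        (by
          have h1 := (hasDerivAt_iff_isLittleO.1 (hd v))
          simp only [zero_smul, add_zero, sub_zero, zero_mul, smul_eq_mul, pow_one] at h1 ⊢
          refine (h1.congr_left (fun w => by ring)).norm_right)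
        (by rw [mem_ball, dist_zero_right, norm_one, lt_div_iff₀ hvp]; linarith)
      rw [dist_eq_norm] at hsch
      simp only [one_smul, one_mul, zero_smul, add_zero, zero_mul, sub_zero, dist_zero_right, norm_one] at hsch
      rw [show F (a + v) - F a - d v = F (a + v) - d v - F a by ring]
      refine hsch.trans (le_of_eq ?_)
      rw [one_div_div, div_pow]
      field_simp
    exact hO.trans_isLittleO (by
      have := Asymptotics.isLittleO_norm_pow_id (E' := E) (n := 2) (by norm_num)
      simpa using this)
  exact hA.differentiableAt

end

end Slice
end

open Set Metric Bornology MvPolynomial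
noncomputable section

namespace Slice
open Filter Topology

section
variable {E : Type*} [NormedAddCommGroup E] [NormedSpace ℂ E]

theorem lip_of_dense {Dd A : Set E} {H : E → ℂ} {P : E → E → Prop}
    (hP : ∀ (x v : E) (Q : E × E → Prop), (∀ᶠ q in 𝓝 ((x, v) : E × E), Q q) → ∃ q, Q q ∧ P q.1 q.2)
    (hH : ∀ x ∈ A, ContinuousAt H x)
    (hl : ∀ b v : E, v ≠ 0 → P b v → DifferentiableOn ℂ (fun w : ℂ => H (b + w • v)) {w | b + w • v ∈ Dd})
    {R : ℝ} (hb : ∀ (b v : E) (w : ℂ), v ≠ 0 → P b v → b + w • v ∈ Dd → ‖H (b + w • v)‖ ≤ R)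
    {a : E} {r : ℝ} (hr : 0 < r) (hball : ball a (3 * r) ⊆ Dd) :
    ∀ x ∈ A ∩ ball a r, ∀ y ∈ A ∩ ball a r, ‖H x - H y‖ ≤ R / r * ‖x - y‖ := by
  intro x hx y hy
  by_contra hcon
  push Not at hcon
  have hxy : y - x ≠ 0 := by
    intro h
    rw [sub_eq_zero.1 h] at hcon
    simp at hcon
  have hc1 : Tendsto (fun q : E × E => H q.1) (𝓝 (x, y - x)) (𝓝 (H x)) :=
    (hH x hx.1).tendsto.comp (continuous_fst.tendsto' _ _ rfl)
  have hc2 : Tendsto (fun q : E × E => H (q.1 + q.2)) (𝓝 (x, y - x)) (𝓝 (H y)) :=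
    (hH y hy.1).tendsto.comp ((continuous_fst.add continuous_snd).tendsto' _ _ (by simp))
  have hc3 : Tendsto (fun q : E × E => ‖H q.1 - H (q.1 + q.2)‖) (𝓝 (x, y - x)) (𝓝 ‖H x - H y‖) := (hc1.sub hc2).norm
  have hc4 : Tendsto (fun q : E × E => R / r * ‖q.2‖) (𝓝 (x, y - x)) (𝓝 (R / r * ‖x - y‖)) := by
    have : Continuous fun q : E × E => R / r * ‖q.2‖ := by fun_prop
    refine this.tendsto' _ _ ?_
    simp only [norm_sub_rev]
  have e1 := hc4.eventually_lt hc3 hcon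
  have e2 : ∀ᶠ q in 𝓝 ((x, y - x) : E × E), q.1 ∈ ball a r :=
    continuous_fst.continuousAt.eventually (isOpen_ball.mem_nhds hx.2)
  have e3 : ∀ᶠ q in 𝓝 ((x, y - x) : E × E), q.1 + q.2 ∈ ball a r :=
    (continuous_fst.add continuous_snd).continuousAt.eventually (isOpen_ball.mem_nhds (by simpa using hy.2))
  have e4 : ∀ᶠ q in 𝓝 ((x, y - x) : E × E), q.2 ≠ 0 :=
    (continuous_snd.tendsto' _ _ rfl).eventually_ne hxy
  obtain ⟨⟨b, v⟩, ⟨⟨h1, h2⟩, h3, h4⟩, h5⟩ := hP x (y - x) _ ((e1.and e2).and (e3.and e4))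
  simp only at h1 h2 h3 h4 h5
  have hvp : 0 < ‖v‖ := norm_pos_iff.2 h4
  have hv2 : ‖v‖ < 2 * r := by
    have h6 : ‖(b + v - a) - (b - a)‖ ≤ ‖b + v - a‖ + ‖b - a‖ := norm_sub_le _ _
    rw [show (b + v - a) - (b - a) = v by abel] at h6
    rw [mem_ball, dist_eq_norm] at h2 h3
    linarith
  have hsub : ∀ w ∈ ball (0 : ℂ) (2 * r / ‖v‖), b + w • v ∈ Dd := by
    intro w hw
    rw [mem_ball, dist_zero_right, lt_div_iff₀ hvp, ← norm_smul] at hw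
    apply hball
    rw [mem_ball, dist_eq_norm] at h2 ⊢
    have := norm_add_le (b - a) (w • v)
    rw [show b - a + w • v = b + w • v - a by abel] at this
    linarith
  have hsch := Complex.dist_le_div_mul_dist_of_mapsTo_ball (R₁ := 2 * r / ‖v‖) (R₂ := 2 * R) (c := (0 : ℂ)) (z := 1)
    (f := fun w : ℂ => H (b + w • v)) ((hl b v h4 h5).mono hsub)
    (fun w hw => by
      rw [mem_closedBall, dist_eq_norm]
      refine (norm_sub_le _ _).trans ?_
      have h6 := hb b v w h4 h5 (hsub w hw)
      have h7 := hb b v 0 h4 h5 (hsub 0 (mem_ball_self (by positivity)))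
      linarith)
    (by rw [mem_ball, dist_zero_right, norm_one, lt_div_iff₀ hvp]; linarith)
  rw [dist_eq_norm, norm_sub_rev] at hsch
  simp only [one_smul, zero_smul, add_zero, dist_zero_right, norm_one, mul_one] at hsch
  have : 2 * R / (2 * r / ‖v‖) = R / r * ‖v‖ := by field_simp
  linarith

theorem holo_lines_limit {Dd : Set E} {H : E → ℂ} {P : E → E → Prop}
    (hP : ∀ (x v : E) (Q : E × E → Prop), (∀ᶠ q in 𝓝 ((x, v) : E × E), Q q) → ∃ q, Q q ∧ P q.1 q.2)
    (hl : ∀ b v : E, v ≠ 0 → P b v → DifferentiableOn ℂ (fun w : ℂ => H (b + w • v)) {w | b + w • v ∈ Dd})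
    {a : E} {r L : ℝ} (hr : 0 < r) (hball : ball a (2 * r) ⊆ Dd)
    (hL0 : 0 ≤ L) (hL : ∀ x ∈ ball a (2 * r), ∀ y ∈ ball a (2 * r), ‖H x - H y‖ ≤ L * ‖x - y‖) (b v : E) :
    DifferentiableOn ℂ (fun w : ℂ => H (b + w • v)) {w | b + w • v ∈ ball a r} := by
  rcases eq_or_ne v 0 with rfl | hv
  · simp only [smul_zero, add_zero]
    exact differentiableOn_const _
  have hvp : 0 < ‖v‖ := norm_pos_iff.2 hv
  set M := (r + ‖b - a‖) / ‖v‖ with hM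
  have hM0 : 0 ≤ M := by positivity
  have hMb : ∀ w : ℂ, b + w • v ∈ ball a r → ‖w‖ ≤ M := by
    intro w hw
    rw [hM, le_div_iff₀ hvp, ← norm_smul]
    rw [mem_ball, dist_eq_norm] at hw
    have := norm_sub_le (b + w • v - a) (b - a)
    rw [show b + w • v - a - (b - a) = w • v by abel] at this
    linarith
  have hseq : ∀ n : ℕ, ∃ q : E × E, ((‖q.1 - b‖ + M * ‖q.2 - v‖ < r * (1 / ((n : ℝ) + 1))) ∧ q.2 ≠ 0) ∧ P q.1 q.2 := by
    intro n
    refine hP b v _ (Filter.Eventually.and ?_ ?_)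
    · have : Continuous fun q : E × E => ‖q.1 - b‖ + M * ‖q.2 - v‖ := by fun_prop
      refine (this.tendsto' (b, v) 0 (by simp)).eventually (gt_mem_nhds ?_)
      positivity
    · exact (continuous_snd.tendsto' _ _ rfl).eventually_ne hv
  choose q hq hqP using hseq
  have hdist : ∀ n : ℕ, ∀ w : ℂ, b + w • v ∈ ball a r →
      ‖(b + w • v) - ((q n).1 + w • (q n).2)‖ < r * (1 / ((n : ℝ) + 1)) := by
    intro n w hw
    refine lt_of_le_of_lt ?_ (hq n).1
    have e : (b + w • v) - ((q n).1 + w • (q n).2) = -((q n).1 - b) - w • ((q n).2 - v) := by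
      rw [smul_sub]; abel
    rw [e]
    refine (norm_sub_le _ _).trans ?_
    rw [norm_neg, norm_smul]
    have := hMb w hw
    gcongr
  have hone : ∀ n : ℕ, 1 / ((n : ℝ) + 1) ≤ 1 := fun n => by
    rw [div_le_one (by positivity)]
    have : (0 : ℝ) ≤ n := n.cast_nonneg
    linarith
  have hmem : ∀ n : ℕ, ∀ w : ℂ, b + w • v ∈ ball a r → (q n).1 + w • (q n).2 ∈ ball a (2 * r) := by
    intro n w hw
    have h1 := hdist n w hw
    have h2 : r * (1 / ((n : ℝ) + 1)) ≤ r * 1 := by gcongr; exact hone n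
    rw [mem_ball, dist_eq_norm] at hw ⊢
    have h3 := norm_sub_le (b + w • v - a) ((b + w • v) - ((q n).1 + w • (q n).2))
    rw [show b + w • v - a - ((b + w • v) - ((q n).1 + w • (q n).2)) = (q n).1 + w • (q n).2 - a by abel] at h3
    linarith
  have hU : IsOpen {w : ℂ | b + w • v ∈ ball a r} :=
    isOpen_ball.preimage (by fun_prop : Continuous fun w : ℂ => b + w • v)
  have hlim : TendstoUniformlyOn (fun (n : ℕ) (w : ℂ) => H ((q n).1 + w • (q n).2)) (fun w : ℂ => H (b + w • v)) atTop
      {w : ℂ | b + w • v ∈ ball a r} := by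
    rw [Metric.tendstoUniformlyOn_iff]
    intro ε hε
    have ht : Tendsto (fun n : ℕ => L * (r * (1 / ((n : ℝ) + 1)))) atTop (𝓝 0) := by
      have := (tendsto_one_div_add_atTop_nhds_zero_nat (𝕜 := ℝ)).const_mul (L * r)
      simpa [mul_assoc] using this
    filter_upwards [ht.eventually (gt_mem_nhds hε)] with n hn w hw
    rw [dist_eq_norm]
    refine lt_of_le_of_lt ?_ hn
    refine (hL _ (ball_subset_ball (by linarith) hw) _ (hmem n w hw)).trans ?_
    gcongr
    exact (hdist n w hw).le
  refine hlim.tendstoLocallyUniformlyOn.differentiableOn (Eventually.of_forall fun n => ?_) hU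
  exact (hl _ _ (hq n).2 (hqP n)).mono fun w hw => hball (hmem n w hw)
end

variable {N : ℕ} {D : Set (EuclideanSpace ℂ (Fin N))} {f : EuclideanSpace ℂ (Fin N) → ℂ}

theorem Setup.bdry_est (S : Setup D f) {b0 u : EuclideanSpace ℂ (Fin N)} (hb0 : b0 ∈ frontier D) (hu : OutDir D b0 u)
    {η : ℝ} (hη : 0 < η) :
    ∃ ε > 0, ∀ p ∈ D, dist p b0 < ε → ∀ u', dist u' u < ε → u' ≠ 0 → ∀ l ∈ SS D f (LX D p u') p, ‖l - f b0‖ ≤ η := by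
  obtain ⟨δ, hδ, hout⟩ := hu
  obtain ⟨R, hR⟩ := S.hFc.exists_bound_of_continuousOn S.hf.continuousOn
  have hR0 : 0 ≤ R := (norm_nonneg _).trans (hR b0 hb0)
  set m := ‖u‖ + δ with hm
  have hm0 : 0 < m := by positivity
  set κ := δ / (4 * m) with hκ
  have hκ0 : 0 < κ := by positivity
  obtain ⟨τ, hτ, hfτ⟩ := Metric.continuousAt_iff.1 (S.hf.continuousAt (x := b0)) (η * κ) (by positivity)
  -- bound for s
  set σ := min δ (min (τ / (2 * m)) (η * τ / (2 * m * (2 * R + 1)))) with hσ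
  have hσ0 : 0 < σ := by positivity
  refine ⟨min (δ / 4) (σ * δ / 2), by positivity, fun p hp hpb u' hu' hu0 l hl => ?_⟩
  have hpb1 : dist p b0 < σ * δ / 2 := hpb.trans_le (min_le_right _ _)
  have hu1 : dist u' u < δ / 4 := hu'.trans_le (min_le_left _ _)
  have hpne : 0 < dist p b0 := by
    rw [dist_pos]
    rintro rfl
    rw [S.hDo.frontier_eq] at hb0
    exact hb0.2 hp
  set s := 2 * dist p b0 / δ with hs
  have hs0 : 0 < s := by positivity
  have hsσ : s < σ := by
    rw [hs, div_lt_iff₀ hδ]; linarith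
  have hdp : dist p b0 = s * δ / 2 := by rw [hs]; field_simp
  have hsδ : s < δ := hsσ.trans_le (min_le_left _ _)
  have hs2 : s < τ / (2 * m) := hsσ.trans_le ((min_le_right _ _).trans (min_le_left _ _))
  have hs3 : s < η * τ / (2 * m * (2 * R + 1)) := hsσ.trans_le ((min_le_right _ _).trans (min_le_right _ _))
  have hu'm : ‖u'‖ ≤ m := by
    rw [dist_eq_norm] at hu1
    have := norm_sub_norm_le u' u
    linarith
  have hball : ∀ x, dist x (b0 + (s : ℂ) • u) < s * δ → x ∉ closure D := by
    intro x hx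
    have h1 := hout b0 hb0 (by simpa using hδ) s hs0 hsδ (u + ((s : ℂ)⁻¹) • (x - (b0 + (s : ℂ) • u))) (by
      rw [dist_eq_norm, add_sub_cancel_left, norm_smul, norm_inv, Complex.norm_real, Real.norm_of_nonneg hs0.le,
        ← dist_eq_norm, inv_mul_lt_iff₀ hs0]
      exact hx)
    have hsc : (s : ℂ) ≠ 0 := by exact_mod_cast hs0.ne'
    rw [smul_add, smul_smul, mul_inv_cancel₀ hsc, one_smul] at h1
    convert h1 using 1
    abel
  have hcd : dist (p + (s : ℂ) • u') (b0 + (s : ℂ) • u) < s * (3 * δ / 4) := by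
    calc dist (p + (s : ℂ) • u') (b0 + (s : ℂ) • u) ≤ dist p b0 + dist ((s : ℂ) • u') ((s : ℂ) • u) := dist_add_add_le _ _ _ _
      _ = s * δ / 2 + s * dist u' u := by
        rw [dist_smul₀, hdp, Complex.norm_real, Real.norm_of_nonneg hs0.le]
      _ < s * δ / 2 + s * (δ / 4) := by gcongr
      _ = s * (3 * δ / 4) := by ring
  have hsn : ‖(s : ℂ)‖ = s := by rw [Complex.norm_real, Real.norm_of_nonneg hs0.le]
  refine S.line_D0 hu0 hp hl (c := (s : ℂ)) (hball _ (hcd.trans (by nlinarith))) hη ?_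
  intro x hx
  rw [hsn]
  have hxs : dist (p + x • u') (p + (s : ℂ) • u') = ‖x - s‖ * ‖u'‖ := by
    rw [dist_add_left, dist_eq_norm, ← sub_smul, norm_smul]
  have hxs2 : ‖x - s‖ * ‖u'‖ ≤ ‖x - s‖ * m := by gcongr
  by_cases hz : dist (p + x • u') b0 < τ
  · have h1 := (hfτ hz).le
    rw [dist_eq_norm] at h1
    have h2 : s * δ ≤ dist (p + x • u') (b0 + (s : ℂ) • u) := by
      by_contra h
      exact hball _ (not_le.1 h) (frontier_subset_closure hx)
    have h3 := dist_triangle (p + x • u') (p + (s : ℂ) • u') (b0 + (s : ℂ) • u)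
    have h4 : s * δ / 4 ≤ ‖x - s‖ * m := by nlinarith
    have h5 : κ * s ≤ ‖x - s‖ := by
      rw [hκ, div_mul_eq_mul_div, div_le_iff₀ (by positivity)]
      nlinarith
    calc ‖f (p + x • u') - f b0‖ * s ≤ (η * κ) * s := by gcongr
      _ = η * (κ * s) := by ring
      _ ≤ η * ‖x - s‖ := by gcongr
  · push Not at hz
    have h1 : ‖f (p + x • u') - f b0‖ ≤ 2 * R + 1 := by
      refine (norm_sub_le _ _).trans ?_
      linarith [hR _ hx, hR _ hb0]
    have h2 : dist (p + (s : ℂ) • u') b0 ≤ s * m := by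
      have h6 : dist (p + (s : ℂ) • u') b0 ≤ ‖p - b0‖ + ‖(s : ℂ) • u'‖ := by
        rw [dist_eq_norm, show p + (s : ℂ) • u' - b0 = (p - b0) + (s : ℂ) • u' by abel]
        exact norm_add_le _ _
      have h7 : ‖u'‖ ≤ ‖u‖ + δ / 4 := by
        rw [dist_eq_norm] at hu1
        have := norm_sub_norm_le u' u
        linarith
      rw [← dist_eq_norm, hdp, norm_smul, hsn] at h6
      have : s * ‖u'‖ ≤ s * (‖u‖ + δ / 4) := by gcongr
      rw [hm]
      nlinarith
    have h3 := dist_triangle (p + x • u') (p + (s : ℂ) • u') b0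
    have h4 : s * m < τ / 2 := by
      rw [lt_div_iff₀ (by positivity)] at hs2
      linarith
    have h5 : τ / 2 ≤ ‖x - s‖ * m := by linarith
    rw [lt_div_iff₀ (by positivity)] at hs3
    have h6 : m * ((2 * R + 1) * s) ≤ m * (η * ‖x - s‖) := by nlinarith
    have h7 := le_of_mul_le_mul_left h6 hm0
    refine le_trans ?_ h7
    gcongr

end Slice
end

open Set Metric Bornology MvPolynomial
noncomputable section

namespace Slice
open Filter Topology

variable {N : ℕ} {D : Set (EuclideanSpace ℂ (Fin N))} {f : EuclideanSpace ℂ (Fin N) → ℂ}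

theorem Setup.extend (S : Setup D f) (hD : HasCkBoundary 2 D) :
    ∃ H : EuclideanSpace ℂ (Fin N) → ℂ, ContinuousOn H (closure D) ∧ DifferentiableOn ℂ H D ∧
      ∀ z ∈ frontier D, H z = f z := by
  have hP : ∀ (x v : EuclideanSpace ℂ (Fin N)) (Q : EuclideanSpace ℂ (Fin N) × EuclideanSpace ℂ (Fin N) → Prop),
      (∀ᶠ q in 𝓝 ((x, v) : EuclideanSpace ℂ (Fin N) × EuclideanSpace ℂ (Fin N)), Q q) →
      ∃ q, Q q ∧ Good D q.1 q.2 := by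
    intro x v Q hQ
    obtain ⟨V, hVQ, hVo, hV⟩ := _root_.mem_nhds_iff.1 hQ
    obtain ⟨p, hp, hg⟩ := good_dense hD S.hFc hVo ⟨_, hV⟩
    exact ⟨p, hVQ hp, hg⟩
  obtain ⟨R, hR⟩ := S.hFc.exists_bound_of_continuousOn S.hf.continuousOn
  have hvalue : ∀ a, ∃ l : ℂ, a ∈ D → ∀ v, v ≠ 0 → Good D a v → SS D f (LX D a v) a = {l} := by
    intro a
    by_cases h : ∃ v, v ≠ 0 ∧ Good D a v ∧ a ∈ D
    · obtain ⟨v, hv, hg, ha⟩ := h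
      have key : ∀ v, v ≠ 0 → Good D a v → ∃ l, SS D f (LX D a v) a = {l} := by
        intro v hv hg
        obtain ⟨G, -, hG⟩ := S.line hv hg
        have := hG 0 (by simpa using ha)
        rw [zero_smul, add_zero] at this
        exact ⟨_, this⟩
      obtain ⟨l, hl⟩ := key v hv hg
      refine ⟨l, fun _ v' hv' hg' => ?_⟩
      obtain ⟨l', hl'⟩ := key v' hv' hg'
      rw [hl', S.consist' hv hv' ha hg hg' hl hl']
    · exact ⟨0, fun ha v hv hg => absurd ⟨v, hv, hg, ha⟩ h⟩
  choose F hF using hvalue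
  have hDp : ∃ Dp : Set (EuclideanSpace ℂ (Fin N)), Dp = {a | a ∈ D ∧ ∃ v, v ≠ 0 ∧ Good D a v} := ⟨_, rfl⟩
  obtain ⟨Dp, hDp⟩ := hDp
  have hmemDp : ∀ a v, a ∈ D → v ≠ 0 → Good D a v → a ∈ Dp := fun a v ha hv hg => by
    rw [hDp]; exact ⟨ha, v, hv, hg⟩
  have hDpD : Dp ⊆ D := by rw [hDp]; exact fun a ha => ha.1
  have hbound : ∀ a ∈ Dp, ‖F a‖ ≤ R := by
    intro a ha
    rw [hDp] at ha
    obtain ⟨ha, v, hv, hg⟩ := ha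
    have : F a ∈ SS D f (LX D a v) a := by rw [hF a ha v hv hg]; rfl
    exact SS_bound this (fun z hz => hR z (LX_sub D a v hz))
  have hcont : ∀ a ∈ Dp, ContinuousAt F a := by
    intro a ha
    rw [hDp] at ha
    obtain ⟨ha, v, hv, hg⟩ := ha
    rw [Metric.continuousAt_iff']
    intro ε hε
    obtain ⟨W, hW, hXW, hev⟩ := SS_usc S.hFc S.hf.continuousOn (X0 := LX D a v) (LX_sub D a v) (subset_closure ha)
      (hF a ha v hv hg).subset hε
    have hpr : Tendsto (fun a' : EuclideanSpace ℂ (Fin N) => (a', v)) (𝓝 a) (𝓝 (a, v)) :=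
      (Continuous.prodMk_left v).tendsto' _ _ rfl
    filter_upwards [hev, hpr.eventually (LX_eventually S.hFc hv hW hXW), hpr.eventually (hg.eventually S.hFc hv),
      S.hDo.mem_nhds ha] with a' h1 h2 h3 h4
    rw [dist_eq_norm]
    refine h1 _ h2 (LX_sub D a' v) (F a') ?_
    rw [hF a' h4 v hv h3]; rfl
  have hlineD : ∀ (b v : EuclideanSpace ℂ (Fin N)) (w : ℂ), v ≠ 0 → Good D b v → b + w • v ∈ D → b + w • v ∈ Dp :=
    fun b v w hv hg hw => hmemDp _ v hw hv (hg.shift w)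
  have hline : ∀ b v : EuclideanSpace ℂ (Fin N), v ≠ 0 → Good D b v →
      DifferentiableOn ℂ (fun w : ℂ => F (b + w • v)) {w | b + w • v ∈ D} := by
    intro b v hv hg
    obtain ⟨G, hGd, hG⟩ := S.line hv hg
    refine hGd.congr fun w hw => ?_
    have h1 := hF _ hw v hv (hg.shift w)
    rw [LX_shift, hG w hw] at h1
    exact (singleton_eq_singleton_iff.1 h1).symm
  have hDpcl : closure D ⊆ closure Dp := by
    refine closure_minimal ?_ isClosed_closure
    intro x hx
    rw [mem_closure_iff_nhds]
    intro t ht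
    by_cases hN : ∃ v : EuclideanSpace ℂ (Fin N), v ≠ 0
    · obtain ⟨v, hv⟩ := hN
      obtain ⟨q, ⟨h1, h2⟩, h3⟩ := hP x v (fun q => q.1 ∈ t ∩ D ∧ q.2 ≠ 0) (by
        refine Filter.Eventually.and ?_ ?_
        · exact (continuous_fst.tendsto' ((x, v) : EuclideanSpace ℂ (Fin N) × EuclideanSpace ℂ (Fin N)) x rfl).eventually
            (inter_mem ht (S.hDo.mem_nhds hx))
        · exact (continuous_snd.tendsto' _ _ rfl).eventually_ne hv)
      exact ⟨q.1, h1.1, hmemDp _ _ h1.2 h2 h3⟩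
    · exfalso
      push Not at hN
      obtain ⟨i, i', hii, -⟩ := S.hA
      have h1 := congrArg (fun y : EuclideanSpace ℂ (Fin N) => y i) (hN (EuclideanSpace.single i 1))
      simp at h1
  have hR0 : ∀ a ∈ D, 0 ≤ R := fun a ha => by
    obtain ⟨x, hx⟩ : Dp.Nonempty := closure_nonempty_iff.1 ⟨a, hDpcl (subset_closure ha)⟩
    exact (norm_nonneg _).trans (hbound x hx)
  have hrad : ∀ a ∈ D, ∃ r, 0 < r ∧ ball a (6 * r) ⊆ D := by
    intro a ha
    obtain ⟨ε, hε, h⟩ := Metric.isOpen_iff.1 S.hDo a ha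
    exact ⟨ε / 6, by positivity, by convert h using 2; ring⟩
  have hlimD : ∀ a ∈ D, ∃ y, Tendsto F (𝓝[Dp] a) (𝓝 y) := by
    intro a ha
    obtain ⟨r, hr, hball⟩ := hrad a ha
    have hlip := lip_of_dense (Dd := D) (A := Dp) (H := F) hP hcont hline
      (fun b v w hv hg hw => hbound _ (hlineD b v w hv hg hw)) hr
      ((ball_subset_ball (by linarith)).trans hball)
    have hne : (𝓝[Dp] a).NeBot := mem_closure_iff_nhdsWithin_neBot.1 (hDpcl (subset_closure ha))
    have hR' := hR0 a ha
    rw [← cauchy_map_iff_exists_tendsto]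
    rw [Metric.cauchy_iff]
    refine ⟨hne.map _, fun ε hε => ?_⟩
    set ε' := min r (ε / (4 * (R / r + 1))) with hε'
    have hε'0 : 0 < ε' := by positivity
    refine ⟨F '' (Dp ∩ ball a ε'), image_mem_map (inter_mem self_mem_nhdsWithin
      (mem_nhdsWithin_of_mem_nhds (ball_mem_nhds a hε'0))), ?_⟩
    rintro _ ⟨x, hx, rfl⟩ _ ⟨y, hy, rfl⟩
    have hsub : ball a ε' ⊆ ball a r := ball_subset_ball (min_le_left _ _)
    have h1 := hlip x ⟨hx.1, hsub hx.2⟩ y ⟨hy.1, hsub hy.2⟩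
    have h2 : ‖x - y‖ ≤ 2 * ε' := by
      rw [← dist_eq_norm]
      have := dist_triangle_right x y a
      have h3 := hx.2; have h4 := hy.2
      rw [mem_ball] at h3 h4
      linarith
    have h3 : ε' * (4 * (R / r + 1)) ≤ ε := by
      rw [← le_div_iff₀ (by positivity)]; exact min_le_right _ _
    have h4 : R / r * ‖x - y‖ ≤ R / r * (2 * ε') := by gcongr
    have h5 : 0 ≤ R / r := by positivity
    rw [dist_eq_norm]
    nlinarith
  have hlimF : ∀ b ∈ frontier D, Tendsto F (𝓝[Dp] b) (𝓝 (f b)) := by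
    intro b hb
    obtain ⟨u, hu⟩ := frontier_outDir hD hb
    have hu0 : u ≠ 0 := by
      rintro rfl
      obtain ⟨δ, hδ, h⟩ := hu
      refine h b hb (by simpa using hδ) (δ / 2) (by positivity) (by linarith) 0 (by simpa using hδ) ?_
      simpa using frontier_subset_closure hb
    rw [Metric.tendsto_nhds]
    intro ε hε
    obtain ⟨e, he, hest⟩ := S.bdry_est hb hu (η := ε / 4) (by positivity)
    filter_upwards [self_mem_nhdsWithin, mem_nhdsWithin_of_mem_nhds (ball_mem_nhds b he)] with p hp hpb
    obtain ⟨q, ⟨⟨h1, h2⟩, ⟨h3, h4⟩, h5⟩, hg⟩ := hP p u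
      (fun q => (q.1 ∈ D ∧ dist q.1 b < e) ∧ (dist q.2 u < e ∧ q.2 ≠ 0) ∧ dist (F q.1) (F p) < ε / 4) (by
      have hfst : Tendsto (fun q : EuclideanSpace ℂ (Fin N) × EuclideanSpace ℂ (Fin N) => q.1) (𝓝 (p, u)) (𝓝 p) :=
        continuous_fst.tendsto' _ _ rfl
      have hsnd : Tendsto (fun q : EuclideanSpace ℂ (Fin N) × EuclideanSpace ℂ (Fin N) => q.2) (𝓝 (p, u)) (𝓝 u) :=
        continuous_snd.tendsto' _ _ rfl
      refine Filter.Eventually.and (Filter.Eventually.and ?_ ?_) (Filter.Eventually.and (Filter.Eventually.and ?_ ?_) ?_)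
      · exact hfst.eventually (S.hDo.mem_nhds (hDpD hp))
      · exact hfst.eventually (isOpen_ball.mem_nhds hpb)
      · exact hsnd.eventually (ball_mem_nhds u he)
      · exact hsnd.eventually_ne hu0
      · exact hfst.eventually ((hcont p hp).eventually (ball_mem_nhds _ (by positivity))))
    have h6 := hest q.1 h1 h2 q.2 h3 h4 (F q.1) (by rw [hF q.1 h1 q.2 h4 hg]; rfl)
    have h7 := dist_triangle_left (F p) (f b) (F q.1)
    rw [← dist_eq_norm] at h6
    linarith
  have hHc : ContinuousOn (extendFrom Dp F) (closure D) := by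
    refine continuousOn_extendFrom hDpcl fun x hx => ?_
    rw [closure_eq_self_union_frontier] at hx
    rcases hx with hx | hx
    · exact hlimD x hx
    · exact ⟨_, hlimF x hx⟩
  have hHF : ∀ x ∈ Dp, extendFrom Dp F x = F x := fun x hx =>
    extendFrom_eq (subset_closure hx) ((hcont x hx).tendsto.mono_left nhdsWithin_le_nhds)
  refine ⟨extendFrom Dp F, hHc, ?_, fun z hz => extendFrom_eq (hDpcl (frontier_subset_closure hz)) (hlimF z hz)⟩
  generalize extendFrom Dp F = H at hHc hHF
  have hHcont : ∀ x ∈ D, ContinuousAt H x := fun x hx =>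
    hHc.continuousAt (mem_of_superset (S.hDo.mem_nhds hx) subset_closure)
  have hHline : ∀ b v : EuclideanSpace ℂ (Fin N), v ≠ 0 → Good D b v →
      DifferentiableOn ℂ (fun w : ℂ => H (b + w • v)) {w | b + w • v ∈ D} := fun b v hv hg =>
    (hline b v hv hg).congr fun w hw => hHF _ (hlineD b v w hv hg hw)
  intro a ha
  obtain ⟨r, hr, hball⟩ := hrad a ha
  have hlip := lip_of_dense (Dd := D) (A := D) (H := H) hP hHcont hHline
      (fun b v w hv hg hw => by
        rw [hHF _ (hlineD b v w hv hg hw)]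
        exact hbound _ (hlineD b v w hv hg hw)) (r := 2 * r) (by positivity)
      ((ball_subset_ball (by linarith)).trans hball)
  have hb2 : ball a (2 * r) ⊆ D := (ball_subset_ball (by linarith)).trans hball
  have hL0 : 0 ≤ R / (2 * r) := div_nonneg (hR0 a ha) (by positivity)
  have hlip' : ∀ x ∈ ball a (2 * r), ∀ y ∈ ball a (2 * r), ‖H x - H y‖ ≤ R / (2 * r) * ‖x - y‖ := fun x hx y hy =>
    hlip x ⟨hb2 hx, hx⟩ y ⟨hb2 hy, hy⟩
  refine (holo_of_lines hr hL0 (fun x hx y hy => ?_)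
    (holo_lines_limit hP hHline hr hb2 hL0 hlip')).differentiableWithinAt
  exact hlip' x (ball_subset_ball (by linarith) hx) y (ball_subset_ball (by linarith) hy)

end Slice
end

open Set Metric Bornology MvPolynomial
noncomputable section

namespace Slice
open Filter Topology

theorem extends_of_degHyp {N : ℕ} (hN : 2 ≤ N) (D : Set (EuclideanSpace ℂ (Fin N)))
    (hDopen : IsOpen D) (hDbdd : IsBounded D) (hDbdry : HasCkBoundary 2 D)
    (hDstein : HasSteinNeighbourhoodBasis (closure D))
    (𝒟 : BrouwerDegreeTheory (EuclideanSpace ℂ (Fin N)))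
    (Φ : EuclideanSpace ℂ (Fin N) → EuclideanSpace ℂ (Fin N))
    (hΦ : ContinuousOn Φ (frontier D)) (hdeg : DegHyp D 𝒟 Φ) : ExtendsHolomorphically Φ D := by
  have htietze : ∀ i : Fin N, ∃ g : EuclideanSpace ℂ (Fin N) → ℂ, Continuous g ∧ ∀ z ∈ frontier D, g z = Φ z i := by
    intro i
    have hc : ContinuousOn (fun z => Φ z i) (frontier D) :=
      (EuclideanSpace.proj i : EuclideanSpace ℂ (Fin N) →L[ℂ] ℂ).continuous.comp_continuousOn hΦ
    haveI : TietzeExtension ℂ := TietzeExtension.of_tvs ℝ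
    obtain ⟨g, hg⟩ := ContinuousMap.exists_restrict_eq (isClosed_frontier (s := D))
      (⟨(frontier D).domRestrict (fun z => Φ z i), hc.domRestrict⟩ : C(frontier D, ℂ))
    exact ⟨g, g.continuous, fun z hz => congrArg (fun k : C(frontier D, ℂ) => k ⟨z, hz⟩) hg⟩
  choose g hgc hg using htietze
  obtain ⟨Φ', hΦ'⟩ : ∃ Φ' : EuclideanSpace ℂ (Fin N) → EuclideanSpace ℂ (Fin N), ∀ z i, Φ' z i = g i z :=
    ⟨fun z => WithLp.toLp 2 (fun i => g i z), fun z i => rfl⟩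
  have hΦ'c : Continuous Φ' := by
    have : Φ' = fun z => WithLp.toLp 2 (fun i => g i z) := by funext z; ext i; exact hΦ' z i
    rw [this]
    exact (PiLp.continuous_toLp 2 _).comp (continuous_pi hgc)
  have heq : ∀ z ∈ frontier D, Φ' z = Φ z := fun z hz => by
    ext i; rw [hΦ', hg i z hz]
  have hdeg' : DegHyp D 𝒟 Φ' := by
    intro U G hU hUD hG h0 F hF hFe
    refine hdeg U G hU hUD hG (fun z hz => ?_) F hF (fun z hz => ?_)
    · rw [← heq z hz]; exact h0 z hz
    · rw [← heq z hz]; exact hFe z hz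
  have hS : ∀ i : Fin N, Setup D (fun z => Φ' z i) := by
    intro i
    haveI : Nontrivial (Fin N) := Fin.nontrivial_iff_two_le.2 hN
    obtain ⟨i', hii⟩ := exists_ne i
    refine ⟨hDopen, hDbdd, hDstein, ?_, i, i', hii, ?_⟩
    · exact (EuclideanSpace.proj i : EuclideanSpace ℂ (Fin N) →L[ℂ] ℂ).continuous.comp hΦ'c
    · intro T p0 s hs t hst a ha haD q hq
      exact degA D hDopen hDbdd 𝒟 Φ' hΦ'c hdeg' i i' hii T p0 s hs t hst a ha haD q hq
  choose H hHc hHd hHe using fun i => (hS i).extend hDbdry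
  refine ⟨fun z => WithLp.toLp 2 (fun i => H i z), ?_, ?_, fun z hz => ?_⟩
  · exact (PiLp.continuous_toLp 2 _).comp_continuousOn (continuousOn_pi.2 hHc)
  · exact differentiableOn_euclidean.2 hHd
  · rw [← heq z hz]
    ext i
    exact hHe i z hz

end Slice
end

/-- **Theorem 2.2.** Let `N ≥ 2` and let `D ⊂ ℂ^N` be a bounded domain with `C²` boundary
such that the closure of `D` has a Stein neighbourhood basis. A continuous map
`Φ : bD → ℂ^N` extends holomorphically through `D` if and only if for each holomorphic map `G`
from an open neighbourhood of the closure of `D` (which may depend on `G`) to `ℂ^N` such that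
`Φ + G ≠ 0` on `bD`, the Brouwer degree of `(Φ + G)|bD` is nonnegative. -/
theorem degree_and_holomorphic_extension_stein
    (N : ℕ) (hN : 2 ≤ N)
    (D : Set (EuclideanSpace ℂ (Fin N)))
    (hDopen : IsOpen D) (hDbdd : IsBounded D) (hDconn : IsConnected D)
    (hDbdry : HasCkBoundary 2 D)
    (hDstein : HasSteinNeighbourhoodBasis (closure D))
    (𝒟 : BrouwerDegreeTheory (EuclideanSpace ℂ (Fin N)))
    (Φ : EuclideanSpace ℂ (Fin N) → EuclideanSpace ℂ (Fin N))
    (hΦ : ContinuousOn Φ (frontier D)) :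
    ExtendsHolomorphically Φ D ↔
      ∀ (U : Set (EuclideanSpace ℂ (Fin N)))
        (G : EuclideanSpace ℂ (Fin N) → EuclideanSpace ℂ (Fin N)),
        IsOpen U → closure D ⊆ U → DifferentiableOn ℂ G U →
        (∀ z ∈ frontier D, Φ z + G z ≠ 0) →
        ∀ F : EuclideanSpace ℂ (Fin N) → EuclideanSpace ℂ (Fin N),
          ContinuousOn F (closure D) →
          (∀ z ∈ frontier D, F z = Φ z + G z) →
          0 ≤ 𝒟.deg F D 0 := by
  constructor
  · rintro ⟨g, hgc, hgd, hge⟩ U G hU hUD hG h0 F hF hFe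
    have hGc : ContinuousOn G (closure D) := hG.continuousOn.mono hUD
    have hne : ∀ z ∈ frontier D, g z + G z ≠ 0 := fun z hz => by rw [hge z hz]; exact h0 z hz
    rw [𝒟.deg_congr F (fun z => g z + G z) D hDopen hDbdd hF (hgc.add hGc)
      (fun z hz => by rw [hFe z hz, hge z hz]) (fun z hz => by rw [hFe z hz]; exact h0 z hz)]
    exact 𝒟.deg_nonneg _ D hDopen hDbdd (hgc.add hGc)
      (hgd.add (hG.mono (subset_closure.trans hUD))) hne
  · intro h
    exact Slice.extends_of_degHyp hN D hDopen hDbdd hDbdry hDstein 𝒟 Φ hΦ h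

end
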